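/- Let r ≥ 2 and d = 2r, and let M be a subcomplex of I^n of dimension d whose geometric realization |M| is a compact topological d-manifold without boundary (in particular a ℤ/2-homology d-manifold, the paper's hypothesis) satisfying H_r(|M|; ℤ/2) = 0. Then a subcomplex S ⊆ M isomorphic to ∂I^{r+1} is the boundary of an (r+1)-dimensional face of M (i.e. S = ∂F̂ for some (r+1)-dimensional face F ∈ M) if and only if H_{r−1}(|M ∖ S|; ℤ/2) ≅ H_{r−1}(|M|; ℤ/2). -/

import Mathlib

/-- A face of the cube `I^n`: `none` marks a free coordinate. -/
def CubeFace (n : ℕ) : Type := Fin n → Option Bool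

namespace CubeFace

/-- The order on faces of the cube: `F ≤ G` iff every coordinate of `G` is free
or agrees with the corresponding coordinate of `F`. -/
instance (n : ℕ) : PartialOrder (CubeFace n) where
  le F G := ∀ i, G i = none ∨ F i = G i
  le_refl F i := Or.inr rfl
  le_trans F G H h1 h2 i := by
    rcases h2 i with h | h
    · exact Or.inl h
    · rcases h1 i with h' | h'
      · exact Or.inl (h ▸ h')
      · exact Or.inr (h' ▸ h)
  le_antisymm F G h1 h2 := by
    funext i
    rcases h1 i with h | h
    · rcases h2 i with h' | h'
      · rw [h, h']
      · rw [← h', h]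
    · exact h

/-- The face of `I^n` corresponding to a vertex. -/
def toFace {n : ℕ} (v : Fin n → Bool) : CubeFace n := fun i => some (v i)

/-- The vertex set of a face. -/
def verts {n : ℕ} (F : CubeFace n) : Set (Fin n → Bool) := {v | toFace v ≤ F}

/-- The dimension of a face: its number of free coordinates. -/
def dim {n : ℕ} (F : CubeFace n) : ℕ :=
  (@Finset.filter _ (fun i => F i = none) (fun i => Option.instDecidableEq (F i) none) Finset.univ).card

/-- A subcomplex of `I^n`: a nonempty, downward closed set of faces. -/
def IsSubcomplex {n : ℕ} (K : Set (CubeFace n)) : Prop :=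
  K.Nonempty ∧ ∀ F ∈ K, ∀ G : CubeFace n, G ≤ F → G ∈ K

/-- The vertex set of a subcomplex. -/
def cvert {n : ℕ} (K : Set (CubeFace n)) : Set (Fin n → Bool) := {v | toFace v ∈ K}

/-- A subcomplex `Γ ⊆ K` is face-like if, for every face `F` of `K`, the set of vertices
of `F` belonging to `Γ` is empty or the vertex set of a face of `Γ`. -/
def FaceLike {n : ℕ} (K Γ : Set (CubeFace n)) : Prop :=
  ∀ F ∈ K, verts F ∩ cvert Γ = ∅ ∨ ∃ G ∈ Γ, verts F ∩ cvert Γ = verts G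

/-- The deletion `K ∖ Γ`: the faces of `K` with no vertex in `Γ`. -/
def delete {n : ℕ} (K Γ : Set (CubeFace n)) : Set (CubeFace n) :=
  {F | F ∈ K ∧ verts F ∩ cvert Γ = ∅}

/-- The geometric realization of a subcomplex of `I^n`, as a subset of `ℝ^n`. -/
def real {n : ℕ} (K : Set (CubeFace n)) : Set (Fin n → ℝ) :=
  ⋃ F ∈ K, {x | (∀ i, 0 ≤ x i ∧ x i ≤ 1) ∧
    ∀ i, (F i = some false → x i = 0) ∧ (F i = some true → x i = 1)}

/-- The boundary `∂F̂` of a face `F`: all faces strictly below `F`. -/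
def bdryHat {n : ℕ} (F : CubeFace n) : Set (CubeFace n) := {G | G ≤ F ∧ G ≠ F}

/-- The boundary of the cube `I^k`: all faces except the top one. -/
def boundaryCube (k : ℕ) : Set (CubeFace k) := {F | F ≠ fun _ => none}

/-- The `k`-skeleton of a subcomplex. -/
def skel {n : ℕ} (k : ℕ) (K : Set (CubeFace n)) : Set (CubeFace n) :=
  {F | F ∈ K ∧ dim F ≤ k}

/-- Isomorphism of cubical subcomplexes: a bijection between the vertex sets under which
vertex sets of faces correspond to vertex sets of faces. -/
def Iso {m n : ℕ} (K : Set (CubeFace m)) (L : Set (CubeFace n)) : Prop :=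
  ∃ f : (Fin m → Bool) → (Fin n → Bool),
    Set.BijOn f (cvert K) (cvert L) ∧
    ∀ W : Set (Fin m → Bool), W ⊆ cvert K →
      ((∃ F ∈ K, verts F = W) ↔ (∃ G ∈ L, verts G = f '' W))

/-- `K` has dimension `d`. -/
def HasDim {n : ℕ} (K : Set (CubeFace n)) (d : ℕ) : Prop :=
  (∀ F ∈ K, dim F ≤ d) ∧ ∃ F ∈ K, dim F = d

end CubeFace

open CategoryTheory in
/-- The `j`-th singular homology of a topological space with coefficients in `R`. -/
noncomputable def sHomology (R : Type) [CommRing R] (X : Type) [TopologicalSpace X]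
    (j : ℕ) : ModuleCat R :=
  ((AlgebraicTopology.alternatingFaceMapComplex (ModuleCat R)).obj
    (((SimplicialObject.whiskering _ _).obj (ModuleCat.free R)).obj
      (TopCat.toSSet.obj (TopCat.of X)))).homology j

/-- `X` is a compact topological `d`-manifold without boundary. -/
def IsCompactManifold (X : Type) [TopologicalSpace X] (d : ℕ) : Prop :=
  CompactSpace X ∧ Nonempty (ChartedSpace (EuclideanSpace ℝ (Fin d)) X)



namespace BF
open Finset

/-- Cosimplicial-type data (augmented, without degeneracies). -/
structure Cos where
  X : ℕ → Type
  δ : ∀ k, Fin (k+1) → X k → X (k+1)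
  rel : ∀ k (i : Fin (k+2)) (j : Fin (k+1)) (x : X k),
    δ (k+1) i (δ k j x) = δ (k+1) (i.succAbove j) (δ k (j.predAbove i) x)

/-- Chains with mod two coefficients. -/
abbrev GCh (C : Cos) (E : Type) : Type := (Σ k, C.X k → E) →₀ ZMod 2

variable {C : Cos} {E E' E'' : Type}

/-- boundary of a generator. -/
noncomputable def bd0 (C : Cos) (E : Type) : (Σ k, C.X k → E) → GCh C E
  | ⟨0, _⟩ => 0
  | ⟨k+1, σ⟩ => ∑ i : Fin (k+1), Finsupp.single ⟨k, σ ∘ C.δ k i⟩ 1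

/-- boundary -/
noncomputable def bd : GCh C E →ₗ[ZMod 2] GCh C E :=
  Finsupp.linearCombination (ZMod 2) (bd0 C E)

/-- a generator -/
noncomputable def gen (k : ℕ) (σ : C.X k → E) : GCh C E := Finsupp.single ⟨k, σ⟩ 1

lemma bd_gen_zero (σ : C.X 0 → E) : bd (gen 0 σ) = 0 := by
  simp [bd, gen, bd0]

lemma bd_gen_succ (k : ℕ) (σ : C.X (k+1) → E) :
    bd (gen (k+1) σ) = ∑ i : Fin (k+1), gen k (σ ∘ C.δ k i) := by
  simp [bd, gen, bd0]

lemma zz {V : Type} [AddCommGroup V] [Module (ZMod 2) V] (x : V) : x + x = 0 := by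
  have : (2 : ZMod 2) • x = 0 := by
    rw [show (2 : ZMod 2) = 0 from rfl, zero_smul]
  rwa [two_smul] at this

lemma eq_of_add {V : Type} [AddCommGroup V] [Module (ZMod 2) V] {x y : V} (h : x + y = 0) : x = y := by
  calc x = x + (y + y) := by rw [zz, add_zero]
    _ = y := by rw [← add_assoc, h, zero_add]

lemma add_cancel {V : Type} [AddCommGroup V] [Module (ZMod 2) V] (x y : V) : x + (x + y) = y := by
  rw [← add_assoc, zz, zero_add]

lemma add_cancel' {V : Type} [AddCommGroup V] [Module (ZMod 2) V] (x y : V) : (y + x) + x = y := by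
  rw [add_assoc, zz, add_zero]

/-- double sum cancellation -/
lemma dsum {V : Type} [AddCommGroup V] [Module (ZMod 2) V] {k : ℕ}
    (f : Fin (k+2) → Fin (k+1) → V)
    (hf : ∀ i j, f i j = f (i.succAbove j) (j.predAbove i)) :
    ∑ i, ∑ j, f i j = 0 := by
  rw [← Finset.sum_product']
  refine Finset.sum_involution (fun p _ => (p.1.succAbove p.2, p.2.predAbove p.1)) ?_ ?_ ?_ ?_
  · rintro ⟨i, j⟩ _
    simp only
    rw [← hf i j, zz]
  · rintro ⟨i, j⟩ _ _ h
    simp only [Prod.mk.injEq] at h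
    exact Fin.succAbove_ne i j h.1
  · intros; simp
  · rintro ⟨i, j⟩ _
    simp only [Prod.mk.injEq]
    exact ⟨Fin.succAbove_succAbove_predAbove i j, Fin.predAbove_predAbove_succAbove i j⟩

lemma gind {P : GCh C E → Prop} (c : GCh C E) (h0 : P 0) (ha : ∀ a b, P a → P b → P (a+b))
    (hg : ∀ k σ, P (gen k σ)) : P c := by
  induction c using Finsupp.induction_linear with
  | zero => exact h0
  | add f g hf hg => exact ha _ _ hf hg
  | single a b =>
    have : b = 0 ∨ b = 1 := by revert b; decide
    rcases this with rfl | rfl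
    · simpa using h0
    · exact hg a.1 a.2

lemma lin_ext {V : Type} [AddCommGroup V] [Module (ZMod 2) V] {f g : GCh C E →ₗ[ZMod 2] V}
    (h : ∀ k σ, f (gen k σ) = g (gen k σ)) (c : GCh C E) : f c = g c := by
  refine gind (P := fun c => f c = g c) c (by simp) (fun a b ha hb => by simp [ha, hb]) h

lemma bd_bd (c : GCh C E) : bd (bd c) = 0 := by
  refine gind (P := fun c => bd (bd c) = 0) c (by simp) (fun a b ha hb => by simp [ha, hb]) ?_
  intro k σ
  match k, σ with
  | 0, σ => rw [bd_gen_zero, map_zero]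
  | 1, σ => rw [bd_gen_succ]; simp [bd_gen_zero]
  | k+2, σ =>
    rw [bd_gen_succ, map_sum]
    simp_rw [bd_gen_succ]
    apply dsum
    intro i j
    congr 1
    funext x
    simp only [Function.comp]
    rw [C.rel]

/-- pushforward -/
noncomputable def push (f : E → E') : GCh C E →ₗ[ZMod 2] GCh C E' :=
  Finsupp.lmapDomain (ZMod 2) (ZMod 2) (fun s => ⟨s.1, f ∘ s.2⟩)

lemma push_gen (f : E → E') (k) (σ : C.X k → E) : push f (gen k σ) = gen k (f ∘ σ) := by
  simp [push, gen]

lemma bd_push (f : E → E') (c : GCh C E) : bd (push f c) = push f (bd c) := by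
  refine lin_ext (f := bd ∘ₗ push f) (g := push f ∘ₗ bd) ?_ c
  intro k σ
  simp only [LinearMap.comp_apply]
  match k, σ with
  | 0, σ => rw [push_gen, bd_gen_zero, bd_gen_zero, map_zero]
  | k+1, σ =>
    rw [push_gen, bd_gen_succ, bd_gen_succ, map_sum]
    simp_rw [push_gen]
    rfl

lemma push_push (f : E → E') (g : E' → E'') (c : GCh C E) : push g (push f c) = push (g ∘ f) c := by
  refine lin_ext (f := push g ∘ₗ push f) (g := push (g ∘ f)) ?_ c
  intro k σ
  simp [push_gen, Function.comp_assoc]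

lemma push_id (c : GCh C E) : push id c = c := by
  refine lin_ext (f := push id) (g := LinearMap.id) ?_ c
  intro k σ
  simp [push_gen]

/-- projection to degree k -/
noncomputable def pr (k : ℕ) : GCh C E →ₗ[ZMod 2] GCh C E :=
  Finsupp.lsum (ZMod 2) (fun s => if s.1 = k then Finsupp.lsingle s else 0)

lemma pr_gen_same (k) (σ : C.X k → E) : pr k (gen k σ) = gen k σ := by
  simp [pr, gen]
lemma pr_gen_ne {k l} (h : l ≠ k) (σ : C.X l → E) : pr k (gen l σ) = 0 := by
  simp [pr, gen, h]

attribute [irreducible] pr bd push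

/-- degree k part -/
def Dg (k : ℕ) : Submodule (ZMod 2) (GCh C E) where
  carrier := {c | pr k c = c}
  add_mem' := by intro a b ha hb; simp only [Set.mem_ofPred_eq, map_add] at *; rw [ha, hb]
  zero_mem' := by simp
  smul_mem' := by intro r x hx; simp only [Set.mem_ofPred_eq, map_smul] at *; rw [hx]

lemma mem_Dg {k : ℕ} {c : GCh C E} : c ∈ Dg (C := C) (E := E) k ↔ pr k c = c := Iff.rfl

lemma gen_mem_Dg (k) (σ : C.X k → E) : gen k σ ∈ Dg (C := C) (E := E) k := pr_gen_same k σ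

lemma pr_pr (k) (c : GCh C E) : pr k (pr k c) = pr k c := by
  refine lin_ext (f := pr k ∘ₗ pr k) (g := pr k) ?_ c
  intro l σ
  by_cases h : l = k
  · subst h; simp [pr_gen_same]
  · simp [pr_gen_ne h]

lemma pr_mem_Dg (k) (c : GCh C E) : pr k c ∈ Dg (C := C) (E := E) k := pr_pr k c

lemma pr_bd (k) (c : GCh C E) : pr k (bd c) = bd (pr (k+1) c) := by
  refine lin_ext (f := pr k ∘ₗ bd) (g := bd ∘ₗ pr (k+1)) ?_ c
  intro l σ
  simp only [LinearMap.comp_apply]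
  match l, σ with
  | 0, σ => rw [bd_gen_zero, pr_gen_ne (by omega)]; simp
  | l+1, σ =>
    rw [bd_gen_succ, map_sum]
    by_cases h : l = k
    · subst h
      rw [pr_gen_same, bd_gen_succ]
      simp_rw [pr_gen_same]
    · rw [pr_gen_ne (by omega)]
      simp_rw [pr_gen_ne h]; simp

lemma bd_pr_zero (c : GCh C E) : bd (pr 0 c) = 0 := by
  refine lin_ext (f := bd ∘ₗ pr 0) (g := 0) ?_ c
  intro l σ
  match l, σ with
  | 0, σ => simp [pr_gen_same, bd_gen_zero]
  | l+1, σ => simp [pr_gen_ne]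

lemma pr_push (k) (f : E → E') (c : GCh C E) : pr k (push f c) = push f (pr k c) := by
  refine lin_ext (f := pr k ∘ₗ push f) (g := push f ∘ₗ pr k) ?_ c
  intro l σ
  by_cases h : l = k
  · subst h; simp [pr_gen_same, push_gen]
  · simp [pr_gen_ne h, push_gen]

lemma bd_mem_Dg {k} {c : GCh C E} (h : c ∈ Dg (C := C) (E := E) (k+1)) : bd c ∈ Dg (C := C) (E := E) k := by
  rw [mem_Dg, pr_bd, mem_Dg.1 h]

lemma bd_Dg_zero {c : GCh C E} (h : c ∈ Dg (C := C) (E := E) 0) : bd c = 0 := by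
  rw [← mem_Dg.1 h, bd_pr_zero]

end BF

set_option linter.unusedVariables false

namespace BF
open Finset

variable {C : Cos} {E E' E'' : Type}

/-- number of elements of A modulo A0 -/
noncomputable def qc {Ω : Type} [AddCommGroup Ω] [Module (ZMod 2) Ω] (A A0 : Submodule (ZMod 2) Ω) : ℕ :=
  Nat.card (A ⧸ (A0.comap A.subtype))

section qc
variable {Ω Ω' : Type} [AddCommGroup Ω] [Module (ZMod 2) Ω] [AddCommGroup Ω'] [Module (ZMod 2) Ω']

lemma neg_eq2 (x : Ω) : -x = x := by
  rw [neg_eq_iff_add_eq_zero, zz]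

lemma qmk_eq {A A0 : Submodule (ZMod 2) Ω} (x y : A) :
    (Submodule.Quotient.mk x : A ⧸ (A0.comap A.subtype)) = Submodule.Quotient.mk y ↔
      (x : Ω) + y ∈ A0 := by
  rw [Submodule.Quotient.eq, sub_eq_add_neg, neg_eq2]; simp

lemma qc_congr {A A0 : Submodule (ZMod 2) Ω} {B B0 : Submodule (ZMod 2) Ω'}
    (R : Ω → Ω' → Prop) (hadd : ∀ a a' b b', R a b → R a' b' → R (a + a') (b + b'))
    (h1 : ∀ a ∈ A, ∃ b ∈ B, R a b) (h2 : ∀ b ∈ B, ∃ a ∈ A, R a b)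
    (h3 : ∀ a ∈ A, ∀ b ∈ B, R a b → (a ∈ A0 ↔ b ∈ B0)) : qc A A0 = qc B B0 := by
  choose! f hf hR using h1
  have key : ∀ (x y : A), (x : Ω) + y ∈ A0 ↔ f x + f y ∈ B0 := fun x y =>
    h3 _ (A.add_mem x.2 y.2) _ (B.add_mem (hf _ x.2) (hf _ y.2)) (hadd _ _ _ _ (hR _ x.2) (hR _ y.2))
  let φ : (A ⧸ (A0.comap A.subtype)) → (B ⧸ (B0.comap B.subtype)) := fun q =>
    Submodule.Quotient.mk ⟨f (Quotient.out q : A), hf _ (Quotient.out q : A).2⟩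
  have hout : ∀ q : A ⧸ (A0.comap A.subtype), Submodule.Quotient.mk (Quotient.out q) = q :=
    fun q => Quotient.out_eq q
  refine Nat.card_eq_of_bijective φ ⟨?_, ?_⟩
  · intro p q h
    rw [qmk_eq] at h
    rw [← hout p, ← hout q, qmk_eq, key]
    exact h
  · intro q
    induction q using Submodule.Quotient.induction_on with
    | H b =>
    obtain ⟨a, ha, hab⟩ := h2 b b.2
    refine ⟨Submodule.Quotient.mk ⟨a, ha⟩, ?_⟩
    rw [qmk_eq]
    have := hout (Submodule.Quotient.mk ⟨a, ha⟩)
    rw [qmk_eq] at this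
    exact (h3 _ (A.add_mem (Quotient.out (Submodule.Quotient.mk (p := A0.comap A.subtype) ⟨a, ha⟩)).2 ha) _
      (B.add_mem (hf _ (Subtype.prop _)) b.2) (hadd _ _ _ _ (hR _ (Subtype.prop _)) hab)).1 this

lemma qc_one {A A0 : Submodule (ZMod 2) Ω} : qc A A0 = 1 ↔ ∀ a ∈ A, a ∈ A0 := by
  unfold qc
  rw [Nat.card_eq_one_iff_unique]
  constructor
  · rintro ⟨h, _⟩ a ha
    have := h.elim (Submodule.Quotient.mk ⟨a, ha⟩) (Submodule.Quotient.mk 0)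
    rw [qmk_eq] at this
    simpa using this
  · intro h
    refine ⟨⟨fun p q => ?_⟩, ⟨0⟩⟩
    induction p using Submodule.Quotient.induction_on with
    | H p =>
    induction q using Submodule.Quotient.induction_on with
    | H q =>
    rw [qmk_eq]
    exact h _ (A.add_mem p.2 q.2)

lemma qc_two {A A0 : Submodule (ZMod 2) Ω} : qc A A0 = 2 ↔
    ∃ a ∈ A, a ∉ A0 ∧ ∀ c ∈ A, c ∈ A0 ∨ c + a ∈ A0 := by
  unfold qc
  rw [Nat.card_eq_two_iff' (0 : A ⧸ (A0.comap A.subtype))]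
  constructor
  · rintro ⟨q, hq, hu⟩
    induction q using Submodule.Quotient.induction_on with
    | H q =>
    refine ⟨q, q.2, fun h => hq ?_, fun c hc => ?_⟩
    · rw [← Submodule.Quotient.mk_zero, qmk_eq]; simpa using h
    · by_cases h : c ∈ A0
      · exact Or.inl h
      · right
        have := hu (Submodule.Quotient.mk ⟨c, hc⟩) (fun h' => h (by
          rw [← Submodule.Quotient.mk_zero, qmk_eq] at h'; simpa using h'))
        rw [qmk_eq] at this
        exact this
  · rintro ⟨a, ha, ha0, h⟩
    refine ⟨Submodule.Quotient.mk ⟨a, ha⟩, fun h' => ha0 ?_, fun q hq => ?_⟩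
    · rw [← Submodule.Quotient.mk_zero, qmk_eq] at h'; simpa using h'
    · induction q using Submodule.Quotient.induction_on with
      | H q =>
      rw [qmk_eq]
      rcases h q q.2 with h | h
      · exact absurd (by rw [← Submodule.Quotient.mk_zero, qmk_eq]; simpa using h) hq
      · exact h

lemma qc_fin {A A0 : Submodule (ZMod 2) Ω} : qc A A0 ≠ 0 ↔ Finite (A ⧸ (A0.comap A.subtype)) := by
  unfold qc
  constructor
  · exact fun h => Nat.finite_of_card_ne_zero h
  · intro h; exact Nat.card_pos.ne'

lemma qc_fin' {A A0 : Submodule (ZMod 2) Ω} : qc A A0 ≠ 0 ↔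
    ∃ S : Set Ω, S.Finite ∧ ∀ a ∈ A, ∃ s ∈ S, a + s ∈ A0 := by
  rw [qc_fin]
  constructor
  · intro h
    refine ⟨Set.range (fun q : A ⧸ (A0.comap A.subtype) => ((Quotient.out q : A) : Ω)), Set.finite_range _, ?_⟩
    intro a ha
    refine ⟨_, ⟨Submodule.Quotient.mk ⟨a, ha⟩, rfl⟩, ?_⟩
    have : Submodule.Quotient.mk (Quotient.out (Submodule.Quotient.mk (p := A0.comap A.subtype) ⟨a, ha⟩)) =
      Submodule.Quotient.mk (p := A0.comap A.subtype) ⟨a, ha⟩ := Quotient.out_eq _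
    rw [eq_comm, qmk_eq] at this
    exact this
  · rintro ⟨S, hS, h⟩
    choose! f hf hf' using h
    have : Finite S := hS
    refine Finite.of_injective (β := S) (fun q => ⟨f (Quotient.out q : A), hf _ (Subtype.prop _)⟩) ?_
    intro p q hpq
    simp only [Subtype.mk.injEq] at hpq
    have hout : ∀ q : A ⧸ (A0.comap A.subtype), Submodule.Quotient.mk (Quotient.out q) = q :=
      fun q => Quotient.out_eq q
    rw [← hout p, ← hout q, qmk_eq]
    have := A0.add_mem (hf' _ (Quotient.out p : A).2) (hf' _ (Quotient.out q : A).2)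
    rwa [hpq, add_add_add_comm, zz, add_zero] at this

end qc

/-- subcomplexes -/
structure IsC (V : Submodule (ZMod 2) (GCh C E)) : Prop where
  bd : ∀ c ∈ V, bd c ∈ V
  pr : ∀ k, ∀ c ∈ V, pr k c ∈ V

lemma IsC.bot : IsC (⊥ : Submodule (ZMod 2) (GCh C E)) :=
  ⟨by intro c hc; rw [Submodule.mem_bot] at hc ⊢; rw [hc, map_zero],
   by intro k c hc; rw [Submodule.mem_bot] at hc ⊢; rw [hc, map_zero]⟩

lemma IsC.inf {V W : Submodule (ZMod 2) (GCh C E)} (hV : IsC V) (hW : IsC W) : IsC (V ⊓ W) :=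
  ⟨fun c hc => ⟨hV.bd c hc.1, hW.bd c hc.2⟩, fun k c hc => ⟨hV.pr k c hc.1, hW.pr k c hc.2⟩⟩

lemma IsC.sup {V W : Submodule (ZMod 2) (GCh C E)} (hV : IsC V) (hW : IsC W) : IsC (V ⊔ W) := by
  constructor
  · intro c hc
    obtain ⟨v, hv, w, hw, rfl⟩ := Submodule.mem_sup.1 hc
    rw [map_add]
    exact Submodule.add_mem_sup (hV.bd v hv) (hW.bd w hw)
  · intro k c hc
    obtain ⟨v, hv, w, hw, rfl⟩ := Submodule.mem_sup.1 hc
    rw [map_add]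
    exact Submodule.add_mem_sup (hV.pr k v hv) (hW.pr k w hw)

/-- relative acyclicity -/
def Z (V U : Submodule (ZMod 2) (GCh C E)) : Prop := ∀ c ∈ V, bd c ∈ U → ∃ e ∈ V, c + bd e ∈ U

lemma mem_of_add {V : Submodule (ZMod 2) (GCh C E)} {a b : GCh C E} (h : a + b ∈ V) (hb : b ∈ V) : a ∈ V := by
  have := V.add_mem h hb
  rwa [add_cancel'] at this

lemma mem_of_add' {V : Submodule (ZMod 2) (GCh C E)} {a b : GCh C E} (h : a + b ∈ V) (hb : a ∈ V) : b ∈ V := by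
  have := V.add_mem hb h
  rwa [add_cancel] at this

section Z
variable {W V U U1 U2 X N : Submodule (ZMod 2) (GCh C E)}

lemma Z.refl (V : Submodule (ZMod 2) (GCh C E)) : Z V V := fun c hc _ => ⟨0, V.zero_mem, by simpa using hc⟩

lemma Z.trans (h1 : Z W V) (h2 : Z V U) (hVW : V ≤ W) (hUV : U ≤ V) : Z W U := by
  intro c hc hb
  obtain ⟨e, he, h⟩ := h1 c hc (hUV hb)
  obtain ⟨e', he', h'⟩ := h2 _ h (by rw [map_add, bd_bd, add_zero]; exact hb)
  exact ⟨e + e', W.add_mem he (hVW he'), by rwa [map_add, ← add_assoc]⟩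

lemma Z.left (h1 : Z W U) (h2 : Z V U) (hVW : V ≤ W) (hUV : U ≤ V) (hV : IsC V) : Z W V := by
  intro c hc hb
  obtain ⟨e, he, h⟩ := h2 (bd c) hb (by rw [bd_bd]; exact U.zero_mem)
  rw [← map_add] at h
  obtain ⟨e', he', h'⟩ := h1 (c + e) (W.add_mem hc (hVW he)) h
  refine ⟨e', he', ?_⟩
  have := V.add_mem (hUV h') he
  rwa [add_right_comm, add_cancel'] at this

lemma Z.right (h1 : Z W V) (h2 : Z W U) (hVW : V ≤ W) (hUV : U ≤ V) (hV : IsC V) : Z V U := by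
  intro c hc hb
  obtain ⟨e, he, h⟩ := h2 c (hVW hc) hb
  have : bd e ∈ V := mem_of_add' (hUV h) hc
  obtain ⟨e', he', h'⟩ := h1 e he this
  exact ⟨e + bd e', h', by rwa [map_add, bd_bd, add_zero]⟩

lemma Z.sup_of_inf (h : Z U2 (U1 ⊓ U2)) (h1 : IsC U1) (h2 : IsC U2) : Z (U1 ⊔ U2) U1 := by
  intro c hc hb
  obtain ⟨v, hv, w, hw, rfl⟩ := Submodule.mem_sup.1 hc
  rw [map_add] at hb
  obtain ⟨e, he, h'⟩ := h w hw ⟨mem_of_add' hb (h1.bd v hv), h2.bd w hw⟩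
  exact ⟨e, Submodule.mem_sup_right he, by rw [add_assoc]; exact U1.add_mem hv h'.1⟩

lemma Z.inf_of_sup (h : Z (U1 ⊔ U2) U1) (h1 : IsC U1) (h2 : IsC U2) : Z U2 (U1 ⊓ U2) := by
  intro c hc hb
  obtain ⟨e, he, h'⟩ := h c (Submodule.mem_sup_right hc) hb.1
  obtain ⟨v, hv, w, hw, rfl⟩ := Submodule.mem_sup.1 he
  refine ⟨w, hw, ?_, U2.add_mem hc (h2.bd w hw)⟩
  rw [map_add] at h'
  have := U1.add_mem h' (h1.bd v hv)
  rwa [show c + (bd v + bd w) + bd v = c + bd w + (bd v + bd v) by abel, zz, add_zero] at this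

end Z

/-- relative cycles in degree k -/
noncomputable def rc (k : ℕ) (V U : Submodule (ZMod 2) (GCh C E)) : Submodule (ZMod 2) (GCh C E) :=
  V ⊓ Dg k ⊓ U.comap bd

/-- relative boundaries -/
noncomputable def rb (V U : Submodule (ZMod 2) (GCh C E)) : Submodule (ZMod 2) (GCh C E) := U ⊔ V.map bd

lemma mem_rc {k : ℕ} {V U : Submodule (ZMod 2) (GCh C E)} {c : GCh C E} :
    c ∈ rc k V U ↔ (c ∈ V ∧ c ∈ Dg (C := C) (E := E) k) ∧ bd c ∈ U := by
  simp [rc]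

lemma mem_rb {V U : Submodule (ZMod 2) (GCh C E)} {c : GCh C E} :
    c ∈ rb V U ↔ ∃ e ∈ V, c + bd e ∈ U := by
  unfold rb
  rw [Submodule.mem_sup]
  constructor
  · rintro ⟨u, hu, v, ⟨e, he, rfl⟩, rfl⟩
    exact ⟨e, he, by rwa [add_cancel']⟩
  · rintro ⟨e, he, h⟩
    exact ⟨_, h, bd e, ⟨e, he, rfl⟩, by rw [add_cancel']⟩

/-- size of the relative homology -/
noncomputable def hc (k : ℕ) (V U : Submodule (ZMod 2) (GCh C E)) : ℕ := qc (rc k V U) (rb V U)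

section hc
variable {W V U U1 U2 X N N1 N2 T : Submodule (ZMod 2) (GCh C E)} {k : ℕ}

lemma hc_one : hc k V U = 1 ↔ ∀ c ∈ V, c ∈ Dg (C := C) (E := E) k → bd c ∈ U → ∃ e ∈ V, c + bd e ∈ U := by
  unfold hc
  rw [qc_one]
  constructor
  · intro h c h1 h2 h3
    exact mem_rb.1 (h c (mem_rc.2 ⟨⟨h1, h2⟩, h3⟩))
  · intro h c hc
    rw [mem_rc] at hc
    exact mem_rb.2 (h c hc.1.1 hc.1.2 hc.2)

lemma hc_of_Z (h : Z V U) : hc k V U = 1 := hc_one.2 fun c h1 _ h3 => h c h1 h3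

lemma hc_two : hc k V U = 2 ↔ ∃ a ∈ V, a ∈ Dg (C := C) (E := E) k ∧ bd a ∈ U ∧ (a ∉ rb V U) ∧
    ∀ c ∈ V, c ∈ Dg (C := C) (E := E) k → bd c ∈ U → (c ∈ rb V U ∨ c + a ∈ rb V U) := by
  unfold hc
  rw [qc_two]
  constructor
  · rintro ⟨a, ha, h1, h2⟩
    rw [mem_rc] at ha
    exact ⟨a, ha.1.1, ha.1.2, ha.2, h1, fun c h1 h2' h3 => h2 c (mem_rc.2 ⟨⟨h1, h2'⟩, h3⟩)⟩
  · rintro ⟨a, h1, h2, h3, h4, h5⟩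
    refine ⟨a, mem_rc.2 ⟨⟨h1, h2⟩, h3⟩, h4, fun c hc => ?_⟩
    rw [mem_rc] at hc
    exact h5 c hc.1.1 hc.1.2 hc.2

/-- (1) -/
lemma hc_sub (h : Z V U) (hUV : U ≤ V) (hVX : V ≤ X) (hV : IsC V) (hU : IsC U) : hc k X U = hc k X V := by
  refine qc_congr (fun a b => a + b ∈ V) ?_ ?_ ?_ ?_
  · intro a a' b b' h1 h2
    rw [add_add_add_comm]; exact V.add_mem h1 h2
  · intro a ha
    rw [mem_rc] at ha
    exact ⟨a, mem_rc.2 ⟨ha.1, hUV ha.2⟩, by rw [zz]; exact V.zero_mem⟩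
  · intro b hb
    rw [mem_rc] at hb
    obtain ⟨e, he, h'⟩ := h (bd b) hb.2 (by rw [bd_bd]; exact U.zero_mem)
    refine ⟨b + pr k e, mem_rc.2 ⟨⟨X.add_mem hb.1.1 (hVX (hV.pr k e he)),
      Submodule.add_mem _ hb.1.2 (pr_mem_Dg k e)⟩, ?_⟩, ?_⟩
    · rw [← map_add] at h'
      cases k with
      | zero => rw [map_add, bd_pr_zero, bd_Dg_zero hb.1.2, add_zero]; exact U.zero_mem
      | succ k =>
        have := hU.pr k _ h'
        rwa [pr_bd, map_add, mem_Dg.1 hb.1.2] at this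
    · rw [add_right_comm, zz, zero_add]; exact hV.pr k e he
  · intro a ha b hb hab
    rw [mem_rc] at ha hb
    rw [mem_rb, mem_rb]
    constructor
    · rintro ⟨e, he, h'⟩
      refine ⟨e, he, ?_⟩
      have := V.add_mem hab (hUV h')
      rwa [show a + b + (a + bd e) = b + bd e + (a + a) by abel, zz, add_zero] at this
    · rintro ⟨e, he, h'⟩
      have := V.add_mem hab h'
      rw [show a + b + (b + bd e) = a + bd e + (b + b) by abel, zz, add_zero] at this
      obtain ⟨e', he', h''⟩ := h _ this (by rw [map_add, bd_bd, add_zero]; exact ha.2)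
      exact ⟨e + e', X.add_mem he (hVX he'), by rwa [map_add, ← add_assoc]⟩

lemma rb_add_mem {a b : GCh C E} (hab : a + b ∈ rb V U) (h : a ∈ rb V U) : b ∈ rb V U := mem_of_add' hab h

/-- (2) -/
lemma hc_big (h : Z X W) (hNW : N ≤ W) (hWX : W ≤ X) (hW : IsC W) (hX : IsC X): hc k W N = hc k X N := by
  refine qc_congr (fun a b => a + b ∈ rb X N) ?_ ?_ ?_ ?_
  · intro a a' b b' h1 h2
    rw [add_add_add_comm]; exact Submodule.add_mem _ h1 h2
  · intro a ha
    rw [mem_rc] at ha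
    exact ⟨a, mem_rc.2 ⟨⟨hWX ha.1.1, ha.1.2⟩, ha.2⟩, by rw [zz]; exact Submodule.zero_mem _⟩
  · intro b hb
    rw [mem_rc] at hb
    obtain ⟨e, he, h'⟩ := h b hb.1.1 (hNW hb.2)
    refine ⟨b + bd (pr (k+1) e), mem_rc.2 ⟨⟨?_, Submodule.add_mem _ hb.1.2 (bd_mem_Dg (pr_mem_Dg _ _))⟩, ?_⟩, ?_⟩
    · have := hW.pr k _ h'
      rwa [map_add, mem_Dg.1 hb.1.2, pr_bd] at this
    · rw [map_add, bd_bd, add_zero]; exact hb.2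
    · rw [add_right_comm, zz, zero_add]
      exact mem_rb.2 ⟨pr (k+1) e, hX.pr _ e he, by rw [zz]; exact N.zero_mem⟩
  · intro a ha b hb hab
    rw [mem_rc] at ha hb
    have : a ∈ rb W N ↔ a ∈ rb X N := by
      rw [mem_rb, mem_rb]
      constructor
      · rintro ⟨e, he, h'⟩; exact ⟨e, hWX he, h'⟩
      · rintro ⟨e, he, h'⟩
        obtain ⟨e', he', h''⟩ := h e he (mem_of_add' (hNW h') ha.1.1)
        exact ⟨e + bd e', h'', by rwa [map_add, bd_bd, add_zero]⟩
    rw [this]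
    exact ⟨fun h => mem_of_add' hab h, fun h => mem_of_add hab h⟩

/-- (3) -/
lemma hc_exc (hT : IsC T) (hN : IsC N) : hc k T (T ⊓ N) = hc k (T ⊔ N) N := by
  refine qc_congr (fun a b => a + b ∈ N) ?_ ?_ ?_ ?_
  · intro a a' b b' h1 h2
    rw [add_add_add_comm]; exact Submodule.add_mem _ h1 h2
  · intro a ha
    rw [mem_rc] at ha
    exact ⟨a, mem_rc.2 ⟨⟨Submodule.mem_sup_left ha.1.1, ha.1.2⟩, ha.2.2⟩, by rw [zz]; exact Submodule.zero_mem _⟩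
  · intro b hb
    rw [mem_rc] at hb
    obtain ⟨t, ht, s, hs, hb'⟩ := Submodule.mem_sup.1 hb.1.1
    have e1 : pr k t + b = pr k s := by
      rw [← mem_Dg.1 hb.1.2, ← hb', map_add, add_cancel]
    have e2 : pr k t + b ∈ N := by rw [e1]; exact hN.pr k s hs
    refine ⟨pr k t, mem_rc.2 ⟨⟨hT.pr k t ht, pr_mem_Dg _ _⟩, hT.bd _ (hT.pr k t ht), ?_⟩, e2⟩
    have := hN.bd _ e2
    rw [map_add] at this
    exact mem_of_add this hb.2
  · intro a ha b hb hab
    rw [mem_rc] at ha hb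
    rw [mem_rb, mem_rb]
    constructor
    · rintro ⟨e, he, h'⟩
      refine ⟨e, Submodule.mem_sup_left he, ?_⟩
      have := N.add_mem hab h'.2
      rwa [show a + b + (a + bd e) = b + bd e + (a + a) by abel, zz, add_zero] at this
    · rintro ⟨e, he, h'⟩
      obtain ⟨t, ht, s, hs, rfl⟩ := Submodule.mem_sup.1 he
      refine ⟨t, ht, T.add_mem ha.1.1 (hT.bd t ht), ?_⟩
      have := N.add_mem (N.add_mem hab h') (hN.bd s hs)
      rwa [map_add, show a + b + (b + (bd t + bd s)) + bd s = a + bd t + (b + b) + (bd s + bd s) by abel,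
        zz, zz, add_zero, add_zero] at this

/-- (5a) -/
lemma hc_bd (h : Z X N2) (h2N : N2 ≤ N) (hNX : N ≤ X) (hX : IsC X) (hN : IsC N) (hN2 : IsC N2) :
    hc (k+1) X N = hc k N N2 := by
  refine qc_congr (fun a b => bd a + b ∈ rb N N2) ?_ ?_ ?_ ?_
  · intro a a' b b' h1 h2
    rw [map_add, add_add_add_comm]; exact Submodule.add_mem _ h1 h2
  · intro a ha
    rw [mem_rc] at ha
    exact ⟨bd a, mem_rc.2 ⟨⟨ha.2, bd_mem_Dg ha.1.2⟩, by rw [bd_bd]; exact N2.zero_mem⟩,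
      by rw [zz]; exact Submodule.zero_mem _⟩
  · intro b hb
    rw [mem_rc] at hb
    obtain ⟨e, he, h'⟩ := h b (hNX hb.1.1) hb.2
    have h'' := hN2.pr k _ h'
    rw [map_add, pr_bd, mem_Dg.1 hb.1.2] at h''
    refine ⟨pr (k+1) e, mem_rc.2 ⟨⟨hX.pr _ e he, pr_mem_Dg _ _⟩, mem_of_add' (h2N h'') hb.1.1⟩, ?_⟩
    rw [add_comm]
    exact mem_rb.2 ⟨0, N.zero_mem, by rw [map_zero, add_zero]; exact h''⟩
  · intro a ha b hb hab
    rw [mem_rc] at ha hb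
    have : a ∈ rb X N ↔ bd a ∈ rb N N2 := by
      rw [mem_rb, mem_rb]
      constructor
      · rintro ⟨e, he, h'⟩
        exact ⟨_, h', by rw [map_add, bd_bd, add_zero, zz]; exact N2.zero_mem⟩
      · rintro ⟨e, he, h'⟩
        rw [← map_add] at h'
        obtain ⟨e', he', h''⟩ := h _ (X.add_mem ha.1.1 (hNX he)) h'
        refine ⟨e', he', ?_⟩
        have := N.add_mem (h2N h'') he
        rwa [add_right_comm, add_cancel'] at this
    rw [this]
    exact ⟨fun h => mem_of_add' hab h, fun h => mem_of_add hab h⟩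

/-- (5) -/
lemma hc_conn (h1 : Z X N1) (h2 : Z X N2) (h : Z N (N1 ⊔ N2)) (hNX : N ≤ X) (h1N : N1 ≤ N) (h2N : N2 ≤ N)
    (hX : IsC X) (hN : IsC N) (hN1 : IsC N1) (hN2 : IsC N2) :
    hc (k+1) X N = hc k X (N1 ⊓ N2) := by
  have hs : N1 ⊔ N2 ≤ N := sup_le h1N h2N
  rw [← hc_sub h hs hNX hN (hN1.sup hN2),
    hc_bd h2 le_sup_right (hs.trans hNX) hX (hN1.sup hN2) hN2, ← hc_exc hN1 hN2,
    hc_big h1 inf_le_left (h1N.trans hNX) hN1 hX]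

/-- Mayer-Vietoris vanishing -/
lemma hc_mv (h1 : hc k X N1 = 1) (h2 : hc k X N2 = 1) (h : hc (k+1) X (N1 ⊔ N2) = 1) (hX : IsC X)
    (h1X : N1 ≤ X)
    (hN1 : IsC N1) (hN2 : IsC N2) : hc k X (N1 ⊓ N2) = 1 := by
  rw [hc_one] at *
  intro c hc hk hb
  obtain ⟨e1, he1, h1'⟩ := h1 c hc hk hb.1
  obtain ⟨e2, he2, h2'⟩ := h2 c hc hk hb.2
  have h1'' := hN1.pr k _ h1'
  have h2'' := hN2.pr k _ h2'
  rw [map_add, pr_bd, mem_Dg.1 hk] at h1'' h2''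
  have e1X := hX.pr (k+1) _ he1
  have e2X := hX.pr (k+1) _ he2
  have e1D : pr (k+1) e1 ∈ Dg (C := C) (E := E) (k+1) := pr_mem_Dg _ _
  have e2D : pr (k+1) e2 ∈ Dg (C := C) (E := E) (k+1) := pr_mem_Dg _ _
  generalize pr (k+1) e1 = f1 at *
  generalize pr (k+1) e2 = f2 at *
  have hsum : bd (f1 + f2) ∈ N1 ⊔ N2 := by
    have := Submodule.add_mem_sup h1'' h2''
    rwa [show c + bd f1 + (c + bd f2) = bd f1 + bd f2 + (c + c) by abel, zz, add_zero, ← map_add] at this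
  obtain ⟨g, hg, hg'⟩ := h (f1 + f2) (X.add_mem e1X e2X) (Submodule.add_mem _ e1D e2D) hsum
  obtain ⟨n1, hn1, n2, hn2, hn⟩ := Submodule.mem_sup.1 hg'
  have hn' : bd n1 + bd n2 = bd f1 + bd f2 := by
    rw [← map_add, hn]; simp [bd_bd]
  refine ⟨f1 + n1, X.add_mem e1X (h1X hn1), ?_, ?_⟩
  · rw [map_add, ← add_assoc]; exact N1.add_mem h1'' (hN1.bd _ hn1)
  · have e : bd f1 + bd n1 = bd f2 + bd n2 := by
      apply eq_of_add
      rw [show bd f1 + bd n1 + (bd f2 + bd n2) = (bd n1 + bd n2) + (bd f1 + bd f2) by abel, hn', zz]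
    rw [map_add, e, ← add_assoc]; exact N2.add_mem h2'' (hN2.bd _ hn2)

lemma hc_mv_inj (h1 : hc (k+1) X N1 = 1) (h2 : hc (k+1) X N2 = 1) (h : hc (k+1) X (N1 ⊔ N2) ≠ 1) (hX : IsC X)
    (h1X : N1 ≤ X) (h2X : N2 ≤ X)
    (hN1 : IsC N1) (hN2 : IsC N2) : hc k X (N1 ⊓ N2) ≠ 1 := by
  intro h3
  apply h
  rw [hc_one] at *
  intro y hy hk hb
  obtain ⟨n1, hn1, n2, hn2, hn⟩ := Submodule.mem_sup.1 hb
  have hp : pr k n1 + pr k n2 = bd y := by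
    rw [← map_add, hn, pr_bd, mem_Dg.1 hk]
  have hp1 := hN1.pr k _ hn1
  have hp2 := hN2.pr k _ hn2
  have hd1 : pr k n1 ∈ Dg (C := C) (E := E) k := pr_mem_Dg _ _
  generalize pr k n1 = c1 at *
  generalize pr k n2 = c2 at *
  have hbb : bd c1 = bd c2 := by
    apply eq_of_add
    rw [← map_add, hp, bd_bd]
  obtain ⟨e, he, he'⟩ := h3 c1 (h1X hp1) hd1 ⟨hN1.bd _ hp1, by rw [hbb]; exact hN2.bd _ hp2⟩
  have hek : pr k (c1 + bd e) ∈ N1 ⊓ N2 := (hN1.inf hN2).pr k _ he'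
  rw [map_add, pr_bd, mem_Dg.1 hd1] at hek
  have heX := hX.pr (k+1) _ he
  have heD : pr (k+1) e ∈ Dg (C := C) (E := E) (k+1) := pr_mem_Dg _ _
  generalize pr (k+1) e = f at *
  obtain ⟨g1, hg1, hg1'⟩ := h1 f heX heD (mem_of_add' hek.1 hp1)
  have hyf : bd (y + f) = c2 + (c1 + bd f) := by
    rw [map_add, ← hp]; abel
  obtain ⟨g2, hg2, hg2'⟩ := h2 (y + f) (X.add_mem hy heX) (Submodule.add_mem _ hk heD)
    (by rw [hyf]; exact N2.add_mem hp2 hek.2)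
  refine ⟨g1 + g2, X.add_mem hg1 hg2, ?_⟩
  have := Submodule.add_mem_sup hg1' hg2'
  rwa [show f + bd g1 + (y + f + bd g2) = y + (bd g1 + bd g2) + (f + f) by abel, zz, add_zero, ← map_add] at this

lemma hc_les (h1 : hc k U N ≠ 0) (h2 : hc k V U ≠ 0) (hUV : U ≤ V) (hNU : N ≤ U) (hV : IsC V) (hU : IsC U) :
    hc k V N ≠ 0 := by
  unfold hc at *
  rw [qc_fin'] at *
  obtain ⟨S2, hS2, h2⟩ := h2
  obtain ⟨S1, hS1, h1⟩ := h1
  classical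
  let c : GCh C E → GCh C E := fun s => if h : ∃ a ∈ rc k V N, a + s ∈ rb V U then h.choose else 0
  have hcs : ∀ a ∈ rc k V N, ∀ s, a + s ∈ rb V U → c s ∈ rc k V N ∧ c s + s ∈ rb V U := by
    intro a ha s h
    have h' : ∃ a ∈ rc k V N, a + s ∈ rb V U := ⟨a, ha, h⟩
    simp only [c, dif_pos h']
    exact h'.choose_spec
  refine ⟨Set.image2 (fun s t => c s + t) S2 S1, hS2.image2 _ hS1, ?_⟩
  intro a ha
  have ha' := mem_rc.1 ha
  obtain ⟨s, hs, h⟩ := h2 a (mem_rc.2 ⟨ha'.1, hNU ha'.2⟩)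
  obtain ⟨h3, h4⟩ := hcs a ha s h
  have h5 := Submodule.add_mem _ h h4
  rw [add_add_add_comm, zz, add_zero, mem_rb] at h5
  obtain ⟨e, he, h5⟩ := h5
  have h6 := Submodule.add_mem _ ha h3
  have h6' := mem_rc.1 h6
  have h7 := hU.pr k _ h5
  rw [map_add, pr_bd, mem_Dg.1 h6'.1.2] at h7
  obtain ⟨t, ht, h8⟩ := h1 (a + c s + bd (pr (k+1) e)) (mem_rc.2 ⟨⟨h7, Submodule.add_mem _ h6'.1.2
    (bd_mem_Dg (pr_mem_Dg _ _))⟩, by rw [map_add, bd_bd, add_zero]; exact h6'.2⟩)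
  obtain ⟨e', he', h8⟩ := mem_rb.1 h8
  refine ⟨_, ⟨s, hs, t, ht, rfl⟩, mem_rb.2 ⟨pr (k+1) e + e', V.add_mem (hV.pr _ _ he) (hUV he'), ?_⟩⟩
  convert h8 using 1
  rw [map_add]; beta_reduce; generalize c s = cs; abel

end hc
end BF

set_option linter.unusedVariables false

namespace BF
open Finset

/-- standard topological simplices -/
@[reducible] noncomputable def cD : Cos where
  X := fun k => stdSimplex ℝ (Fin k)
  δ := fun k i => stdSimplex.map (Fin.succAbove i)
  rel := by
    intro k i j x
    rw [stdSimplex.map_comp_apply, stdSimplex.map_comp_apply]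
    congr 1
    funext l
    exact (Fin.succAbove_succAbove_succAbove_predAbove i j l).symm

/-- finite ordinals -/
@[reducible] def cF : Cos where
  X := fun k => Fin k
  δ := fun k i => Fin.succAbove i
  rel := by
    intro k i j x
    exact (Fin.succAbove_succAbove_succAbove_predAbove i j x).symm

/-- singular chains (augmented) -/
abbrev Ch (E : Type) : Type := GCh cD E

/-- chains supported on a set -/
noncomputable def Sp {E : Type} [TopologicalSpace E] (U : Set E) : Submodule (ZMod 2) (Ch E) :=
  Finsupp.supported (ZMod 2) (ZMod 2) {s | Continuous (X := stdSimplex ℝ (Fin s.1)) s.2 ∧ ∀ t, s.2 t ∈ U}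

section Sp
variable {E E' : Type} [TopologicalSpace E] [TopologicalSpace E']

lemma gen_mem_Sp {U : Set E} {k : ℕ} {σ : stdSimplex ℝ (Fin k) → E} (h : Continuous σ) (h' : ∀ t, σ t ∈ U) :
    gen (C := cD) k σ ∈ Sp U := by
  unfold Sp gen
  apply Finsupp.single_mem_supported
  exact ⟨h, h'⟩

lemma Sp_ind {U : Set E} {P : Ch E → Prop} {c : Ch E} (hc : c ∈ Sp U) (h0 : P 0)
    (ha : ∀ a b, P a → P b → P (a + b))
    (hg : ∀ k (σ : stdSimplex ℝ (Fin k) → E), Continuous σ → (∀ t, σ t ∈ U) → P (gen (C := cD) k σ)) : P c := by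
  unfold Sp at hc
  rw [Finsupp.supported_eq_span_single] at hc
  induction hc using Submodule.span_induction with
  | mem x h =>
    obtain ⟨s, hs, rfl⟩ := h
    exact hg s.1 s.2 hs.1 hs.2
  | zero => exact h0
  | add x y _ _ hx hy => exact ha _ _ hx hy
  | smul r x _ hx =>
    have : r = 0 ∨ r = 1 := by revert r; decide
    rcases this with rfl | rfl
    · simpa using h0
    · simpa using hx

lemma Sp_mono {U V : Set E} (h : U ⊆ V) : Sp U ≤ Sp V :=
  Finsupp.supported_mono (fun s hs => ⟨hs.1, fun t => h (hs.2 t)⟩)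

lemma Sp_inter (U V : Set E) : Sp (U ∩ V) = Sp U ⊓ Sp V := by
  unfold Sp
  rw [← Finsupp.supported_inter]
  congr 1
  ext s
  constructor
  · rintro ⟨h1, h2⟩
    exact ⟨⟨h1, fun t => (h2 t).1⟩, ⟨h1, fun t => (h2 t).2⟩⟩
  · rintro ⟨⟨h1, h2⟩, ⟨h3, h4⟩⟩
    exact ⟨h1, fun t => ⟨h2 t, h4 t⟩⟩

lemma Sp_map_le {U : Set E} {V : Type} [AddCommGroup V] [Module (ZMod 2) V]
    {W : Submodule (ZMod 2) V} (f : Ch E →ₗ[ZMod 2] V)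
    (hg : ∀ k (σ : stdSimplex ℝ (Fin k) → E), Continuous σ → (∀ t, σ t ∈ U) → f (gen (C := cD) k σ) ∈ W) :
    ∀ c ∈ Sp U, f c ∈ W := by
  intro c hc
  refine Sp_ind (P := fun c => f c ∈ W) hc ?_ ?_ hg
  · simp
  · intro a b ha hb; rw [map_add]; exact W.add_mem ha hb

lemma Sp_isC (U : Set E) : IsC (Sp U) := by
  constructor
  · apply Sp_map_le
    intro k σ h1 h2
    match k, σ, h1, h2 with
    | 0, σ, h1, h2 => rw [bd_gen_zero]; exact Submodule.zero_mem _
    | k+1, σ, h1, h2 =>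
      rw [bd_gen_succ]
      exact Submodule.sum_mem _ fun i _ => gen_mem_Sp (h1.comp (stdSimplex.continuous_map _)) fun t => h2 _
  · intro l
    apply Sp_map_le
    intro k σ h1 h2
    by_cases h : k = l
    · subst h; rw [pr_gen_same]; exact gen_mem_Sp h1 h2
    · rw [pr_gen_ne h]; exact Submodule.zero_mem _

lemma push_mem {U : Set E} {V : Set E'} {f : E → E'} (hf : ContinuousOn f U) (hm : ∀ x ∈ U, f x ∈ V) :
    ∀ c ∈ Sp U, push f c ∈ Sp V := by
  apply Sp_map_le
  intro k σ h1 h2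
  rw [push_gen]
  exact gen_mem_Sp (hf.comp_continuous h1 h2) fun t => hm _ (h2 t)

end Sp

section aff
variable {W : Type} [NormedAddCommGroup W] [NormedSpace ℝ W] {K : Set W}

/-- affine simplex in a convex set -/
noncomputable def aff (hK : Convex ℝ K) {m : ℕ} (v : Fin m → K) (t : stdSimplex ℝ (Fin m)) : K :=
  ⟨∑ i, t.1 i • (v i : W), hK.sum_mem (fun i _ => t.2.1 i) t.2.2 (fun i _ => (v i).2)⟩

lemma aff_cont (hK : Convex ℝ K) {m : ℕ} (v : Fin m → K) : Continuous (aff hK v) := by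
  apply Continuous.subtype_mk
  refine continuous_finsetSum _ fun i _ => ?_
  exact ((continuous_apply i).comp continuous_subtype_val).smul continuous_const

lemma sum_map {X Y : Type} [Fintype X] [Fintype Y] (f : X → Y) (t : X → ℝ) (v : Y → W) :
    ∑ y, FunOnFinite.linearMap ℝ ℝ f t y • v y = ∑ x, t x • v (f x) := by
  classical
  simp_rw [FunOnFinite.linearMap_apply_apply, Finset.sum_smul]
  rw [← Finset.sum_fiberwise Finset.univ f]
  refine Finset.sum_congr rfl fun y _ => Finset.sum_congr rfl fun x hx => ?_
  simp at hx; rw [hx]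

lemma aff_map (hK : Convex ℝ K) {m l : ℕ} (v : Fin m → K) (f : Fin l → Fin m) (t : stdSimplex ℝ (Fin l)) :
    aff hK v (stdSimplex.map f t) = aff hK (v ∘ f) t := by
  apply Subtype.ext
  exact sum_map f t.1 (fun i => (v i : W))

/-- affine chains to singular chains -/
noncomputable def rho (hK : Convex ℝ K) : GCh cF K →ₗ[ZMod 2] Ch K :=
  Finsupp.lmapDomain (ZMod 2) (ZMod 2) (fun s => ⟨s.1, aff hK s.2⟩)

lemma rho_gen (hK : Convex ℝ K) (m : ℕ) (v : Fin m → K) : rho hK (gen (C := cF) m v) = gen (C := cD) m (aff hK v) := by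
  simp [rho, gen]

attribute [irreducible] rho

lemma rho_bd (hK : Convex ℝ K) (c : GCh cF K) : bd (rho hK c) = rho hK (bd c) := by
  refine lin_ext (f := bd ∘ₗ rho hK) (g := rho hK ∘ₗ bd) ?_ c
  intro k σ
  simp only [LinearMap.comp_apply]
  rw [rho_gen]
  match k, σ with
  | 0, σ => rw [bd_gen_zero, bd_gen_zero, map_zero]
  | k+1, σ =>
    rw [bd_gen_succ, bd_gen_succ, map_sum]
    refine Finset.sum_congr rfl fun i _ => ?_
    refine Eq.trans ?_ (rho_gen hK k (σ ∘ cF.δ k i)).symm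
    congr 1
    funext t
    exact aff_map hK σ _ t

lemma rho_mem (hK : Convex ℝ K) (c : GCh cF K) : rho hK c ∈ Sp (Set.univ : Set K) := by
  refine gind (P := fun c => rho hK c ∈ Sp (Set.univ : Set K)) c (by simp) (fun a b ha hb => by
    rw [map_add]; exact Submodule.add_mem _ ha hb) ?_
  intro k v
  rw [rho_gen]
  exact gen_mem_Sp (aff_cont hK v) (fun _ => trivial)

end aff

section cone
variable {K : Type}

/-- cone -/
noncomputable def cone (b : K) : GCh cF K →ₗ[ZMod 2] GCh cF K :=
  Finsupp.lmapDomain (ZMod 2) (ZMod 2) (fun s => ⟨s.1 + 1, (Fin.cons b s.2 : Fin (s.1+1) → K)⟩)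

lemma cone_gen (b : K) (m : ℕ) (v : Fin m → K) :
    cone b (gen (C := cF) m v) = gen (C := cF) (m+1) (Fin.cons b v : Fin (m+1) → K) := by
  simp [cone, gen]

attribute [irreducible] cone

lemma bd_cone (b : K) (c : GCh cF K) : bd (cone b c) = c + cone b (bd c) := by
  refine lin_ext (f := bd ∘ₗ cone b) (g := LinearMap.id + cone b ∘ₗ bd) ?_ c
  intro k v
  simp only [LinearMap.comp_apply, LinearMap.add_apply, LinearMap.id_apply]
  rw [cone_gen, bd_gen_succ, Fin.sum_univ_succ]
  congr 1
  match k, v with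
  | 0, v => rw [bd_gen_zero]; simp
  | k+1, v =>
    rw [bd_gen_succ, map_sum]
    refine Finset.sum_congr rfl fun i _ => ?_
    refine Eq.trans ?_ (cone_gen b k (v ∘ cF.δ k i)).symm
    congr 1
    funext t
    simp only [cF, Function.comp]
    refine Fin.cases ?_ (fun t => ?_) t
    · simp
    · simp

end cone

/-- prism -/
def Kt (k : ℕ) : Set (ℝ × (Fin k → ℝ)) := Set.Icc 0 1 ×ˢ stdSimplex ℝ (Fin k)

lemma Kt_convex (k : ℕ) : Convex ℝ (Kt k) := (convex_Icc 0 1).prod (convex_stdSimplex ℝ _)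

/-- faces of the prism -/
noncomputable def dl (k : ℕ) (i : Fin (k+1)) (p : Kt k) : Kt (k+1) :=
  ⟨(p.1.1, FunOnFinite.linearMap ℝ ℝ (Fin.succAbove i) p.1.2), p.2.1,
    (stdSimplex.map (Fin.succAbove i) ⟨p.1.2, p.2.2⟩).2⟩

/-- projection of prism -/
def sx {k : ℕ} (p : Kt k) : stdSimplex ℝ (Fin k) := ⟨p.1.2, p.2.2⟩

lemma dl_dl (k : ℕ) (i : Fin (k+2)) (j : Fin (k+1)) :
    dl (k+1) i ∘ dl k j = dl (k+1) (i.succAbove j) ∘ dl k (j.predAbove i) := by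
  funext p
  apply Subtype.ext
  refine Prod.ext rfl ?_
  exact congrArg Subtype.val (cD.rel k i j (sx p))

lemma dl_aff (k : ℕ) (i : Fin (k+1)) {m : ℕ} (v : Fin m → Kt k) :
    dl k i ∘ aff (Kt_convex k) v = aff (Kt_convex (k+1)) (dl k i ∘ v) := by
  funext t
  apply Subtype.ext
  simp [dl, aff, Prod.ext_iff, Prod.fst_sum, Prod.snd_sum]

lemma dl_cont (k : ℕ) (i : Fin (k+1)) : Continuous (dl k i) := by
  apply Continuous.subtype_mk
  refine Continuous.prodMk (by fun_prop) ?_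
  exact (FunOnFinite.continuous_linearMap ℝ ℝ _).comp (by fun_prop)

/-- rho on prisms -/
noncomputable def rh (k : ℕ) : GCh cF (Kt k) →ₗ[ZMod 2] Ch (Kt k) := rho (Kt_convex k)

lemma rh_dl (k : ℕ) (i : Fin (k+1)) (c : GCh cF (Kt k)) : rh (k+1) (push (dl k i) c) = push (dl k i) (rh k c) := by
  refine lin_ext (f := rh (k+1) ∘ₗ push (dl k i)) (g := push (dl k i) ∘ₗ rh k) ?_ c
  intro m v
  simp only [LinearMap.comp_apply, rh]
  rw [push_gen, rho_gen, rho_gen, push_gen]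
  congr 1
  exact (dl_aff k i v).symm

/-- recursion -/
noncomputable def tau (κ : ∀ k, GCh cF (Kt k)) (b : ∀ k, Kt (k+1)) (τ0 : GCh cF (Kt 0)) : ∀ k, GCh cF (Kt k)
  | 0 => τ0
  | k+1 => cone (b k) (κ (k+1) + ∑ i, push (dl k i) (tau κ b τ0 k))

/-- chain condition for universal families -/
def CM (τ κ : ∀ k, GCh cF (Kt k)) : Prop := bd (τ 0) = κ 0 ∧
  ∀ k, bd (τ (k+1)) = κ (k+1) + ∑ i, push (dl k i) (τ k)

lemma tau_CM {κ : ∀ k, GCh cF (Kt k)} {b : ∀ k, Kt (k+1)} {τ0 : GCh cF (Kt 0)}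
    (h0 : bd τ0 = κ 0) (hκ : ∀ k, bd (κ (k+1)) = ∑ i, push (dl k i) (κ k)) : CM (tau κ b τ0) κ := by
  refine ⟨h0, fun k => ?_⟩
  have key : bd (κ (k+1) + ∑ i, push (dl k i) (tau κ b τ0 k)) = 0 → 
      bd (tau κ b τ0 (k+1)) = κ (k+1) + ∑ i, push (dl k i) (tau κ b τ0 k) := by
    intro h
    rw [tau, bd_cone, h, map_zero, add_zero]
  induction k with
  | zero =>
    apply key
    rw [map_add, hκ, map_sum]
    simp_rw [bd_push]
    rw [tau, h0, zz]
  | succ k ih =>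
    apply key
    have ih' : bd (tau κ b τ0 (k+1)) = κ (k+1) + ∑ i, push (dl k i) (tau κ b τ0 k) := by
      apply ih
      intro h
      rw [tau, bd_cone, h, map_zero, add_zero]
    rw [map_add, hκ, map_sum]
    simp_rw [bd_push, ih', map_add, Finset.sum_add_distrib]
    rw [add_cancel]
    simp_rw [map_sum, push_push]
    apply dsum
    intro i j
    rw [dl_dl]

variable {E E' : Type}

/-- prism map -/
def pm (h : ℝ → E → E') {k : ℕ} (σ : stdSimplex ℝ (Fin k) → E) (p : Kt k) : E' := h p.1.1 (σ (sx p))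

/-- universal operator -/
noncomputable def op (τ : ∀ k, GCh cF (Kt k)) (h : ℝ → E → E') : Ch E →ₗ[ZMod 2] Ch E' :=
  Finsupp.linearCombination (ZMod 2) (fun s => push (pm h s.2) (rh s.1 (τ s.1)))

lemma op_gen (τ : ∀ k, GCh cF (Kt k)) (h : ℝ → E → E') (k : ℕ) (σ : stdSimplex ℝ (Fin k) → E) :
    op τ h (gen (C := cD) k σ) = push (pm h σ) (rh k (τ k)) := by
  simp [op, gen]

attribute [irreducible] op

lemma op_bd {τ κ : ∀ k, GCh cF (Kt k)} (hC : CM τ κ) (h : ℝ → E → E') (c : Ch E) :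
    bd (op τ h c) + op τ h (bd c) = op κ h c := by
  refine lin_ext (f := bd ∘ₗ op τ h + op τ h ∘ₗ bd) (g := op κ h) ?_ c
  intro k σ
  simp only [LinearMap.comp_apply, LinearMap.add_apply]
  have e := op_gen τ h k σ
  have e' := op_gen κ h k σ
  rw [e, e']
  match k, σ with
  | 0, σ =>
    rw [bd_gen_zero, map_zero, add_zero, bd_push, rh, rho_bd, hC.1]
  | k+1, σ =>
    rw [bd_gen_succ, map_sum, bd_push]
    have : bd (rh (k+1) (τ (k+1))) = rh (k+1) (κ (k+1)) + ∑ i, push (dl k i) (rh k (τ k)) := by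
      rw [rh, rho_bd, hC.2, map_add, map_sum]
      congr 1
      exact Finset.sum_congr rfl fun i _ => rh_dl k i _
    rw [this, map_add, map_sum, add_assoc]
    convert add_zero _
    rw [← Finset.sum_add_distrib]
    apply Finset.sum_eq_zero
    intro i _
    have e2 := op_gen τ h k (σ ∘ cD.δ k i)
    rw [push_push]
    refine Eq.trans (congrArg _ e2) ?_
    exact zz (push (pm h (σ ∘ cD.δ k i)) (rh k (τ k)))

lemma sx_cont {k : ℕ} : Continuous (sx (k := k)) := by
  apply Continuous.subtype_mk
  fun_prop

lemma op_mem [TopologicalSpace E] [TopologicalSpace E'] (τ : ∀ k, GCh cF (Kt k)) {h : ℝ → E → E'}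
    {V : Set E} {V' : Set E'} (hc : ContinuousOn (Function.uncurry h) (Set.Icc 0 1 ×ˢ V))
    (hm : ∀ t ∈ Set.Icc (0:ℝ) 1, ∀ x ∈ V, h t x ∈ V') : ∀ c ∈ Sp V, op τ h c ∈ Sp V' := by
  apply Sp_map_le
  intro k σ h1 h2
  rw [op_gen]
  refine push_mem (U := Set.univ) ?_ ?_ _ (rho_mem _ _)
  · rw [continuousOn_univ]
    refine hc.comp_continuous (f := fun p : Kt k => (p.1.1, σ (sx p))) ?_ ?_
    · exact Continuous.prodMk (by fun_prop) (h1.comp sx_cont)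
    · intro p
      exact ⟨p.2.1, h2 _⟩
  · intro p _
    exact hm _ p.2.1 _ (h2 _)

/-- ends of the prism -/
noncomputable def io (s : ℝ) (hs : s ∈ Set.Icc (0:ℝ) 1) (k : ℕ) : GCh cF (Kt k) :=
  gen (C := cF) k (fun j : Fin k => (⟨(s, Pi.single j 1), hs, single_mem_stdSimplex ℝ j⟩ : Kt k))

lemma io_bd (s : ℝ) (hs : s ∈ Set.Icc (0:ℝ) 1) (k : ℕ) : bd (io s hs (k+1)) = ∑ i, push (dl k i) (io s hs k) := by
  unfold io
  rw [bd_gen_succ]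
  refine Finset.sum_congr rfl fun i _ => ?_
  rw [push_gen]
  congr 1
  funext j
  apply Subtype.ext
  simp [dl, cF]

lemma op_io (s : ℝ) (hs : s ∈ Set.Icc (0:ℝ) 1) (h : ℝ → E → E') (c : Ch E) : op (io s hs) h c = push (h s) c := by
  refine lin_ext (f := op (io s hs) h) (g := push (h s)) ?_ c
  intro k σ
  rw [push_gen]
  refine (op_gen (io s hs) h k σ).trans ?_
  unfold io rh
  rw [rho_gen, push_gen]
  congr 1
  funext t
  have : (aff (Kt_convex k) (fun j : Fin k => (⟨(s, Pi.single j 1), hs, single_mem_stdSimplex ℝ j⟩ : Kt k)) t).1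
      = (s, t.1) := by
    simp only [aff]
    ext j
    · have ht : ∑ i, t.1 i = 1 := t.2.2
      simp [Prod.fst_sum, ← Finset.sum_mul, ht]
    · simp [Prod.snd_sum, Finset.sum_apply, Pi.single_apply]
  show h _ (σ _) = h s (σ t)
  have e1 : (aff (Kt_convex k) (fun j : Fin k => (⟨(s, Pi.single j 1), hs, single_mem_stdSimplex ℝ j⟩ : Kt k)) t).1.1 = s := by
    rw [this]
  rw [e1]
  congr 2
  apply Subtype.ext
  show (aff (Kt_convex k) (fun j : Fin k => (⟨(s, Pi.single j 1), hs, single_mem_stdSimplex ℝ j⟩ : Kt k)) t).1.2 = t.1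
  rw [this]

/-- barycenters -/
noncomputable def bb (k : ℕ) : Kt (k+1) := ⟨(0, fun _ => ((k:ℝ)+1)⁻¹), ⟨le_refl _, zero_le_one⟩,
  fun _ => by positivity, by simp; field_simp⟩

lemma io_zero (s : ℝ) (hs : s ∈ Set.Icc (0:ℝ) 1) : io s hs 0 = gen (C := cF) 0 (fun j : Fin 0 => j.elim0) := by
  unfold io
  congr 1
  funext j
  exact j.elim0

lemma z01 : (0:ℝ) ∈ Set.Icc (0:ℝ) 1 := ⟨le_refl _, zero_le_one⟩
lemma o01 : (1:ℝ) ∈ Set.Icc (0:ℝ) 1 := ⟨zero_le_one, le_refl _⟩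

/-- subdivision family -/
noncomputable def th : ∀ k, GCh cF (Kt k) := tau (fun _ => 0) bb (gen (C := cF) 0 (fun j : Fin 0 => j.elim0))

lemma th_CM : CM th (fun _ => 0) := tau_CM (bd_gen_zero _) (by simp)

/-- subdivision homotopy family -/
noncomputable def tT : ∀ k, GCh cF (Kt k) := tau (fun k => io 0 z01 k + th k) bb 0

lemma tT_CM : CM tT (fun k => io 0 z01 k + th k) := by
  apply tau_CM
  · rw [map_zero, io_zero]
    exact (zz _).symm
  · intro k
    rw [map_add, io_bd, th_CM.2, zero_add, ← Finset.sum_add_distrib]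
    simp_rw [map_add]

/-- prism family -/
noncomputable def tP : ∀ k, GCh cF (Kt k) := tau (fun k => io 0 z01 k + io 1 o01 k) bb 0

lemma tP_CM : CM tP (fun k => io 0 z01 k + io 1 o01 k) := by
  apply tau_CM
  · rw [map_zero, io_zero, io_zero, zz]
  · intro k
    rw [map_add, io_bd, io_bd, ← Finset.sum_add_distrib]
    simp_rw [map_add]

lemma op_add (τ τ' : ∀ k, GCh cF (Kt k)) (h : ℝ → E → E') (c : Ch E) :
    op (fun k => τ k + τ' k) h c = op τ h c + op τ' h c := by
  refine lin_ext (f := op (fun k => τ k + τ' k) h) (g := op τ h + op τ' h) ?_ c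
  intro k σ
  rw [LinearMap.add_apply]
  refine (op_gen _ h k σ).trans ?_
  rw [map_add, map_add]
  exact congrArg₂ _ (op_gen _ h k σ).symm (op_gen _ h k σ).symm

lemma op_zero (h : ℝ → E → E') (c : Ch E) : op (fun _ => 0) h c = 0 := by
  refine lin_ext (f := op (fun k => 0) h) (g := 0) ?_ c
  intro k σ
  refine (op_gen _ h k σ).trans ?_
  simp

/-- homotopy formula -/
lemma prism (h : ℝ → E → E') (c : Ch E) : bd (op tP h c) + op tP h (bd c) = push (h 0) c + push (h 1) c := by
  rw [op_bd tP_CM, op_add, op_io, op_io]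

lemma push_congr [TopologicalSpace E] {V : Set E} {f g : E → E'} (h : ∀ x ∈ V, f x = g x) (c : Ch E) (hc : c ∈ Sp V) :
    push f c = push g c := by
  refine Sp_ind (P := fun c => push f c = push g c) hc (by simp) (fun a b ha hb => by simp [ha, hb]) ?_
  intro k σ _ h2
  rw [push_gen, push_gen]
  congr 1
  funext t
  exact h _ (h2 t)

/-- homotopy theorem -/
theorem Z_of_htpy [TopologicalSpace E] {V U : Set E} (hUV : U ⊆ V) (h : ℝ → E → E)
    (hc : ContinuousOn (Function.uncurry h) (Set.Icc 0 1 ×ˢ V))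
    (h0 : ∀ x ∈ V, h 0 x = x) (h1 : ∀ x ∈ V, h 1 x ∈ U)
    (hV : ∀ t ∈ Set.Icc (0:ℝ) 1, ∀ x ∈ V, h t x ∈ V)
    (hU : ∀ t ∈ Set.Icc (0:ℝ) 1, ∀ x ∈ U, h t x ∈ U) : Z (Sp V) (Sp U) := by
  intro c hcV hb
  refine ⟨op tP h c, op_mem _ hc hV c hcV, ?_⟩
  have e := prism h c
  rw [push_congr (g := id) h0 c hcV, push_id] at e
  have e2 : c + bd (op tP h c) = op tP h (bd c) + push (h 1) c := by
    apply eq_of_add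
    rw [show c + bd (op tP h c) + (op tP h (bd c) + push (h 1) c) =
      (bd (op tP h c) + op tP h (bd c)) + (c + push (h 1) c) by abel, e, zz]
  rw [e2]
  refine Submodule.add_mem _ (op_mem _ (hc.mono (Set.prod_mono le_rfl hUV)) hU _ hb) ?_
  refine push_mem ?_ h1 c hcV
  exact hc.comp (f := fun x => ((1:ℝ), x)) (by fun_prop) (fun x hx => ⟨o01, hx⟩)

end BF

set_option linter.unusedVariables false

namespace BF
open Finset

/-- chains supported on a set of generators -/
noncomputable def Gs {C : Cos} {E : Type} (A : ∀ k, (C.X k → E) → Prop) : Submodule (ZMod 2) (GCh C E) :=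
  Finsupp.supported (ZMod 2) (ZMod 2) {s | A s.1 s.2}

section Gs
variable {C : Cos} {E : Type} {A : ∀ k, (C.X k → E) → Prop}
lemma gen_mem_Gs {k : ℕ} {σ : C.X k → E} (h : A k σ) : gen k σ ∈ Gs A := by
  unfold Gs gen
  apply Finsupp.single_mem_supported
  exact h

lemma Gs_map_le {V : Type} [AddCommGroup V] [Module (ZMod 2) V]
    {W : Submodule (ZMod 2) V} (f : GCh C E →ₗ[ZMod 2] V)
    (hg : ∀ k (σ : C.X k → E), A k σ → f (gen k σ) ∈ W) : ∀ c ∈ Gs A, f c ∈ W := by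
  intro c hc
  unfold Gs at hc
  rw [Finsupp.supported_eq_span_single] at hc
  induction hc using Submodule.span_induction with
  | mem x h =>
    obtain ⟨s, hs, rfl⟩ := h
    exact hg s.1 s.2 hs
  | zero => simp
  | add x y _ _ hx hy => rw [map_add]; exact W.add_mem hx hy
  | smul r x _ hx => rw [map_smul]; exact W.smul_mem _ hx
end Gs

/-- small affine simplices -/
def Sm (k : ℕ) (m : ℕ) (w : Fin m → Kt k) : Prop := m = k ∧ ∀ (d : ℕ) (u : Fin k → (Fin d → ℝ)) (D : ℝ),
  (∀ i j, dist (u i) (u j) ≤ D) → ∀ a b,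
    dist (∑ l, (w a).1.2 l • u l) (∑ l, (w b).1.2 l • u l) ≤ (1 - (k:ℝ)⁻¹) * D

lemma th_small (k : ℕ) : th k ∈ Gs (C := cF) (E := Kt k) (Sm k) := by
  induction k with
  | zero =>
    unfold th tau
    refine gen_mem_Gs ⟨rfl, ?_⟩
    intro d u D _ a
    exact a.elim0
  | succ k ih =>
    have e : th (k+1) = cone (bb k) (0 + ∑ i, push (dl k i) (th k)) := rfl
    rw [e, zero_add, map_sum]
    refine Submodule.sum_mem _ fun i _ => ?_
    refine Gs_map_le (A := Sm k) (C := cF) (E := Kt k) (cone (bb k) ∘ₗ push (dl k i)) ?_ _ ih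
    intro m w hw
    rw [LinearMap.comp_apply, push_gen]
    refine Set.mem_of_eq_of_mem (cone_gen (bb k) m (dl k i ∘ w)) ?_
    obtain ⟨rfl, hw⟩ := hw
    refine gen_mem_Gs ⟨rfl, ?_⟩
    intro d u D hu
    have hD : 0 ≤ D := dist_nonneg.trans (hu 0 0)
    have hk1 : (0:ℝ) < (m:ℝ) + 1 := by positivity
    -- vertex to barycenter
    have key1 : ∀ j, dist (u j) (∑ l : Fin (m+1), ((m:ℝ)+1)⁻¹ • u l) ≤ (1 - ((m:ℝ)+1)⁻¹) * D := by
      intro j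
      have e1 : u j - (∑ l : Fin (m+1), ((m:ℝ)+1)⁻¹ • u l) = ∑ l : Fin (m+1), ((m:ℝ)+1)⁻¹ • (u j - u l) := by
        simp_rw [smul_sub, Finset.sum_sub_distrib]
        congr 1
        rw [Finset.sum_const, Finset.card_univ, Fintype.card_fin, ← Nat.cast_smul_eq_nsmul ℝ, smul_smul]
        push_cast
        rw [mul_inv_cancel₀ hk1.ne', one_smul]
      rw [dist_eq_norm, e1, ← Finset.add_sum_erase _ _ (Finset.mem_univ j), sub_self, smul_zero, zero_add]
      refine (norm_sum_le _ _).trans ?_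
      have : ∀ l ∈ Finset.univ.erase j, ‖((m:ℝ)+1)⁻¹ • (u j - u l)‖ ≤ ((m:ℝ)+1)⁻¹ * D := by
        intro l _
        rw [norm_smul, Real.norm_of_nonneg (by positivity), ← dist_eq_norm]
        gcongr
        exact hu _ _
      refine (Finset.sum_le_card_nsmul _ _ _ this).trans ?_
      rw [Finset.card_erase_of_mem (Finset.mem_univ _), Finset.card_univ, Fintype.card_fin, nsmul_eq_mul]
      apply le_of_eq
      simp only [Nat.add_sub_cancel]
      field_simp
      ring
    have key2 : ∀ t ∈ stdSimplex ℝ (Fin (m+1)), dist (∑ l, t l • u l) (∑ l : Fin (m+1), ((m:ℝ)+1)⁻¹ • u l)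
        ≤ (1 - ((m:ℝ)+1)⁻¹) * D := by
      intro t ht
      have := (convex_closedBall (∑ l : Fin (m+1), ((m:ℝ)+1)⁻¹ • u l) ((1 - ((m:ℝ)+1)⁻¹) * D)).sum_mem
        (t := Finset.univ) (w := t) (z := u) (fun i _ => ht.1 i) ht.2 (fun i _ => Metric.mem_closedBall.2 (key1 i))
      exact Metric.mem_closedBall.1 this
    have hbb : ∀ l, (bb m).1.2 l = ((m:ℝ)+1)⁻¹ := fun _ => rfl
    have hnn : 0 ≤ (1 - ((m:ℝ)+1)⁻¹) * D := dist_nonneg.trans (key1 0)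
    push_cast
    intro a b
    refine Fin.cases ?_ (fun a => ?_) a
    · refine Fin.cases ?_ (fun b => ?_) b
      · rw [dist_self]; exact hnn
      · rw [Fin.cons_zero, Fin.cons_succ, dist_comm]
        simp_rw [hbb]
        exact key2 _ (dl m i (w b)).2.2
    · refine Fin.cases ?_ (fun b => ?_) b
      · rw [Fin.cons_zero, Fin.cons_succ]
        simp_rw [hbb]
        exact key2 _ (dl m i (w a)).2.2
      · rw [Fin.cons_succ, Fin.cons_succ]
        have e2 : ∀ p : Kt m, ∑ l, (dl m i p).1.2 l • u l = ∑ l, p.1.2 l • u (i.succAbove l) := by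
          intro p
          exact sum_map (Fin.succAbove i) p.1.2 u
        simp only [Function.comp]
        rw [e2, e2]
        refine (hw d (fun l => u (i.succAbove l)) D (fun _ _ => hu _ _) a b).trans ?_
        gcongr
        · have : 0 < m := Fin.pos a
          exact_mod_cast this
        · linarith

variable {E : Type}

/-- subdivision -/
noncomputable def Sd : Ch E →ₗ[ZMod 2] Ch E := op th (fun _ x => x)
/-- subdivision homotopy -/
noncomputable def TT : Ch E →ₗ[ZMod 2] Ch E := op tT (fun _ x => x)

lemma bd_Sd (c : Ch E) : bd (Sd c) = Sd (bd c) := by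
  apply eq_of_add
  unfold Sd
  rw [op_bd th_CM, op_zero]

lemma bd_TT (c : Ch E) : bd (TT c) + TT (bd c) = c + Sd c := by
  unfold TT Sd
  rw [op_bd tT_CM, op_add, op_io]
  congr 1
  exact push_id c

lemma Sd_mem [TopologicalSpace E] {V : Set E} : ∀ c ∈ Sp V, Sd c ∈ Sp V :=
  op_mem _ (continuous_snd.continuousOn) (fun _ _ _ hx => hx)
lemma TT_mem [TopologicalSpace E] {V : Set E} : ∀ c ∈ Sp V, TT c ∈ Sp V :=
  op_mem _ (continuous_snd.continuousOn) (fun _ _ _ hx => hx)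

/-- small simplices inside σ -/
def As {k : ℕ} (σ : stdSimplex ℝ (Fin k) → E) (D : ℝ) (m : ℕ) (τ : stdSimplex ℝ (Fin m) → E) : Prop :=
  m = k ∧ ∃ u : Fin m → stdSimplex ℝ (Fin k), τ = σ ∘ aff (convex_stdSimplex ℝ (Fin k)) u ∧
    ∀ i j, dist (u i) (u j) ≤ D

lemma Sd_As {k : ℕ} (σ : stdSimplex ℝ (Fin k) → E) (D : ℝ) :
    ∀ c ∈ Gs (C := cD) (As σ D), Sd c ∈ Gs (C := cD) (As σ ((1 - (k:ℝ)⁻¹) * D)) := by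
  apply Gs_map_le
  intro m τ hτ
  obtain ⟨rfl, u, rfl, hu⟩ := hτ
  unfold Sd
  rw [op_gen]
  refine Gs_map_le (A := Sm m) (C := cF) (E := Kt m)
    (push (pm (fun _ x => x) (σ ∘ aff (convex_stdSimplex ℝ (Fin m)) u)) ∘ₗ rh m) ?_ _ (th_small m)
  intro m' w hw
  obtain ⟨rfl, hw⟩ := hw
  rw [LinearMap.comp_apply, rh, rho_gen, push_gen]
  refine gen_mem_Gs ⟨rfl, fun a => aff (convex_stdSimplex ℝ (Fin m')) u (sx (w a)), ?_, ?_⟩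
  · funext t
    simp only [Function.comp, pm]
    congr 1
    apply Subtype.ext
    simp only [aff, sx, Prod.snd_sum, Finset.sum_apply, Prod.smul_snd, Pi.smul_apply, Finset.sum_smul,
      Finset.smul_sum, smul_smul]
    rw [Finset.sum_comm]
    simp only [smul_eq_mul]
  · intro i j
    exact hw m' (fun l => (u l).1) D hu i j

lemma Sd_iter {k : ℕ} (σ : stdSimplex ℝ (Fin k) → E) (N : ℕ) :
    (Sd^[N]) (gen (C := cD) k σ) ∈ Gs (C := cD) (As σ ((1 - (k:ℝ)⁻¹) ^ N)) := by
  induction N with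
  | zero =>
    refine gen_mem_Gs ⟨rfl, fun j => stdSimplex.vertex j, ?_, ?_⟩
    · funext t
      simp only [Function.comp]
      congr 1
      apply Subtype.ext
      simp only [aff]
      funext j
      simp [Finset.sum_apply, Pi.single_apply]
    · intro i j
      rw [pow_zero]
      have := i.pos
      rw [Subtype.dist_eq, dist_pi_le_iff zero_le_one]
      intro l
      simp only [Pi.single_apply]
      split_ifs <;> simp
  | succ N ih =>
    rw [Function.iterate_succ_apply', pow_succ']
    exact Sd_As σ _ _ ih

lemma small_gen [TopologicalSpace E] {V U1 U2 O1 O2 : Set E} (hO1 : IsOpen O1) (hO2 : IsOpen O2)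
    (h1 : V ∩ O1 ⊆ U1) (h2 : V ∩ O2 ⊆ U2) (hV : V ⊆ O1 ∪ O2) {k : ℕ} {σ : stdSimplex ℝ (Fin k) → E}
    (hσ : Continuous σ) (hσV : ∀ t, σ t ∈ V) :
    ∃ N, (Sd^[N]) (gen (C := cD) k σ) ∈ Sp U1 ⊔ Sp U2 := by
  rcases Nat.eq_zero_or_pos k with rfl | hk
  · refine ⟨0, Submodule.mem_sup_left (gen_mem_Sp hσ ?_)⟩
    intro t
    have := t.2.2
    simp at this
  have hcomp : IsCompact (Set.univ : Set (stdSimplex ℝ (Fin k))) :=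
    isCompact_iff_isCompact_univ.1 (isCompact_stdSimplex ℝ (Fin k))
  obtain ⟨δ, hδ, hb⟩ := lebesgue_number_lemma_of_metric (ι := Bool)
    (c := fun b => σ ⁻¹' (if b then O1 else O2)) hcomp
    (by intro b; cases b <;> simp [hO1.preimage hσ, hO2.preimage hσ])
    (by
      intro t _
      rw [Set.mem_iUnion]
      rcases hV (hσV t) with h | h
      · exact ⟨true, by simpa using h⟩
      · exact ⟨false, by simpa using h⟩)
  have hkk : (0:ℝ) < k := by exact_mod_cast hk
  have hq0 : 0 ≤ 1 - (k:ℝ)⁻¹ := by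
    rw [sub_nonneg]; apply inv_le_one_of_one_le₀; exact_mod_cast hk
  have hq1 : 1 - (k:ℝ)⁻¹ < 1 := by
    have : 0 < (k:ℝ)⁻¹ := by positivity
    linarith
  obtain ⟨N, hN⟩ := exists_pow_lt_of_lt_one hδ hq1
  refine ⟨N, ?_⟩
  have hmem := Sd_iter σ N
  have : ∀ c ∈ Gs (C := cD) (As σ ((1 - (k:ℝ)⁻¹) ^ N)), (LinearMap.id : Ch E →ₗ[ZMod 2] Ch E) c ∈ Sp U1 ⊔ Sp U2 := by
    apply Gs_map_le
    intro m τ hτ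
    obtain ⟨rfl, u, rfl, hu⟩ := hτ
    rw [LinearMap.id_apply]
    obtain ⟨b, hb⟩ := hb (u ⟨0, hk⟩) trivial
    have hin : ∀ t, σ (aff (convex_stdSimplex ℝ (Fin m)) u t) ∈ (if b then O1 else O2) := by
      intro t
      apply hb
      rw [Metric.mem_ball, Subtype.dist_eq]
      have := (convex_closedBall (u ⟨0, hk⟩ : Fin m → ℝ) ((1 - (m:ℝ)⁻¹) ^ N)).sum_mem
        (t := Finset.univ) (w := t.1) (z := fun i => (u i).1) (fun i _ => t.2.1 i) t.2.2
        (fun i _ => Metric.mem_closedBall.2 (hu i _))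
      exact (Metric.mem_closedBall.1 this).trans_lt hN
    have hcont : Continuous (σ ∘ aff (convex_stdSimplex ℝ (Fin m)) u) := hσ.comp (aff_cont _ _)
    cases b with
    | true => exact Submodule.mem_sup_left (gen_mem_Sp hcont fun t => h1 ⟨hσV _, by simpa using hin t⟩)
    | false => exact Submodule.mem_sup_right (gen_mem_Sp hcont fun t => h2 ⟨hσV _, by simpa using hin t⟩)
  exact this _ hmem

theorem Z_small [TopologicalSpace E] {V U1 U2 O1 O2 : Set E} (hO1 : IsOpen O1) (hO2 : IsOpen O2)
    (h1 : V ∩ O1 ⊆ U1) (h2 : V ∩ O2 ⊆ U2) (hV : V ⊆ O1 ∪ O2) : Z (Sp V) (Sp U1 ⊔ Sp U2) := by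
  have hSd : ∀ c ∈ Sp U1 ⊔ Sp U2, Sd c ∈ Sp U1 ⊔ Sp U2 := by
    intro c hc
    obtain ⟨a, ha, b, hb, rfl⟩ := Submodule.mem_sup.1 hc
    rw [map_add]; exact Submodule.add_mem_sup (Sd_mem _ ha) (Sd_mem _ hb)
  have hTT : ∀ c ∈ Sp U1 ⊔ Sp U2, TT c ∈ Sp U1 ⊔ Sp U2 := by
    intro c hc
    obtain ⟨a, ha, b, hb, rfl⟩ := Submodule.mem_sup.1 hc
    rw [map_add]; exact Submodule.add_mem_sup (TT_mem _ ha) (TT_mem _ hb)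
  have hit : ∀ N, ∀ c ∈ Sp U1 ⊔ Sp U2, (Sd^[N]) c ∈ Sp U1 ⊔ Sp U2 := by
    intro N
    induction N with
    | zero => exact fun c hc => hc
    | succ N ih => intro c hc; rw [Function.iterate_succ_apply]; exact ih _ (hSd _ hc)
  have hadd : ∀ N (a b : Ch E), (Sd^[N]) (a + b) = (Sd^[N]) a + (Sd^[N]) b := by
    intro N
    induction N with
    | zero => intros; rfl
    | succ N ih => intro a b; rw [Function.iterate_succ_apply, map_add, ih]; rfl
  have hN : ∀ c ∈ Sp V, ∃ N, (Sd^[N]) c ∈ Sp U1 ⊔ Sp U2 := by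
    intro c hc
    refine Sp_ind (P := fun c => ∃ N, (Sd^[N]) c ∈ Sp U1 ⊔ Sp U2) hc ⟨0, Submodule.zero_mem _⟩ ?_ ?_
    · rintro a b ⟨N, hN⟩ ⟨N', hN'⟩
      refine ⟨N + N', ?_⟩
      rw [hadd]
      refine Submodule.add_mem _ ?_ ?_
      · rw [add_comm, Function.iterate_add_apply]; exact hit _ _ hN
      · rw [Function.iterate_add_apply]; exact hit _ _ hN'
    · intro k σ hσ hσ'
      exact small_gen hO1 hO2 h1 h2 hV hσ hσ'
  have main : ∀ N, ∀ c ∈ Sp V, bd c ∈ Sp U1 ⊔ Sp U2 → (Sd^[N]) c ∈ Sp U1 ⊔ Sp U2 →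
      ∃ e ∈ Sp V, c + bd e ∈ Sp U1 ⊔ Sp U2 := by
    intro N
    induction N with
    | zero => intro c hc _ h; exact ⟨0, Submodule.zero_mem _, by simpa using h⟩
    | succ N ih =>
      intro c hc hb h
      rw [Function.iterate_succ_apply] at h
      obtain ⟨e, he, he'⟩ := ih (Sd c) (Sd_mem c hc) (by rw [bd_Sd]; exact hSd _ hb) h
      refine ⟨TT c + e, Submodule.add_mem _ (TT_mem c hc) he, ?_⟩
      have := Submodule.add_mem _ he' (hTT _ hb)
      have e2 := bd_TT c
      have e3 : c + bd (TT c + e) = Sd c + bd e + TT (bd c) := by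
        rw [map_add]
        apply eq_of_add
        rw [show c + (bd (TT c) + bd e) + (Sd c + bd e + TT (bd c)) =
          (bd (TT c) + TT (bd c)) + (c + Sd c) + (bd e + bd e) by abel, e2, zz, zz, add_zero]
      rw [e3]; exact this
  intro c hc hb
  obtain ⟨N, h⟩ := hN c hc
  exact main N c hc hb h

end BF

set_option linter.unusedVariables false

namespace BF
open Finset

section exc
variable {E E' : Type} [TopologicalSpace E] [TopologicalSpace E']

lemma Sp_diff_union (X B1 B2 : Set E) : Sp (X \ (B1 ∪ B2)) = Sp (X \ B1) ⊓ Sp (X \ B2) := by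
  rw [← Sp_inter]; congr 1; ext x; simp; tauto

lemma Z_exc (X : Set E) {B1 B2 : Set E} (h1 : IsClosed B1) (h2 : IsClosed B2) :
    Z (Sp (X \ (B1 ∩ B2))) (Sp (X \ B1) ⊔ Sp (X \ B2)) := by
  refine Z_small (O1 := B1ᶜ) (O2 := B2ᶜ) h1.isOpen_compl h2.isOpen_compl ?_ ?_ ?_
  · rintro x ⟨h, h'⟩; exact ⟨h.1, h'⟩
  · rintro x ⟨h, h'⟩; exact ⟨h.1, h'⟩
  · rintro x ⟨h, h'⟩
    simp at h' ⊢; tauto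

lemma sup_le_diff (X B1 B2 : Set E) : Sp (X \ B1) ⊔ Sp (X \ B2) ≤ Sp (X \ (B1 ∩ B2)) :=
  sup_le (Sp_mono (Set.sdiff_subset_sdiff_right Set.inter_subset_left))
    (Sp_mono (Set.sdiff_subset_sdiff_right Set.inter_subset_right))

lemma exc1 {X B1 B2 : Set E} (h1 : IsClosed B1) (h2 : IsClosed B2)
    (h : Z (Sp (X \ (B1 ∩ B2))) (Sp (X \ B1))) : Z (Sp (X \ B2)) (Sp (X \ (B1 ∪ B2))) := by
  have e := Z_exc X h1 h2
  have := Z.right e h (sup_le_diff X B1 B2) le_sup_left ((Sp_isC _).sup (Sp_isC _))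
  rw [Sp_diff_union]
  exact this.inf_of_sup (Sp_isC _) (Sp_isC _)

lemma exc2 {X B1 B2 : Set E} (h1 : IsClosed B1) (h2 : IsClosed B2)
    (h : Z (Sp (X \ B2)) (Sp (X \ (B1 ∪ B2)))) : Z (Sp (X \ (B1 ∩ B2))) (Sp (X \ B1)) := by
  have e := Z_exc X h1 h2
  rw [Sp_diff_union] at h
  have := h.sup_of_inf (Sp_isC _) (Sp_isC _)
  exact Z.trans e this (sup_le_diff X B1 B2) le_sup_left

lemma small_open {X T B : Set E} (hT : IsOpen T) (hB : IsClosed B) (hBT : B ⊆ T) {B' : Set E} (hB' : B' ⊆ B) :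
    Z (Sp (X \ B')) (Sp ((X ∩ T) \ B') ⊔ Sp (X \ B)) := by
  refine Z_small (O1 := T) (O2 := Bᶜ) hT hB.isOpen_compl ?_ ?_ ?_
  · rintro x ⟨h, h'⟩; exact ⟨⟨h.1, h'⟩, h.2⟩
  · rintro x ⟨h, h'⟩; exact ⟨h.1, h'⟩
  · rintro x ⟨h, h'⟩
    by_cases hx : x ∈ B
    · exact Or.inl (hBT hx)
    · exact Or.inr hx

lemma open_le {X T B : Set E} {B' : Set E} (hB' : B' ⊆ B) :
    Sp ((X ∩ T) \ B') ⊔ Sp (X \ B) ≤ Sp (X \ B') :=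
  sup_le (Sp_mono (Set.sdiff_subset_sdiff_left Set.inter_subset_left)) (Sp_mono (Set.sdiff_subset_sdiff_right hB'))

lemma open_inf {X T B : Set E} {B' : Set E} (hB' : B' ⊆ B) :
    Sp ((X ∩ T) \ B') ⊓ Sp (X \ B) = Sp ((X ∩ T) \ B) := by
  rw [← Sp_inter]; congr 1; ext x
  have := @hB' x
  simp; tauto

lemma hc_open {X T B : Set E} (hT : IsOpen T) (hB : IsClosed B) (hBT : B ⊆ T) (k : ℕ) :
    hc k (Sp (X ∩ T)) (Sp ((X ∩ T) \ B)) = hc k (Sp X) (Sp (X \ B)) := by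
  have h1 := small_open (X := X) hT hB hBT (Set.empty_subset B)
  have h2 := open_inf (X := X) (T := T) (Set.empty_subset B)
  have h3 := open_le (X := X) (T := T) (Set.empty_subset B)
  simp only [Set.sdiff_empty] at h1 h2 h3
  rw [← h2, hc_exc (Sp_isC _) (Sp_isC _), hc_big h1 le_sup_right h3 ((Sp_isC _).sup (Sp_isC _)) (Sp_isC _)]

lemma Z_open1 {X T B B' : Set E} (hT : IsOpen T) (hB : IsClosed B) (hBT : B ⊆ T) (hB' : B' ⊆ B)
    (h : Z (Sp ((X ∩ T) \ B')) (Sp ((X ∩ T) \ B))) : Z (Sp (X \ B')) (Sp (X \ B)) := by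
  have h1 := small_open (X := X) hT hB hBT hB'
  rw [← open_inf hB', inf_comm] at h
  have h2 := h.sup_of_inf (Sp_isC _) (Sp_isC _)
  rw [sup_comm] at h2
  exact h1.trans h2 (open_le hB') le_sup_right

lemma Z_open2 {X T B B' : Set E} (hT : IsOpen T) (hB : IsClosed B) (hBT : B ⊆ T) (hB' : B' ⊆ B)
    (h : Z (Sp (X \ B')) (Sp (X \ B))) : Z (Sp ((X ∩ T) \ B')) (Sp ((X ∩ T) \ B)) := by
  have h1 := small_open (X := X) hT hB hBT hB'
  have := h1.right h (open_le hB') le_sup_right ((Sp_isC _).sup (Sp_isC _))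
  rw [sup_comm] at this
  have := this.inf_of_sup (Sp_isC _) (Sp_isC _)
  rwa [inf_comm, open_inf hB'] at this

/-- pairs homeomorphic by partial maps -/
structure PH (V U : Set E) (V' U' : Set E') (f : E → E') (g : E' → E) : Prop where
  fc : ContinuousOn f V
  gc : ContinuousOn g V'
  fV : ∀ x ∈ V, f x ∈ V'
  gV : ∀ x ∈ V', g x ∈ V
  fU : ∀ x ∈ U, f x ∈ U'
  gU : ∀ x ∈ U', g x ∈ U
  gf : ∀ x ∈ V, g (f x) = x
  fg : ∀ x ∈ V', f (g x) = x
  UV : U ⊆ V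
  UV' : U' ⊆ V'

variable {V U : Set E} {V' U' : Set E'} {f : E → E'} {g : E' → E}

lemma PH.symm (h : PH V U V' U' f g) : PH V' U' V U g f :=
  ⟨h.gc, h.fc, h.gV, h.fV, h.gU, h.fU, h.fg, h.gf, h.UV', h.UV⟩

lemma PH.pgf (h : PH V U V' U' f g) (c : Ch E) (hc : c ∈ Sp V) : push g (push f c) = c := by
  rw [push_push, push_congr (f := g ∘ f) (g := id) h.gf c hc, push_id]

lemma PH.Z (h : PH V U V' U' f g) (hz : Z (Sp V) (Sp U)) : Z (Sp V') (Sp U') := by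
  intro c hc hb
  obtain ⟨e, he, h'⟩ := hz (push g c) (push_mem h.gc h.gV c hc) (by
    rw [bd_push]; exact push_mem (h.gc.mono h.UV') h.gU _ hb)
  refine ⟨push f e, push_mem h.fc h.fV e he, ?_⟩
  have := push_mem (h.fc.mono h.UV) h.fU _ h'
  rwa [map_add, ← bd_push, h.symm.pgf c hc] at this

lemma PH.hc (h : PH V U V' U' f g) (k : ℕ) : hc k (Sp V) (Sp U) = hc k (Sp V') (Sp U') := by
  refine qc_congr (fun a b => push f a = b) ?_ ?_ ?_ ?_
  · rintro a a' b b' rfl rfl; rw [map_add]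
  · intro a ha
    rw [mem_rc] at ha
    refine ⟨_, mem_rc.2 ⟨⟨push_mem h.fc h.fV a ha.1.1, ?_⟩, ?_⟩, rfl⟩
    · rw [mem_Dg, pr_push, mem_Dg.1 ha.1.2]
    · rw [bd_push]; exact push_mem (h.fc.mono h.UV) h.fU _ ha.2
  · intro a ha
    rw [mem_rc] at ha
    refine ⟨push g a, mem_rc.2 ⟨⟨push_mem h.gc h.gV a ha.1.1, ?_⟩, ?_⟩, h.symm.pgf a ha.1.1⟩
    · rw [mem_Dg, pr_push, mem_Dg.1 ha.1.2]
    · rw [bd_push]; exact push_mem (h.gc.mono h.UV') h.gU _ ha.2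
  · rintro a ha _ hb rfl
    rw [mem_rc] at ha
    rw [mem_rb, mem_rb]
    constructor
    · rintro ⟨e, he, h'⟩
      refine ⟨push f e, push_mem h.fc h.fV e he, ?_⟩
      rw [bd_push, ← map_add]
      exact push_mem (h.fc.mono h.UV) h.fU _ h'
    · rintro ⟨e, he, h'⟩
      refine ⟨push g e, push_mem h.gc h.gV e he, ?_⟩
      have := push_mem (h.gc.mono h.UV') h.gU _ h'
      rwa [map_add, ← bd_push, h.pgf a ha.1.1] at this

/-- cone to constant -/
noncomputable def cn (b : E) : Ch E →ₗ[ZMod 2] Ch E :=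
  Finsupp.lmapDomain (ZMod 2) (ZMod 2) (fun s => ⟨s.1 + 1, fun _ => b⟩)

lemma cn_gen (b : E) (k : ℕ) (σ : stdSimplex ℝ (Fin k) → E) :
    cn b (gen (C := cD) k σ) = gen (C := cD) (k+1) (fun _ => b) := by
  simp [cn, gen]

attribute [irreducible] cn

lemma Z_pt (b : E) : Z (Sp {b}) ⊥ := by
  have hm : ∀ c ∈ Sp {b}, cn b c ∈ Sp {b} := by
    apply Sp_map_le
    intro k σ _ _
    rw [cn_gen]
    exact gen_mem_Sp continuous_const (fun _ => rfl)
  have key : ∀ c ∈ Sp {b}, (bd ∘ₗ cn b + cn b ∘ₗ bd + LinearMap.id : Ch E →ₗ[ZMod 2] Ch E) c ∈ (⊥ : Submodule (ZMod 2) (Ch E)) := by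
    apply Sp_map_le
    intro k σ _ h2
    rw [Submodule.mem_bot]
    simp only [LinearMap.comp_apply, LinearMap.add_apply, LinearMap.id_apply]
    have hσ : σ = fun _ => b := funext h2
    rw [cn_gen, bd_gen_succ]
    match k, σ, hσ with
    | 0, σ, hσ =>
      rw [bd_gen_zero, map_zero, add_zero]
      subst hσ
      have e2 : ∀ i : Fin (0+1), gen (C := cD) 0 ((fun _ => b) ∘ cD.δ 0 i) = gen (C := cD) (E := E) 0 (fun _ => b) :=
        fun i => rfl
      simp_rw [e2]
      rw [Fin.sum_univ_succ]
      simp only [Finset.univ_eq_empty, Finset.sum_empty, add_zero]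
      exact zz _
    | k+1, σ, hσ =>
      rw [bd_gen_succ, map_sum]
      subst hσ
      have e1 : ∀ i : Fin (k+1), cn b (gen (C := cD) k ((fun _ => b) ∘ cD.δ k i)) = gen (C := cD) (k+1) (fun _ => b) :=
        fun i => cn_gen b k _
      simp_rw [e1]
      have e2 : ∀ i : Fin (k+2), gen (C := cD) (k+1) ((fun _ => b) ∘ cD.δ (k+1) i) = gen (C := cD) (k+1) (fun _ => b) :=
        fun i => rfl
      simp_rw [e2]
      rw [Fin.sum_univ_succ]
      generalize gen (C := cD) (E := E) (k+1) (fun _ => b) = y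
      rw [show ∀ s : Ch E, y + s + s + y = (y + y) + (s + s) by intro s; abel, zz, zz, add_zero]
  intro c hc hb
  have := key c hc
  rw [Submodule.mem_bot] at this hb
  simp only [LinearMap.comp_apply, LinearMap.add_apply, LinearMap.id_apply] at this
  rw [hb, map_zero, add_zero] at this
  exact ⟨cn b c, hm c hc, by rw [Submodule.mem_bot, add_comm]; exact this⟩

lemma Sp_zero_mem {U V : Set E} {c : Ch E} (hc : c ∈ Sp V) (h0 : c ∈ Dg (C := cD) (E := E) 0) : c ∈ Sp U := by
  rw [← mem_Dg.1 h0]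
  revert c
  have : ∀ c ∈ Sp V, pr 0 c ∈ Sp U := by
    apply Sp_map_le
    intro k σ h1 h2
    by_cases h : k = 0
    · subst h; rw [pr_gen_same]
      refine gen_mem_Sp h1 ?_
      intro t
      have := t.2.2
      simp at this
    · rw [pr_gen_ne h]; exact Submodule.zero_mem _
  intro c hc _
  exact this c hc

lemma hc_zero (V U : Set E) : hc 0 (Sp V) (Sp U) = 1 := by
  rw [hc_one]
  intro c hc h0 _
  exact ⟨0, Submodule.zero_mem _, by rw [map_zero, add_zero]; exact Sp_zero_mem hc h0⟩

lemma Sp_empty_le : Sp (∅ : Set E) ≤ Dg (C := cD) (E := E) 0 := by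
  intro c hc
  refine Sp_map_le (f := LinearMap.id) (U := (∅ : Set E)) ?_ c hc
  intro k σ h1 h2
  match k, σ, h2 with
  | 0, σ, _ => exact gen_mem_Dg (C := cD) (E := E) 0 σ
  | k+1, σ, h2 => exact absurd (h2 (stdSimplex.vertex 0)) (Set.notMem_empty _)

/-- the empty simplex -/
noncomputable def ge (E : Type) : Ch E := gen (C := cD) 0 (fun t : stdSimplex ℝ (Fin 0) => absurd t.2.2 (by simp))

lemma ge_ne : ge E ≠ 0 := by
  unfold ge gen
  rw [Ne, Finsupp.single_eq_zero]
  exact one_ne_zero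

lemma Sp_empty_cases {c : Ch E} (hc : c ∈ Sp (∅ : Set E)) : c = 0 ∨ c = ge E := by
  refine Sp_ind (P := fun c => c = 0 ∨ c = ge E) hc (Or.inl rfl) ?_ ?_
  · rintro a b (rfl | rfl) (rfl | rfl)
    · simp
    · simp
    · simp
    · rw [zz]; simp
  · intro k σ h1 h2
    match k, σ, h2 with
    | 0, σ, _ =>
      right
      unfold ge
      congr 1
      funext t
      have := t.2.2
      simp at this
    | k+1, σ, h2 => exact absurd (h2 (stdSimplex.vertex 0)) (Set.notMem_empty _)

lemma ge_mem (U : Set E) : ge E ∈ Sp U := by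
  refine gen_mem_Sp ?_ ?_
  · rw [continuous_iff_continuousAt]
    intro t
    have := t.2.2
    simp at this
  · intro t
    have := t.2.2
    simp at this

lemma hc_empty (k : ℕ) : hc k (Sp (∅ : Set E)) ⊥ = if k = 0 then 2 else 1 := by
  have hbd : ∀ c ∈ Sp (∅ : Set E), bd c = 0 := fun c hc => bd_Dg_zero (Sp_empty_le hc)
  split_ifs with h
  · subst h
    rw [hc_two]
    refine ⟨ge E, ge_mem _, gen_mem_Dg 0 _, ?_, ?_, ?_⟩
    · rw [Submodule.mem_bot]; exact hbd _ (ge_mem _)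
    · rw [mem_rb]
      rintro ⟨e, he, h⟩
      rw [hbd e he, add_zero, Submodule.mem_bot] at h
      exact ge_ne h
    · intro c hc _ _
      rcases Sp_empty_cases hc with rfl | rfl
      · exact Or.inl (Submodule.zero_mem _)
      · right; rw [zz]; exact Submodule.zero_mem _
  · rw [hc_one]
    intro c hc hk _
    refine ⟨0, Submodule.zero_mem _, ?_⟩
    rw [map_zero, add_zero, Submodule.mem_bot]
    have h0 := mem_Dg.1 (Sp_empty_le hc)
    have h1 := mem_Dg.1 hk
    rcases Sp_empty_cases hc with rfl | rfl
    · rfl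
    · rw [← h1]; exact pr_gen_ne (Ne.symm h) _

/-- acyclic pointed sets -/
lemma hc_acyclic_empty {V : Set E} (hV : Z (Sp V) ⊥) (k : ℕ) :
    hc k (Sp V) (Sp (∅ : Set E)) = if k = 1 then 2 else 1 := by
  cases k with
  | zero => rw [hc_zero]; rfl
  | succ k =>
    rw [hc_bd hV bot_le (Sp_mono (Set.empty_subset _)) (Sp_isC _) (Sp_isC _) IsC.bot, hc_empty]
    simp

lemma Z_star [AddCommGroup E] [Module ℝ E] [ContinuousAdd E] [ContinuousSMul ℝ E] {V : Set E} {b : E} (hb : b ∈ V)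
    (h : ∀ x ∈ V, ∀ t ∈ Set.Icc (0:ℝ) 1, (1 - t) • x + t • b ∈ V) : Z (Sp V) ⊥ := by
  refine Z.trans (V := Sp {b}) ?_ (Z_pt b) (Sp_mono (Set.singleton_subset_iff.2 hb)) bot_le
  refine Z_of_htpy (Set.singleton_subset_iff.2 hb) (fun t x => (1 - t) • x + t • b) ?_ ?_ ?_ ?_ ?_
  · apply Continuous.continuousOn
    unfold Function.uncurry
    fun_prop
  · intro x _; simp
  · intro x _; simp
  · intro t ht x hx; exact h x hx t ht
  · rintro t ht x rfl; rw [Set.mem_singleton_iff, ← add_smul]; simp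

lemma Z_star2 [AddCommGroup E] [Module ℝ E] [ContinuousAdd E] [ContinuousSMul ℝ E] {V : Set E} {b : E} (hb : b ∈ V)
    (h : ∀ x ∈ V, ∀ t ∈ Set.Icc (0:ℝ) 1, (1 - t) • x + t • b ∈ V) : Z (Sp Set.univ) (Sp V) := by
  refine Z.left (Z_star (V := Set.univ) (b := b) trivial (fun _ _ _ _ => trivial)) (Z_star hb h)
    (Sp_mono (Set.subset_univ _)) bot_le (Sp_isC _)

end exc

section loc
variable {d : ℕ}
local notation "Rd" => EuclideanSpace ℝ (Fin d)

/-- coordinate subspaces -/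
def Ls (d m : ℕ) : Set (EuclideanSpace ℝ (Fin d)) := {x | ∀ i : Fin d, m ≤ i.1 → x i = 0}

lemma Ls_closed (m : ℕ) : IsClosed (Ls d m) := by
  have : Ls d m = ⋂ i : Fin d, {x | m ≤ i.1 → x i = 0} := by ext; simp [Ls]
  rw [this]
  refine isClosed_iInter fun i => ?_
  by_cases h : m ≤ i.1
  · simp only [h, true_imp_iff]
    exact isClosed_eq (by fun_prop) continuous_const
  · simp [h]

lemma Ls_step (k m : ℕ) (hm : m < d) :
    hc (k+1) (Sp (Set.univ : Set Rd)) (Sp (Set.univ \ Ls d m)) = hc k (Sp (Set.univ : Set Rd)) (Sp (Set.univ \ Ls d (m+1))) := by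
  let j : Fin d := ⟨m, hm⟩
  have cl : ∀ s : ℝ, IsClosed (Ls d (m+1) ∩ {x | 0 ≤ s * x j}) := by
    intro s
    refine (Ls_closed _).inter (isClosed_le continuous_const (by fun_prop))
  have e1 : (Ls d (m+1) ∩ {x : Rd | 0 ≤ (1:ℝ) * x j}) ∩ (Ls d (m+1) ∩ {x | 0 ≤ (-1:ℝ) * x j}) = Ls d m := by
    ext x
    constructor
    · rintro ⟨⟨h1, h2⟩, ⟨_, h3⟩⟩
      have h2' : 0 ≤ 1 * x j := h2
      have h3' : 0 ≤ -1 * x j := h3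
      intro i hi
      rcases hi.eq_or_lt with h | h
      · have : i = j := Fin.ext h.symm
        rw [this]; linarith
      · exact h1 i h
    · intro h
      have hj : x j = 0 := h j le_rfl
      refine ⟨⟨fun i hi => h i (by omega), ?_⟩, ⟨fun i hi => h i (by omega), ?_⟩⟩
      · show 0 ≤ 1 * x j
        rw [hj]; simp
      · show 0 ≤ -1 * x j
        rw [hj]; simp
  have e2 : (Ls d (m+1) ∩ {x : Rd | 0 ≤ (1:ℝ) * x j}) ∪ (Ls d (m+1) ∩ {x | 0 ≤ (-1:ℝ) * x j}) = Ls d (m+1) := by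
    rw [← Set.inter_union_distrib_left, Set.inter_eq_left]
    intro x _
    rcases le_total 0 (x j) with h | h
    · left; show 0 ≤ 1 * x j; linarith
    · right; show 0 ≤ -1 * x j; linarith
  have star : ∀ s : ℝ, s ≠ 0 → Z (Sp (Set.univ : Set Rd)) (Sp (Set.univ \ (Ls d (m+1) ∩ {x : Rd | 0 ≤ s * x j}))) := by
    intro s hs
    have hsb : s * (EuclideanSpace.single j (-s) : Rd) j < 0 := by
      simp only [PiLp.single_apply, if_true, mul_neg]
      have : 0 < s * s := mul_self_pos.2 hs
      linarith
    refine Z_star2 (b := EuclideanSpace.single j (-s)) ⟨trivial, fun h => ?_⟩ ?_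
    · have h' : 0 ≤ s * (EuclideanSpace.single j (-s) : Rd) j := h.2
      linarith
    · rintro x ⟨_, hx⟩ t ht
      refine ⟨trivial, fun h => hx ?_⟩
      have h' : 0 ≤ s * ((1 - t) * x j + t * (EuclideanSpace.single j (-s) : Rd) j) := h.2
      have ht1 : t ≠ 1 := by
        rintro rfl
        simp only [sub_self, zero_mul, zero_add, one_mul] at h'
        linarith
      have ht2 : 0 < 1 - t := by
        have := lt_of_le_of_ne ht.2 ht1
        linarith
      constructor
      · intro i hi
        have h3 : (1 - t) * x i + t * (EuclideanSpace.single j (-s) : Rd) i = 0 := h.1 i hi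
        have hij : i ≠ j := by
          rintro rfl
          simp [j] at hi
        have : (EuclideanSpace.single j (-s) : Rd) i = 0 := by simp [hij]
        rw [this, mul_zero, add_zero] at h3
        exact (mul_eq_zero.1 h3).resolve_left ht2.ne'
      · show 0 ≤ s * x j
        have h4 : 0 ≤ (1 - t) * (s * x j) := by
          have : t * (s * (EuclideanSpace.single j (-s) : Rd) j) ≤ 0 := mul_nonpos_of_nonneg_of_nonpos ht.1 hsb.le
          linarith
        exact nonneg_of_mul_nonneg_right h4 ht2
  have hz := Z_exc (Set.univ : Set Rd) (cl 1) (cl (-1))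
  have hle := sup_le_diff (Set.univ : Set Rd) (Ls d (m+1) ∩ {x : Rd | 0 ≤ (1:ℝ) * x j}) (Ls d (m+1) ∩ {x | 0 ≤ (-1:ℝ) * x j})
  rw [e1] at hz hle
  rw [hc_conn (star 1 one_ne_zero) (star (-1) (by norm_num)) hz (Sp_mono (Set.subset_univ _))
    (le_sup_left.trans hle) (le_sup_right.trans hle) (Sp_isC _) (Sp_isC _) (Sp_isC _) (Sp_isC _),
    ← Sp_diff_union, e2]

lemma Ls_hc (k m : ℕ) (hm : m ≤ d) :
    hc k (Sp (Set.univ : Set Rd)) (Sp (Set.univ \ Ls d m)) = if k + m = d + 1 then 2 else 1 := by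
  obtain ⟨l, rfl⟩ := Nat.exists_eq_add_of_le hm
  induction l generalizing m k with
  | zero =>
    have : Ls (m+0) m = Set.univ := by
      ext x; simp only [Ls, Set.mem_ofPred_eq, Set.mem_univ, iff_true]
      intro i hi; have := i.2; omega
    rw [this, Set.sdiff_self, hc_acyclic_empty]
    · congr 1; simp; omega
    · exact Z_star (b := 0) trivial (fun _ _ _ _ => trivial)
  | succ l ih =>
    cases k with
    | zero =>
      rw [hc_zero, if_neg (by omega)]
    | succ k =>
      rw [Ls_step k m (by omega)]
      have := ih
      have e : m + (l+1) = (m+1) + l := by omega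
      clear this
      revert ih
      generalize hD : m + (l+1) = D at *
      subst e
      intro ih
      rw [ih k (m+1) (by omega)]
      congr 1
      simp; omega

/-- local homology of Euclidean space -/
lemma hc_Rd (k : ℕ) (p : Rd) :
    hc k (Sp (Set.univ : Set Rd)) (Sp (Set.univ \ {p})) = if k = d + 1 then 2 else 1 := by
  have h := Ls_hc (d := d) k 0 (Nat.zero_le _)
  have e : Ls d 0 = {0} := by
    ext x
    simp only [Ls, Set.mem_ofPred_eq, Set.mem_singleton_iff, Nat.zero_le, true_imp_iff]
    constructor
    · intro h; ext i; simpa using h i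
    · rintro rfl i; simp
  rw [e] at h
  rw [add_zero] at h
  rw [← h]
  symm
  refine PH.hc (V := Set.univ) (V' := Set.univ) (U := Set.univ \ {0}) (U' := Set.univ \ {p}) (f := fun x => x + p) (g := fun x => x - p) ⟨by fun_prop, by fun_prop, fun _ _ => trivial,
    fun _ _ => trivial, ?_, ?_, ?_, ?_, Set.subset_univ _, Set.subset_univ _⟩ k
  · rintro x ⟨_, hx⟩; exact ⟨trivial, by simpa using hx⟩
  · rintro x ⟨_, hx⟩; exact ⟨trivial, by simpa [sub_eq_zero] using hx⟩
  · intro x _; simp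
  · intro x _; simp

/-- pushing radially -/
lemma Z_ball (y q : Rd) (R : ℝ) (hR : 0 < R) (hq : q ∈ Metric.closedBall y R) :
    Z (Sp (Set.univ \ {q} : Set Rd)) (Sp (Set.univ \ Metric.closedBall y R)) := by
  have hne : ∀ x ∈ (Set.univ \ {q} : Set Rd), x - q ≠ 0 := fun x hx => sub_ne_zero.2 hx.2
  have hh : ∀ (x : Rd) (t : ℝ), x + (t * (2 * R) * ‖x - q‖⁻¹) • (x - q) - q = (1 + t * (2 * R) * ‖x - q‖⁻¹) • (x - q) := by
    intro x t
    rw [add_smul, one_smul]; abel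
  have hpos : ∀ (x : Rd) (t : ℝ), t ∈ Set.Icc (0:ℝ) 1 → 0 ≤ t * (2 * R) * ‖x - q‖⁻¹ := by
    intro x t ht
    have := ht.1
    positivity
  have hsub : (Set.univ \ Metric.closedBall y R : Set Rd) ⊆ Set.univ \ {q} := by
    rintro x ⟨_, hx⟩
    exact ⟨trivial, fun h => hx (by rw [Set.mem_singleton_iff] at h; rwa [h])⟩
  refine Z_of_htpy hsub (fun t x => x + (t * (2 * R) * ‖x - q‖⁻¹) • (x - q)) ?_ ?_ ?_ ?_ ?_
  · unfold Function.uncurry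
    refine ContinuousOn.fun_add (by fun_prop) (ContinuousOn.fun_smul
      (ContinuousOn.fun_mul (by fun_prop) (ContinuousOn.fun_inv₀ (by fun_prop) ?_)) (by fun_prop))
    rintro ⟨t, x⟩ ⟨_, hx⟩
    exact norm_ne_zero_iff.2 (hne x hx)
  · intro x _; simp
  · intro x hx
    refine ⟨trivial, fun h => ?_⟩
    rw [Metric.mem_closedBall] at h hq
    have h1 := hh x 1
    have hn : 0 < ‖x - q‖ := norm_pos_iff.2 (hne x hx)
    have h2 : ‖x + (1 * (2 * R) * ‖x - q‖⁻¹) • (x - q) - q‖ = ‖x - q‖ + 2 * R := by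
      rw [h1, norm_smul, Real.norm_of_nonneg (by positivity)]
      field_simp
    have h3 : dist (x + (1 * (2 * R) * ‖x - q‖⁻¹) • (x - q)) q ≤ R + R := by
      refine (dist_triangle _ y _).trans (add_le_add h ?_)
      rw [dist_comm]; exact hq
    rw [dist_eq_norm, h2] at h3
    linarith
  · intro t ht x hx
    refine ⟨trivial, fun h => ?_⟩
    have h1 := hh x t
    rw [Set.mem_singleton_iff] at h
    rw [h, sub_self] at h1
    have := hpos x t ht
    rcases smul_eq_zero.1 h1.symm with h2 | h2
    · linarith
    · exact hne x hx h2
  · intro t ht x hx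
    refine ⟨trivial, fun h => hx.2 ?_⟩
    have h1 := hh x t
    have h2 := hpos x t ht
    set s := t * (2 * R) * ‖x - q‖⁻¹
    have h3 := (convex_closedBall y R) hq h (a := 1 - (1 + s)⁻¹) (b := (1 + s)⁻¹)
      (by rw [sub_nonneg]; apply inv_le_one_of_one_le₀; linarith) (by positivity) (by ring)
    convert h3 using 1
    have h4 : x + s • (x - q) = q + (1 + s) • (x - q) := by rw [← h1]; abel
    rw [h4, smul_add, smul_smul, inv_mul_cancel₀ (by positivity), one_smul, sub_smul, one_smul]
    abel

end loc
end BF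

set_option linter.unusedVariables false

namespace BF
open Finset

section chart
variable {E : Type} [TopologicalSpace E] [T2Space E] {d : ℕ}

lemma chart_data {X : Set E} (hX : Nonempty (ChartedSpace (EuclideanSpace ℝ (Fin d)) ↥X)) {p : E} (hp : p ∈ X)
    {W : Set E} (hW : IsOpen W) (hpW : p ∈ W) :
    ∃ (T : Set E) (T' : Set (EuclideanSpace ℝ (Fin d))) (f : E → EuclideanSpace ℝ (Fin d))
      (g : EuclideanSpace ℝ (Fin d) → E), IsOpen T ∧ p ∈ T ∧ X ∩ T ⊆ W ∧ IsOpen T' ∧ PH (X ∩ T) ∅ T' ∅ f g ∧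
      ∀ B : Set (EuclideanSpace ℝ (Fin d)), IsOpen B → B ⊆ T' → ∃ O : Set E, IsOpen O ∧ X ∩ O = g '' B := by
  obtain ⟨cs⟩ := hX
  let e0 := chartAt (EuclideanSpace ℝ (Fin d)) (⟨p, hp⟩ : ↥X)
  let e := e0.restrOpen (Subtype.val ⁻¹' W) (hW.preimage continuous_subtype_val)
  have hsrc : e.source = e0.source ∩ Subtype.val ⁻¹' W := OpenPartialHomeomorph.restrOpen_source _ _ _
  have hpe : (⟨p, hp⟩ : ↥X) ∈ e.source := by
    rw [hsrc]; exact ⟨mem_chart_source _ _, hpW⟩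
  obtain ⟨T, hT, hTs⟩ := isOpen_induced_iff.1 e.open_source
  have hmem : ∀ x : ↥X, x ∈ e.source ↔ x.1 ∈ T := by intro x; rw [← hTs]; rfl
  classical
  let f : E → EuclideanSpace ℝ (Fin d) := fun x => if h : x ∈ X then e ⟨x, h⟩ else 0
  have hf : ∀ x : ↥X, f x.1 = e x := by
    intro x
    have : f x.1 = if h : x.1 ∈ X then e ⟨x.1, h⟩ else 0 := rfl
    rw [this, dif_pos x.2]
  refine ⟨T, e.target, f, fun y => (e.symm y).1, hT, ?_, ?_, e.open_target, ⟨?_, ?_, ?_, ?_, ?_, ?_, ?_, ?_, ?_, ?_⟩, ?_⟩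
  · exact (hmem _).1 hpe
  · rintro x ⟨hx, hxT⟩
    have := (hmem ⟨x, hx⟩).2 hxT
    rw [hsrc] at this
    exact this.2
  · have : X ∩ T = Subtype.val '' e.source := by
      ext x; constructor
      · rintro ⟨hx, hxT⟩; exact ⟨⟨x, hx⟩, (hmem _).2 hxT, rfl⟩
      · rintro ⟨y, hy, rfl⟩; exact ⟨y.2, (hmem _).1 hy⟩
    rw [this]
    have hi : Topology.IsInducing (Subtype.val : ↥X → E) := Topology.IsInducing.subtypeVal
    rintro _ ⟨y, hy, rfl⟩
    have hc : ContinuousWithinAt (f ∘ Subtype.val) e.source y := by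
      refine (e.continuousOn y hy).congr (fun z _ => hf z) (hf y)
    unfold ContinuousWithinAt at hc ⊢
    rw [← hi.map_nhdsWithin_eq]
    exact hc
  · exact continuous_subtype_val.comp_continuousOn e.symm.continuousOn
  · rintro x ⟨hx, hxT⟩
    rw [hf ⟨x, hx⟩]
    exact e.map_source ((hmem _).2 hxT)
  · intro y hy
    exact ⟨(e.symm y).2, (hmem _).1 (e.map_target hy)⟩
  · intro x hx; exact absurd hx (Set.notMem_empty _)
  · intro x hx; exact absurd hx (Set.notMem_empty _)
  · rintro x ⟨hx, hxT⟩
    rw [hf ⟨x, hx⟩, e.left_inv ((hmem _).2 hxT)]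
  · intro y hy
    rw [hf, e.right_inv hy]
  · exact Set.empty_subset _
  · exact Set.empty_subset _
  · intro B hB hBT
    have h1 := e.symm.isOpen_image_of_subset_source hB (by simpa using hBT)
    obtain ⟨O, hO, h2⟩ := isOpen_induced_iff.1 h1
    refine ⟨O, hO, ?_⟩
    ext x; constructor
    · rintro ⟨hx, hxO⟩
      have : (⟨x, hx⟩ : ↥X) ∈ Subtype.val ⁻¹' O := hxO
      rw [h2] at this
      obtain ⟨b, hb, hbx⟩ := this
      exact ⟨b, hb, congrArg Subtype.val hbx⟩
    · rintro ⟨b, hb, rfl⟩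
      refine ⟨(e.symm b).2, ?_⟩
      have : e.symm b ∈ (Subtype.val ⁻¹' O : Set ↥X) := by rw [h2]; exact ⟨b, hb, rfl⟩
      exact this

lemma PH.diff {E E' : Type} [TopologicalSpace E] [TopologicalSpace E'] {V : Set E} {V' : Set E'} {f : E → E'} {g : E' → E}
    (h : PH V ∅ V' ∅ f g) {B : Set E} {B' : Set E'} (h1 : ∀ x ∈ V, f x ∈ B' → x ∈ B) (h2 : ∀ x ∈ V, x ∈ B → f x ∈ B') :
    PH V (V \ B) V' (V' \ B') f g :=
  ⟨h.fc, h.gc, h.fV, h.gV, fun x hx => ⟨h.fV x hx.1, fun h' => hx.2 (h1 x hx.1 h')⟩,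
    fun y hy => ⟨h.gV y hy.1, fun h' => hy.2 (by have := h2 _ (h.gV y hy.1) h'; rwa [h.fg y hy.1] at this)⟩,
    h.gf, h.fg, Set.sdiff_subset, Set.sdiff_subset⟩

lemma PH.diff2 {E E' : Type} [TopologicalSpace E] [TopologicalSpace E'] {V : Set E} {V' : Set E'} {f : E → E'} {g : E' → E}
    (h : PH V ∅ V' ∅ f g) {B C : Set E} {B' C' : Set E'} (h1 : ∀ x ∈ V, f x ∈ B' ↔ x ∈ B) (h2 : ∀ x ∈ V, f x ∈ C' ↔ x ∈ C)
    (hBC : C ⊆ B) (hBC' : C' ⊆ B') :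
    PH (V \ C) (V \ B) (V' \ C') (V' \ B') f g := by
  have a := h.diff (fun x hx => (h1 x hx).1) (fun x hx => (h1 x hx).2)
  have b := h.diff (fun x hx => (h2 x hx).1) (fun x hx => (h2 x hx).2)
  exact ⟨h.fc.mono Set.sdiff_subset, h.gc.mono Set.sdiff_subset, b.fU, b.gU, a.fU, a.gU, fun x hx => h.gf x hx.1, fun x hx => h.fg x hx.1,
    Set.sdiff_subset_sdiff_right hBC, Set.sdiff_subset_sdiff_right hBC'⟩

lemma loc_hc {X : Set E} (hX : Nonempty (ChartedSpace (EuclideanSpace ℝ (Fin d)) ↥X)) {p : E} (hp : p ∈ X) (k : ℕ) :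
    hc k (Sp X) (Sp (X \ {p})) = if k = d + 1 then 2 else 1 := by
  obtain ⟨T, T', f, g, hT, hpT, _, hT', h, _⟩ := chart_data hX hp isOpen_univ trivial
  rw [← hc_open hT isClosed_singleton (Set.singleton_subset_iff.2 hpT)]
  rw [(h.diff (B := {p}) (B' := {f p}) ?_ ?_).hc]
  · have := hc_open (X := Set.univ) hT' (isClosed_singleton (x := f p)) (Set.singleton_subset_iff.2 (h.fV p ⟨hp, hpT⟩)) k
    rw [Set.univ_inter] at this
    rw [this, hc_Rd]
  · intro x hx hxp
    rw [Set.mem_singleton_iff] at hxp ⊢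
    rw [← h.gf x hx, hxp, h.gf p ⟨hp, hpT⟩]
  · rintro x hx rfl; rfl

lemma loc_ball {X : Set E} (hX : Nonempty (ChartedSpace (EuclideanSpace ℝ (Fin d)) ↥X)) {p : E} (hp : p ∈ X)
    {W : Set E} (hW : IsOpen W) (hpW : p ∈ W) :
    ∃ Bl O : Set E, IsClosed Bl ∧ Bl ⊆ W ∧ Bl ⊆ X ∧ IsOpen O ∧ p ∈ O ∧ X ∩ O ⊆ Bl ∧
      ∀ q ∈ Bl, Z (Sp (X \ {q})) (Sp (X \ Bl)) := by
  obtain ⟨T, T', f, g, hT, hpT, hTW, hT', h, hop⟩ := chart_data hX hp hW hpW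
  obtain ⟨R, hR, hball⟩ := Metric.nhds_basis_closedBall.mem_iff.1 (hT'.mem_nhds (h.fV p ⟨hp, hpT⟩))
  obtain ⟨O, hO, hOe⟩ := hop (Metric.ball (f p) R) Metric.isOpen_ball (Metric.ball_subset_closedBall.trans hball)
  have hcl : IsClosed (g '' Metric.closedBall (f p) R) :=
    ((isCompact_closedBall _ _).image_of_continuousOn (h.gc.mono hball)).isClosed
  have hsub : g '' Metric.closedBall (f p) R ⊆ X ∩ T := by
    rintro _ ⟨y, hy, rfl⟩; exact h.gV y (hball hy)
  refine ⟨g '' Metric.closedBall (f p) R, O, hcl, hsub.trans hTW, hsub.trans Set.inter_subset_left, hO, ?_, ?_, ?_⟩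
  · have : p ∈ X ∩ O := by
      rw [hOe]; exact ⟨f p, Metric.mem_ball_self hR, h.gf p ⟨hp, hpT⟩⟩
    exact this.2
  · rw [hOe]; exact Set.image_mono Metric.ball_subset_closedBall
  · rintro _ ⟨q, hq, rfl⟩
    have hgq := h.gV q (hball hq)
    have hsing : {g q} ⊆ g '' Metric.closedBall (f p) R := Set.singleton_subset_iff.2 ⟨q, hq, rfl⟩
    refine Z_open1 hT hcl (hsub.trans Set.inter_subset_right) hsing ?_
    refine (h.diff2 (C := {g q}) (C' := {q}) (B := g '' Metric.closedBall (f p) R) (B' := Metric.closedBall (f p) R) ?_ ?_ hsing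
      (Set.singleton_subset_iff.2 hq)).symm.Z ?_
    · intro x hx
      constructor
      · intro hh; exact ⟨f x, hh, h.gf x hx⟩
      · rintro ⟨y, hy, rfl⟩; rwa [h.fg y (hball hy)]
    · intro x hx
      simp only [Set.mem_singleton_iff]
      constructor
      · rintro rfl; exact (h.gf x hx).symm
      · rintro rfl; exact h.fg q (hball hq)
    · have := Z_open2 (X := Set.univ) hT' Metric.isClosed_closedBall hball (Set.singleton_subset_iff.2 hq)
        (Z_ball (f p) q R hR hq)
      rwa [Set.univ_inter] at this

end chart
end BF

set_option linter.unusedVariables false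

namespace BF
open Finset

section push
variable {n : ℕ}

/-- the cube -/
def cube (n : ℕ) : Set (Fin n → ℝ) := {x | ∀ i, 0 ≤ x i ∧ x i ≤ 1}

/-- unions of faces of the cube -/
structure Cub (X : Set (Fin n → ℝ)) : Prop where
  sub : X ⊆ cube n
  st : ∀ x ∈ X, ∀ y ∈ cube n, (∀ i, x i = 0 → y i = 0) → (∀ i, x i = 1 → y i = 1) → y ∈ X

/-- coordinate gauge -/
noncomputable def gam (a x : ℝ) : ℝ := max ((x - a) / (1 - a)) ((a - x) / a)

lemma gam_nonneg {a : ℝ} (ha : 0 ≤ a ∧ a ≤ 1) (x : ℝ) : 0 ≤ gam a x := by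
  unfold gam
  rcases le_total a x with h | h
  · exact le_max_of_le_left (div_nonneg (by linarith) (by linarith))
  · exact le_max_of_le_right (div_nonneg (by linarith) ha.1)

lemma gam_cont (a : ℝ) : Continuous (gam a) := by
  unfold gam
  exact ((continuous_id.sub continuous_const).div_const _).max ((continuous_const.sub continuous_id).div_const _)

lemma gam_scale (a x : ℝ) {s : ℝ} (hs : 0 ≤ s) : gam a (a + (x - a) * s) = s * gam a x := by
  unfold gam
  rw [mul_max_of_nonneg _ _ hs]
  congr 1 <;> ring

lemma gam_pos {a x : ℝ} (ha : 0 ≤ a ∧ a ≤ 1) (hx : 0 ≤ x ∧ x ≤ 1) (h : x ≠ a) : 0 < gam a x := by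
  unfold gam
  rcases lt_or_gt_of_ne h with h | h
  · exact lt_max_of_lt_right (div_pos (by linarith) (by linarith))
  · exact lt_max_of_lt_left (div_pos (by linarith) (by linarith))

lemma gam_le {a x : ℝ} (ha : 0 ≤ a ∧ a ≤ 1) (hx : 0 ≤ x ∧ x ≤ 1) : gam a x ≤ 1 := by
  unfold gam
  apply max_le
  · exact div_le_one_of_le₀ (by linarith) (by linarith)
  · exact div_le_one_of_le₀ (by linarith) (by linarith)

lemma gam_one {a x : ℝ} (ha : 0 ≤ a ∧ a ≤ 1) (hx : 0 ≤ x ∧ x ≤ 1) : gam a x = 1 ↔ (x = 0 ∨ x = 1) ∧ x ≠ a := by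
  unfold gam
  constructor
  · intro h
    rcases max_choice ((x - a) / (1 - a)) ((a - x) / a) with h' | h'
    · rw [h'] at h
      have h1 : 1 - a ≠ 0 := by rintro h0; rw [h0, div_zero] at h; norm_num at h
      rw [div_eq_one_iff_eq h1] at h
      refine ⟨Or.inr (by linarith), fun h2 => h1 (by linarith)⟩
    · rw [h'] at h
      have h1 : a ≠ 0 := by rintro h0; rw [h0, div_zero] at h; norm_num at h
      rw [div_eq_one_iff_eq h1] at h
      refine ⟨Or.inl (by linarith), fun h2 => h1 (by linarith)⟩
  · rintro ⟨rfl | rfl, h⟩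
    · rw [sub_zero, div_self (Ne.symm h)]
      exact max_eq_right ((div_nonpos_of_nonpos_of_nonneg (by linarith) (by linarith)).trans zero_le_one)
    · rw [div_self (sub_ne_zero.2 h)]
      exact max_eq_left ((div_nonpos_of_nonpos_of_nonneg (by linarith) (by linarith)).trans zero_le_one)

lemma gam_push {a x s : ℝ} (ha : 0 ≤ a ∧ a ≤ 1) (hx : 0 ≤ x ∧ x ≤ 1) (hs : 1 ≤ s) (h : s * gam a x ≤ 1) :
    (0 ≤ a + (x - a) * s ∧ a + (x - a) * s ≤ 1) ∧ (x = 0 → a + (x - a) * s = 0) ∧ (x = 1 → a + (x - a) * s = 1) := by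
  have hs0 : 0 ≤ s := by linarith
  refine ⟨⟨?_, ?_⟩, ?_, ?_⟩
  · rcases le_total a x with h1 | h1
    · have := mul_nonneg (sub_nonneg.2 h1) hs0; linarith
    · rcases ha.1.eq_or_lt with h2 | h2
      · have : x = a := by linarith
        rw [this]; simp; exact ha.1
      · have h3 : (a - x) / a ≤ gam a x := le_max_right _ _
        have h4 : s * ((a - x) / a) ≤ 1 := (mul_le_mul_of_nonneg_left h3 hs0).trans h
        rw [← mul_div_assoc, div_le_one h2] at h4
        linarith
  · rcases le_total x a with h1 | h1
    · have := mul_nonneg (sub_nonneg.2 h1) hs0; linarith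
    · rcases ha.2.eq_or_lt with h2 | h2
      · have : x = a := by linarith
        rw [this]; simp; exact ha.2
      · have h3 : (x - a) / (1 - a) ≤ gam a x := le_max_left _ _
        have h4 : s * ((x - a) / (1 - a)) ≤ 1 := (mul_le_mul_of_nonneg_left h3 hs0).trans h
        rw [← mul_div_assoc, div_le_one (by linarith)] at h4
        linarith
  · intro hx0
    by_cases h1 : x = a
    · rw [← h1]; simp [hx0]
    · rw [(gam_one ha hx).2 ⟨Or.inl hx0, h1⟩] at h
      have : s = 1 := by linarith
      rw [this, hx0]; ring
  · intro hx0
    by_cases h1 : x = a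
    · rw [← h1]; simp [hx0]
    · rw [(gam_one ha hx).2 ⟨Or.inr hx0, h1⟩] at h
      have : s = 1 := by linarith
      rw [this, hx0]; ring

/-- the disc of a pattern -/
def Dq (q : Fin n → Option ℝ) : Set (Fin n → ℝ) := {x | ∀ i a, q i = some a → x i = a}

/-- the far part -/
def Pq (X : Set (Fin n → ℝ)) (q : Fin n → Option ℝ) : Set (Fin n → ℝ) :=
  {x | x ∈ X ∧ ∃ i a, q i = some a ∧ (x i = 0 ∨ x i = 1) ∧ x i ≠ a}

/-- good patterns -/
def Gq (q : Fin n → Option ℝ) : Prop := ∀ i a, q i = some a → 0 ≤ a ∧ a ≤ 1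

noncomputable def psh (q : Fin n → Option ℝ) (s : ℝ) (x : Fin n → ℝ) : Fin n → ℝ := fun i =>
  match q i with
  | none => x i
  | some a => a + (x i - a) * s

lemma psh_none {q : Fin n → Option ℝ} {i : Fin n} (h : q i = none) (s : ℝ) (x : Fin n → ℝ) : psh q s x i = x i := by
  unfold psh; rw [h]

lemma psh_some {q : Fin n → Option ℝ} {i : Fin n} {a : ℝ} (h : q i = some a) (s : ℝ) (x : Fin n → ℝ) :
    psh q s x i = a + (x i - a) * s := by
  unfold psh; rw [h]

noncomputable def gvec (q : Fin n → Option ℝ) (x : Fin n → ℝ) : Fin n → ℝ := fun i =>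
  match q i with
  | none => 0
  | some a => gam a (x i)

lemma gvec_none {q : Fin n → Option ℝ} {i : Fin n} (h : q i = none) (x : Fin n → ℝ) : gvec q x i = 0 := by
  unfold gvec; rw [h]

lemma gvec_some {q : Fin n → Option ℝ} {i : Fin n} {a : ℝ} (h : q i = some a) (x : Fin n → ℝ) :
    gvec q x i = gam a (x i) := by
  unfold gvec; rw [h]

lemma gvec_nonneg {q : Fin n → Option ℝ} (hq : Gq q) (x : Fin n → ℝ) (i : Fin n) : 0 ≤ gvec q x i := by
  cases h : q i with
  | none => rw [gvec_none h]
  | some a => rw [gvec_some h]; exact gam_nonneg (hq i a h) _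

lemma gvec_cont (q : Fin n → Option ℝ) : Continuous (gvec q) := by
  refine continuous_pi fun i => ?_
  cases h : q i with
  | none => simp_rw [gvec_none h]; exact continuous_const
  | some a => simp_rw [gvec_some h]; exact (gam_cont a).comp (continuous_apply i)

lemma gvec_le {q : Fin n → Option ℝ} (hq : Gq q) {x : Fin n → ℝ} (hx : x ∈ cube n) : ‖gvec q x‖ ≤ 1 := by
  rw [pi_norm_le_iff_of_nonneg zero_le_one]
  intro i
  rw [Real.norm_of_nonneg (gvec_nonneg hq x i)]
  cases h : q i with
  | none => rw [gvec_none h]; exact zero_le_one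
  | some a => rw [gvec_some h]; exact gam_le (hq i a h) (hx i)

lemma gvec_pos {q : Fin n → Option ℝ} (hq : Gq q) {x : Fin n → ℝ} (hx : x ∈ cube n) (h : x ∉ Dq q) : 0 < ‖gvec q x‖ := by
  unfold Dq at h
  rw [Set.mem_ofPred_eq] at h
  push Not at h
  obtain ⟨i, a, h1, h2⟩ := h
  have h3 := norm_le_pi_norm (gvec q x) i
  rw [gvec_some h1] at h3
  have := gam_pos (hq i a h1) (hx i) h2
  exact lt_of_lt_of_le (this.trans_le (Real.le_norm_self _)) h3

lemma gvec_Pq {X : Set (Fin n → ℝ)} {q : Fin n → Option ℝ} (hq : Gq q) {x : Fin n → ℝ} (hx : x ∈ cube n) (hxX : x ∈ X) :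
    x ∈ Pq X q ↔ ‖gvec q x‖ = 1 := by
  constructor
  · rintro ⟨_, i, a, h1, h2⟩
    refine le_antisymm (gvec_le hq hx) ?_
    have h3 := norm_le_pi_norm (gvec q x) i
    rw [gvec_some h1, (gam_one (hq i a h1) (hx i)).2 h2] at h3
    simpa using h3
  · intro h
    refine ⟨hxX, ?_⟩
    by_contra hne
    push Not at hne
    have : ‖gvec q x‖ < 1 := by
      rw [pi_norm_lt_iff zero_lt_one]
      intro i
      rw [Real.norm_of_nonneg (gvec_nonneg hq x i)]
      cases h : q i with
      | none => rw [gvec_none h]; exact zero_lt_one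
      | some a =>
        rw [gvec_some h]
        refine lt_of_le_of_ne (gam_le (hq i a h) (hx i)) fun h' => ?_
        have h2 := (gam_one (hq i a h) (hx i)).1 h'
        exact h2.2 (hne i a h h2.1)
    linarith

lemma gvec_psh {q : Fin n → Option ℝ} {s : ℝ} (hs : 0 ≤ s) (x : Fin n → ℝ) : gvec q (psh q s x) = s • gvec q x := by
  funext i
  rw [Pi.smul_apply, smul_eq_mul]
  cases h : q i with
  | none => rw [gvec_none h, gvec_none h, mul_zero]
  | some a => rw [gvec_some h, gvec_some h, psh_some h, gam_scale _ _ hs]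

lemma psh_mem {X : Set (Fin n → ℝ)} (hX : Cub X) {q : Fin n → Option ℝ} (hq : Gq q) {x : Fin n → ℝ} (hx : x ∈ X) {s : ℝ}
    (hs : 1 ≤ s) (h : s * ‖gvec q x‖ ≤ 1) : psh q s x ∈ X := by
  have hxc := hX.sub hx
  have key : ∀ i, (0 ≤ psh q s x i ∧ psh q s x i ≤ 1) ∧ (x i = 0 → psh q s x i = 0) ∧ (x i = 1 → psh q s x i = 1) := by
    intro i
    cases h1 : q i with
    | none => rw [psh_none h1]; exact ⟨hxc i, id, id⟩
    | some a =>
      rw [psh_some h1]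
      refine gam_push (hq i a h1) (hxc i) hs (le_trans (mul_le_mul_of_nonneg_left ?_ (by linarith)) h)
      have h3 := norm_le_pi_norm (gvec q x) i
      rw [gvec_some h1] at h3
      exact (Real.le_norm_self _).trans h3
  exact hX.st x hx _ (fun i => (key i).1) (fun i => (key i).2.1) (fun i => (key i).2.2)

lemma psh_one (q : Fin n → Option ℝ) (x : Fin n → ℝ) : psh q 1 x = x := by
  funext i
  cases h : q i with
  | none => rw [psh_none h]
  | some a => rw [psh_some h]; ring

lemma Pq_sub {X : Set (Fin n → ℝ)} (q : Fin n → Option ℝ) : Pq X q ⊆ X := fun x hx => hx.1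

lemma Z_push {X : Set (Fin n → ℝ)} (hX : Cub X) {q : Fin n → Option ℝ} (hq : Gq q) {B : Set (Fin n → ℝ)}
    (hDB : ∀ x ∈ X, x ∈ Dq q → x ∈ B) (hPB : ∀ x ∈ Pq X q, x ∉ B)
    (hst : ∀ x ∈ X, ∀ s : ℝ, 1 ≤ s → psh q s x ∈ B → x ∈ B) :
    Z (Sp (X \ B)) (Sp (Pq X q)) := by
  have hsc : ∀ t ∈ Set.Icc (0:ℝ) 1, ∀ x ∈ X \ B, 0 < ‖gvec q x‖ ∧ 1 ≤ 1 - t + t * ‖gvec q x‖⁻¹ ∧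
      (1 - t + t * ‖gvec q x‖⁻¹) * ‖gvec q x‖ = (1 - t) * ‖gvec q x‖ + t ∧ (1 - t + t * ‖gvec q x‖⁻¹) * ‖gvec q x‖ ≤ 1 := by
    intro t ht x hx
    have h1 := gvec_le hq (hX.sub hx.1)
    have h2 := gvec_pos hq (hX.sub hx.1) (fun h => hx.2 (hDB x hx.1 h))
    have h3 := (one_le_inv₀ h2).2 h1
    have e : (1 - t + t * ‖gvec q x‖⁻¹) * ‖gvec q x‖ = (1 - t) * ‖gvec q x‖ + t := by field_simp
    refine ⟨h2, ?_, e, ?_⟩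
    · have := mul_le_mul_of_nonneg_left h3 ht.1
      linarith
    · rw [e]
      have := mul_le_mul_of_nonneg_left h1 (sub_nonneg.2 ht.2)
      linarith
  refine Z_of_htpy (fun x hx => ⟨hx.1, hPB x hx⟩) (fun t x => psh q (1 - t + t * ‖gvec q x‖⁻¹) x) ?_ ?_ ?_ ?_ ?_
  · unfold Function.uncurry
    have hs : ContinuousOn (fun a : ℝ × (Fin n → ℝ) => 1 - a.1 + a.1 * ‖gvec q a.2‖⁻¹) (Set.Icc 0 1 ×ˢ (X \ B)) := by
      refine ContinuousOn.fun_add (by fun_prop) (ContinuousOn.fun_mul (by fun_prop) (ContinuousOn.fun_inv₀ ?_ ?_))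
      · exact ((gvec_cont q).comp continuous_snd).norm.continuousOn
      · rintro ⟨t, x⟩ ⟨ht, hx⟩
        exact (hsc t ht x hx).1.ne'
    refine continuousOn_pi.2 fun i => ?_
    cases h : q i with
    | none => simp_rw [psh_none h]; fun_prop
    | some a =>
      simp_rw [psh_some h]
      exact ContinuousOn.fun_add (by fun_prop) (ContinuousOn.fun_mul (by fun_prop) hs)
  · intro x hx
    simp [psh_one]
  · intro x hx
    have h := hsc 1 ⟨zero_le_one, le_rfl⟩ x hx
    have hm := psh_mem hX hq hx.1 h.2.1 h.2.2.2
    refine (gvec_Pq hq (hX.sub hm) hm).2 ?_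
    rw [gvec_psh (by linarith [h.2.1]), norm_smul, Real.norm_of_nonneg (by linarith [h.2.1]), h.2.2.1]
    ring
  · intro t ht x hx
    have h := hsc t ht x hx
    exact ⟨psh_mem hX hq hx.1 h.2.1 h.2.2.2, fun hb => hx.2 (hst x hx.1 _ h.2.1 hb)⟩
  · intro t ht x hx
    have h1 := (gvec_Pq hq (hX.sub hx.1) hx.1).1 hx
    simp only [h1, inv_one, mul_one, sub_add_cancel, psh_one]
    exact hx

lemma Pq_Dq {X : Set (Fin n → ℝ)} {q : Fin n → Option ℝ} : ∀ x ∈ Pq X q, x ∉ Dq q := by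
  rintro x ⟨_, i, a, h, _, h2⟩ hx
  exact h2 (hx i a h)

lemma Z_push_D {X : Set (Fin n → ℝ)} (hX : Cub X) {q : Fin n → Option ℝ} (hq : Gq q) :
    Z (Sp (X \ Dq q)) (Sp (Pq X q)) := by
  refine Z_push hX hq (fun x _ h => h) Pq_Dq ?_
  intro x hx s hs h i a hi
  have h1 := h i a hi
  rw [psh_some hi] at h1
  have h2 : (x i - a) * s = 0 := by linarith
  rcases mul_eq_zero.1 h2 with h3 | h3
  · linarith
  · linarith

end push
end BF

set_option linter.unusedVariables false

namespace BF
open Finset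

section disc
variable {n d : ℕ}

/-- point pattern -/
def sq (v : Fin n → ℝ) : Fin n → Option ℝ := fun i => some (v i)

lemma Dq_sq (v : Fin n → ℝ) : Dq (sq v) = {v} := by
  ext x
  simp only [Dq, sq, Set.mem_ofPred_eq, Set.mem_singleton_iff, Option.some.injEq]
  constructor
  · intro h; funext i; exact h i _ rfl
  · rintro rfl i a h; exact h

lemma Gq_sq {v : Fin n → ℝ} (hv : v ∈ cube n) : Gq (sq v) := by
  rintro i a h
  cases h
  exact hv i

lemma Z_push_pt {X : Set (Fin n → ℝ)} (hX : Cub X) {v : Fin n → ℝ} (hv : v ∈ cube n) :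
    Z (Sp (X \ {v})) (Sp (Pq X (sq v))) := by
  have := Z_push_D hX (Gq_sq hv)
  rwa [Dq_sq] at this

lemma Pq_pt_ne {X : Set (Fin n → ℝ)} {v : Fin n → ℝ} : Pq X (sq v) ⊆ X \ {v} := by
  intro x hx
  refine ⟨hx.1, ?_⟩
  have := Pq_Dq x hx
  rwa [Dq_sq] at this

lemma mem_Pq_sq {X : Set (Fin n → ℝ)} {v x : Fin n → ℝ} : x ∈ Pq X (sq v) ↔ x ∈ X ∧ ∃ i, (x i = 0 ∨ x i = 1) ∧ x i ≠ v i := by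
  unfold Pq sq
  constructor
  · rintro ⟨h, i, a, h1, h2⟩
    cases h1
    exact ⟨h, i, h2⟩
  · rintro ⟨h, i, h2⟩
    exact ⟨h, i, v i, rfl, h2⟩

lemma upd_cube {v : Fin n → ℝ} (hv : v ∈ cube n) {c : Fin n} {a : ℝ} (ha : 0 ≤ a ∧ a ≤ 1) : Function.update v c a ∈ cube n := by
  intro i
  by_cases h : i = c
  · subst h; simpa using ha
  · rw [Function.update_of_ne h]; exact hv i

/-- edge lemma -/
lemma edge {X : Set (Fin n → ℝ)} (hX : Cub X) (hm : Nonempty (ChartedSpace (EuclideanSpace ℝ (Fin d)) ↥X))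
    {u : Fin n → ℝ} {c : Fin n} (hc : u c = 0 ∨ u c = 1)
    (hw : Function.update u c (1/2) ∈ X) (hu : u ∈ X) :
    Z (Sp (Pq X (sq (Function.update u c (1/2))))) (Sp (Pq X (sq u))) := by
  have huc := hX.sub hu
  have hW : IsOpen {x : Fin n → ℝ | ∀ i, (x i = 0 ∨ x i = 1) → x i = u i} := by
    have : {x : Fin n → ℝ | ∀ i, (x i = 0 ∨ x i = 1) → x i = u i} =
        ⋂ i : Fin n, {x : Fin n → ℝ | (x i = 0 → 0 = u i) ∧ (x i = 1 → 1 = u i)} := by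
      ext x
      simp only [Set.mem_ofPred_eq, Set.mem_iInter]
      refine forall_congr' fun i => ?_
      constructor
      · intro h; exact ⟨fun h1 => by rw [← h (Or.inl h1), h1], fun h1 => by rw [← h (Or.inr h1), h1]⟩
      · rintro ⟨h1, h2⟩ (h | h)
        · rw [← h1 h, h]
        · rw [← h2 h, h]
    rw [this]
    refine isOpen_iInter_of_finite fun i => ?_
    have op : ∀ b : ℝ, IsOpen {x : Fin n → ℝ | x i = b → b = u i} := by
      intro b
      by_cases h : b = u i
      · simp [h]
      · simp only [h, imp_false]
        exact (isClosed_eq (continuous_apply i) continuous_const).isOpen_compl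
    exact (op 0).inter (op 1)
  obtain ⟨Bl, O, hBl, hBW, hBX, hO, hpO, hOB, hz⟩ := loc_ball hm hu hW (fun i _ => rfl)
  -- a nearby point
  have hlim : Filter.Tendsto (fun ε : ℝ => Function.update u c (u c + ε * (1/2 - u c))) (nhdsWithin 0 (Set.Ioi 0)) (nhds u) := by
    have h1 : Continuous (fun ε : ℝ => Function.update u c (u c + ε * (1/2 - u c))) := by fun_prop
    have h2 := h1.tendsto 0
    simp only [zero_mul, add_zero, Function.update_eq_self] at h2
    exact h2.mono_left nhdsWithin_le_nhds
  have hev := (hlim.eventually (hO.mem_nhds hpO)).and (Ioo_mem_nhdsGT (zero_lt_one' ℝ))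
  obtain ⟨ε, h1, h2⟩ := hev.exists
  set w := Function.update u c (u c + ε * (1/2 - u c)) with hwdef
  have hwc : w c = u c + ε * (1/2 - u c) := by simp [hwdef]
  have hwne : 0 < w c ∧ w c < 1 := by
    rw [hwc]
    rcases hc with h | h <;> rw [h] <;> constructor <;> nlinarith [h2.1, h2.2]
  have hwX : w ∈ X := by
    refine hX.st _ hw _ (upd_cube huc (by rw [← hwc]; exact ⟨hwne.1.le, hwne.2.le⟩)) ?_ ?_
    · intro i hi
      by_cases h : i = c
      · subst h; simp at hi
      · rw [Function.update_of_ne h] at hi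
        rw [hwdef, Function.update_of_ne h, hi]
    · intro i hi
      by_cases h : i = c
      · subst h; norm_num at hi
      · rw [Function.update_of_ne h] at hi
        rw [hwdef, Function.update_of_ne h, hi]
  have hwB : w ∈ Bl := hOB ⟨hwX, h1⟩
  have huB : u ∈ Bl := hOB ⟨hu, hpO⟩
  have hP : Pq X (sq (Function.update u c (1/2))) = Pq X (sq w) := by
    ext x
    rw [mem_Pq_sq, mem_Pq_sq]
    refine and_congr_right fun _ => exists_congr fun i => and_congr_right fun hi => ?_
    by_cases h : i = c
    · subst h
      rw [Function.update_self]
      have e1 : x i ≠ 1/2 := by rcases hi with h | h <;> rw [h] <;> norm_num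
      have e2 : x i ≠ w i := by rcases hi with h | h <;> rw [h] <;> [exact hwne.1.ne; exact hwne.2.ne']
      exact ⟨fun _ => e2, fun _ => e1⟩
    · rw [hwdef, Function.update_of_ne h, Function.update_of_ne h]
  rw [hP]
  have hPu : Pq X (sq u) ⊆ X \ Bl := by
    intro x hx
    rw [mem_Pq_sq] at hx
    obtain ⟨hx, i, h3, h4⟩ := hx
    exact ⟨hx, fun hb => h4 (hBW hb i h3)⟩
  have hPP : Pq X (sq u) ⊆ Pq X (sq w) := by
    intro x hx
    rw [mem_Pq_sq] at hx ⊢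
    obtain ⟨hx, i, h3, h4⟩ := hx
    refine ⟨hx, i, h3, ?_⟩
    by_cases h : i = c
    · subst h
      rcases h3 with h | h <;> rw [h] <;> [exact hwne.1.ne; exact hwne.2.ne']
    · rwa [hwdef, Function.update_of_ne h]
  have z1 : Z (Sp (X \ Bl)) (Sp (Pq X (sq u))) :=
    Z.right (hz u huB) (Z_push_pt hX huc) (Sp_mono (Set.sdiff_subset_sdiff_right (Set.singleton_subset_iff.2 huB)))
      (Sp_mono hPu) (Sp_isC _)
  have z2 : Z (Sp (X \ {w})) (Sp (Pq X (sq u))) :=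
    (hz w hwB).trans z1 (Sp_mono (Set.sdiff_subset_sdiff_right (Set.singleton_subset_iff.2 hwB))) (Sp_mono hPu)
  exact Z.right (Z_push_pt hX (hX.sub hwX)) z2 (Sp_mono Pq_pt_ne) (Sp_mono hPP) (Sp_isC _)

lemma Pq_mono {X : Set (Fin n → ℝ)} {q q' : Fin n → Option ℝ} (h : ∀ i a, q i = some a → ∃ b, q' i = some b ∧ 
    ∀ t : ℝ, (t = 0 ∨ t = 1) → t ≠ a → t ≠ b) : Pq X q ⊆ Pq X q' := by
  rintro x ⟨hx, i, a, h1, h2, h3⟩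
  obtain ⟨b, hb, hb'⟩ := h i a h1
  exact ⟨hx, i, b, hb, h2, hb' _ h2 h3⟩

lemma Dq_closed (q : Fin n → Option ℝ) : IsClosed (Dq q) := by
  have : Dq q = ⋂ i, ⋂ a, ⋂ _ : q i = some a, {x | x i = a} := by
    ext x; simp [Dq]
  rw [this]
  exact isClosed_iInter fun i => isClosed_iInter fun a => isClosed_iInter fun _ =>
    isClosed_eq (continuous_apply i) continuous_const

/-- pushing away from a half disc -/
lemma Z_half {X : Set (Fin n → ℝ)} (hX : Cub X) {q : Fin n → Option ℝ} (hq : Gq q) {c : Fin n} (hqc : q c = none)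
    {e : ℝ} (he : e = 0 ∨ e = 1) :
    Z (Sp (X \ (Dq q ∩ {x | |x c - e| ≤ |x c - (1 - e)|}))) (Sp (Pq X (Function.update q c (some e)))) ∧
    Pq X (Function.update q c (some e)) ⊆ X \ (Dq q ∩ {x | |x c - e| ≤ |x c - (1 - e)|}) := by
  have hP : ∀ x ∈ Pq X (Function.update q c (some e)), x ∉ Dq q ∩ {x | |x c - e| ≤ |x c - (1 - e)|} := by
    rintro x ⟨hx, i, a, h1, h2, h3⟩ ⟨h4, h5⟩
    by_cases h : i = c
    · subst h
      rw [Function.update_self] at h1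
      cases h1
      have h5' : |x i - e| ≤ |x i - (1 - e)| := h5
      revert h3 h5'
      rcases he with rfl | rfl <;> rcases h2 with h2 | h2 <;> rw [h2] <;> norm_num
    · rw [Function.update_of_ne h] at h1
      exact h3 (h4 i a h1)
  refine ⟨Z_push hX ?_ ?_ hP ?_, fun x hx => ⟨hx.1, hP x hx⟩⟩
  · intro i a h1
    by_cases h : i = c
    · subst h
      rw [Function.update_self] at h1
      cases h1
      rcases he with rfl | rfl <;> norm_num
    · rw [Function.update_of_ne h] at h1
      exact hq i a h1
  · intro x hx h
    refine ⟨?_, ?_⟩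
    · intro i a hi
      have hic : i ≠ c := by rintro rfl; rw [hqc] at hi; cases hi
      exact h i a (by rw [Function.update_of_ne hic]; exact hi)
    · have : x c = e := h c e (by simp)
      show |x c - e| ≤ |x c - (1 - e)|
      rw [this]; simp
  · rintro x hx s hs ⟨h1, h2⟩
    refine ⟨?_, ?_⟩
    · intro i a hi
      have hic : i ≠ c := by rintro rfl; rw [hqc] at hi; cases hi
      have h3 := h1 i a hi
      rw [psh_some (a := a) (by rw [Function.update_of_ne hic]; exact hi)] at h3
      have h2 : (x i - a) * s = 0 := by linarith
      rcases mul_eq_zero.1 h2 with h3 | h3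
      · linarith
      · linarith
    · have h2' : |psh (Function.update q c (some e)) s x c - e| ≤ |psh (Function.update q c (some e)) s x c - (1 - e)| := h2
      rw [psh_some (a := e) (by simp)] at h2'
      show |x c - e| ≤ |x c - (1 - e)|
      have hxc := hX.sub hx c
      rw [← sq_le_sq] at h2' ⊢
      rcases he with rfl | rfl
      · nlinarith
      · nlinarith

lemma disc {X : Set (Fin n → ℝ)} (hX : Cub X) (hm : Nonempty (ChartedSpace (EuclideanSpace ℝ (Fin d)) ↥X)) :
    ∀ (N : ℕ) (q : Fin n → Option ℝ), (univ.filter (fun i => q i = none)).card = N → Gq q →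
    (∀ x ∈ cube n, x ∈ Dq q → x ∈ X) → ∀ v ∈ Dq q, (∀ i, q i = none → v i = 0 ∨ v i = 1) →
      Z (Sp (Pq X (sq v))) (Sp (Pq X q)) := by
  intro N
  induction N with
  | zero =>
    intro q hN hq hD v hv hvn
    have : q = sq v := by
      funext i
      rw [Finset.card_eq_zero, Finset.filter_eq_empty_iff] at hN
      have := hN (mem_univ i)
      cases h : q i with
      | none => exact absurd h this
      | some a => rw [sq, hv i a h]
    rw [this]
    exact Z.refl _
  | succ N ih =>
    intro q hN hq hD v hv hvn
    obtain ⟨c, hc⟩ : ∃ c, q c = none := by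
      have : 0 < (univ.filter (fun i => q i = none)).card := by omega
      obtain ⟨c, hc⟩ := Finset.card_pos.1 this
      exact ⟨c, (Finset.mem_filter.1 hc).2⟩
    have hcard : ∀ a : ℝ, (univ.filter (fun i => (Function.update q c (some a)) i = none)).card = N := by
      intro a
      have : univ.filter (fun i => (Function.update q c (some a)) i = none) = (univ.filter (fun i => q i = none)).erase c := by
        ext i
        simp only [Finset.mem_filter, Finset.mem_univ, true_and, Finset.mem_erase]
        by_cases h : i = c
        · subst h; simp
        · simp [h]
      rw [this, Finset.card_erase_of_mem (by simp [hc]), hN]; rfl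
    have hG : ∀ a : ℝ, 0 ≤ a ∧ a ≤ 1 → Gq (Function.update q c (some a)) := by
      intro a ha i b hb
      by_cases h : i = c
      · subst h; rw [Function.update_self] at hb; cases hb; exact ha
      · rw [Function.update_of_ne h] at hb; exact hq i b hb
    have hDs : ∀ a : ℝ, Dq (Function.update q c (some a)) ⊆ Dq q := by
      intro a x hx i b hb
      have hic : i ≠ c := by rintro rfl; rw [hc] at hb; cases hb
      exact hx i b (by rw [Function.update_of_ne hic]; exact hb)
    have hvD : ∀ a : ℝ, Function.update v c a ∈ Dq (Function.update q c (some a)) := by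
      intro a i b hb
      by_cases h : i = c
      · subst h; rw [Function.update_self] at hb ⊢; cases hb; rfl
      · rw [Function.update_of_ne h] at hb ⊢; exact hv i b hb
    have hvn' : ∀ a : ℝ, ∀ i, (Function.update q c (some a)) i = none → (Function.update v c a) i = 0 ∨ (Function.update v c a) i = 1 := by
      intro a i hi
      by_cases h : i = c
      · subst h; simp at hi
      · rw [Function.update_of_ne h] at hi ⊢; exact hvn i hi
    have hvc : v ∈ cube n := by
      intro i
      cases h : q i with
      | none => rcases hvn i h with h | h <;> rw [h] <;> norm_num
      | some a => rw [hv i a h]; exact hq i a h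
    have IH : ∀ a : ℝ, 0 ≤ a ∧ a ≤ 1 → Z (Sp (Pq X (sq (Function.update v c a)))) (Sp (Pq X (Function.update q c (some a)))) :=
      fun a ha => ih _ (hcard a) (hG a ha) (fun x hx h => hD x hx (hDs a h)) _ (hvD a) (hvn' a)
    -- inclusions
    have mono1 : ∀ a : ℝ, Pq X q ⊆ Pq X (Function.update q c (some a)) := by
      intro a
      refine Pq_mono fun i b hb => ⟨b, ?_, fun _ _ h => h⟩
      have hic : i ≠ c := by rintro rfl; rw [hc] at hb; cases hb
      rw [Function.update_of_ne hic]; exact hb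
    have mono2 : ∀ a : ℝ, (a = 0 ∨ a = 1) → Pq X (Function.update q c (some a)) ⊆ Pq X (Function.update q c (some (1/2))) := by
      intro a ha
      refine Pq_mono fun i b hb => ?_
      by_cases h : i = c
      · subst h
        refine ⟨1/2, by simp, ?_⟩
        rintro t (h | h) _ <;> rw [h] <;> norm_num
      · rw [Function.update_of_ne h] at hb ⊢; exact ⟨b, hb, fun _ _ h => h⟩
    have mono3 : ∀ a : ℝ, Pq X (Function.update q c (some a)) ⊆ Pq X (sq (Function.update v c a)) := by
      intro a
      refine Pq_mono fun i b hb => ?_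
      refine ⟨b, ?_, fun _ _ h => h⟩
      rw [sq, hvD a i b hb]
    have mono4 : ∀ a : ℝ, Pq X (Function.update q c (some a)) ⊆ X \ Dq (Function.update q c (some a)) :=
      fun a x hx => ⟨hx.1, Pq_Dq x hx⟩
    have hb := hvn c hc
    set b := v c with hbdef
    have hb' : 1 - b = 0 ∨ 1 - b = 1 := by rcases hb with h | h <;> rw [h] <;> norm_num
    have hbb : 0 ≤ b ∧ b ≤ 1 := hvc c
    have hbb' : 0 ≤ 1 - b ∧ 1 - b ≤ 1 := ⟨by linarith, by linarith⟩
    have hhalf : (0:ℝ) ≤ 1/2 ∧ (1/2 : ℝ) ≤ 1 := by norm_num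
    have memX : ∀ a : ℝ, 0 ≤ a ∧ a ≤ 1 → Function.update v c a ∈ X := fun a ha => hD _ (upd_cube hvc ha) (hDs a (hvD a))
    have ed : Z (Sp (Pq X (sq (Function.update v c (1/2))))) (Sp (Pq X (sq (Function.update v c (1 - b))))) := by
      have := edge hX hm (u := Function.update v c (1 - b)) (c := c) (by simpa using hb')
        (by rw [Function.update_idem]; exact memX _ hhalf) (memX _ hbb')
      rwa [Function.update_idem] at this
    have mono5 : Pq X (sq (Function.update v c (1 - b))) ⊆ Pq X (sq (Function.update v c (1/2))) := by
      refine Pq_mono fun i a ha => ?_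
      by_cases h : i = c
      · subst h
        refine ⟨1/2, by simp [sq], ?_⟩
        rintro t (h | h) _ <;> rw [h] <;> norm_num
      · exact ⟨a, by rw [sq, Function.update_of_ne h] at ha ⊢; exact ha, fun _ _ h => h⟩
    have z1 : Z (Sp (Pq X (sq (Function.update v c (1/2))))) (Sp (Pq X (Function.update q c (some (1 - b))))) :=
      ed.trans (IH _ hbb') (Sp_mono mono5) (Sp_mono (mono3 _))
    have z2 : Z (Sp (Pq X (Function.update q c (some (1/2))))) (Sp (Pq X (Function.update q c (some (1 - b))))) :=
      Z.right (IH _ hhalf) z1 (Sp_mono (mono3 _)) (Sp_mono (mono2 _ hb')) (Sp_isC _)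
    have z3 : Z (Sp (X \ Dq (Function.update q c (some (1/2))))) (Sp (Pq X (Function.update q c (some (1 - b))))) :=
      (Z_push_D hX (hG _ hhalf)).trans z2 (Sp_mono (mono4 _)) (Sp_mono (mono2 _ hb'))
    obtain ⟨n1, n1'⟩ := Z_half hX hq hc hb
    obtain ⟨f1, f1'⟩ := Z_half hX hq hc hb'
    have clo : ∀ e : ℝ, IsClosed (Dq q ∩ {x : Fin n → ℝ | |x c - e| ≤ |x c - (1 - e)|}) := by
      intro e
      exact (Dq_closed q).inter (isClosed_le (by fun_prop) (by fun_prop))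
    have einter : (Dq q ∩ {x : Fin n → ℝ | |x c - (1 - b)| ≤ |x c - (1 - (1 - b))|}) ∩ (Dq q ∩ {x | |x c - b| ≤ |x c - (1 - b)|}) =
        Dq (Function.update q c (some (1/2))) := by
      ext x
      constructor
      · rintro ⟨⟨h1, h2⟩, ⟨_, h3⟩⟩ i a hi
        by_cases h : i = c
        · subst h
          rw [Function.update_self] at hi
          cases hi
          have h2' : |x i - (1 - b)| ≤ |x i - (1 - (1 - b))| := h2
          have h3' : |x i - b| ≤ |x i - (1 - b)| := h3
          rw [← sq_le_sq] at h2' h3'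
          rcases hb with hb | hb <;> rw [hb] at h2' h3' <;> nlinarith
        · rw [Function.update_of_ne h] at hi; exact h1 i a hi
      · intro h
        have h1 : x c = 1/2 := h c _ (by simp)
        refine ⟨⟨hDs _ h, ?_⟩, ⟨hDs _ h, ?_⟩⟩
        · show |x c - (1 - b)| ≤ |x c - (1 - (1 - b))|
          rw [← sq_le_sq, h1]
          rcases hb with hb | hb <;> rw [hb] <;> norm_num
        · show |x c - b| ≤ |x c - (1 - b)|
          rw [← sq_le_sq, h1]
          rcases hb with hb | hb <;> rw [hb] <;> norm_num
    have eunion : (Dq q ∩ {x : Fin n → ℝ | |x c - (1 - b)| ≤ |x c - (1 - (1 - b))|}) ∪ (Dq q ∩ {x | |x c - b| ≤ |x c - (1 - b)|}) =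
        Dq q := by
      rw [← Set.inter_union_distrib_left, Set.inter_eq_left]
      intro x _
      rw [show 1 - (1 - b) = b by ring]
      exact le_total |x c - (1 - b)| |x c - b|
    have z4 : Z (Sp (X \ Dq (Function.update q c (some (1/2))))) (Sp (X \ (Dq q ∩ {x : Fin n → ℝ | |x c - (1 - b)| ≤ |x c - (1 - (1 - b))|}))) := by
      refine Z.left z3 f1 (Sp_mono (Set.sdiff_subset_sdiff_right ?_)) (Sp_mono f1') (Sp_isC _)
      rw [← einter]; exact Set.inter_subset_left
    have z5 := exc1 (X := X) (clo (1 - b)) (clo b) (by rw [einter]; exact z4)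
    rw [eunion] at z5
    have z6 := z5.trans (Z_push_D hX hq) (Sp_mono (Set.sdiff_subset_sdiff_right Set.inter_subset_left))
      (Sp_mono (fun x hx => ⟨hx.1, Pq_Dq x hx⟩))
    have z7 : Z (Sp (Pq X (Function.update q c (some b)))) (Sp (Pq X q)) :=
      Z.right n1 z6 (Sp_mono n1') (Sp_mono (mono1 _)) (Sp_isC _)
    have z8 := IH b hbb
    rw [hbdef, Function.update_eq_self] at z8
    refine z8.trans z7 (Sp_mono ?_) (Sp_mono (mono1 _))
    have := mono3 b
    rwa [hbdef, Function.update_eq_self] at this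

lemma disc' {X : Set (Fin n → ℝ)} (hX : Cub X) (hm : Nonempty (ChartedSpace (EuclideanSpace ℝ (Fin d)) ↥X))
    {q : Fin n → Option ℝ} (hq : Gq q) (hD : ∀ x ∈ cube n, x ∈ Dq q → x ∈ X) {v : Fin n → ℝ} (hv : v ∈ Dq q)
    (hvn : ∀ i, q i = none → v i = 0 ∨ v i = 1) : Z (Sp (X \ {v})) (Sp (X \ Dq q)) := by
  have h1 := disc hX hm _ q rfl hq hD v hv hvn
  have hvc : v ∈ cube n := by
    intro i
    cases h : q i with
    | none => rcases hvn i h with h | h <;> rw [h] <;> norm_num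
    | some a => rw [hv i a h]; exact hq i a h
  have h2 := (Z_push_pt hX hvc).trans h1 (Sp_mono Pq_pt_ne) (Sp_mono (Pq_mono fun i b hb => ⟨b, by rw [sq, hv i b hb], fun _ _ h => h⟩))
  exact Z.left h2 (Z_push_D hX hq) (Sp_mono (Set.sdiff_subset_sdiff_right (Set.singleton_subset_iff.2 hv)))
    (Sp_mono (fun x hx => ⟨hx.1, Pq_Dq x hx⟩)) (Sp_isC _)

end disc
end BF

set_option linter.unusedVariables false

namespace BF
open Finset

section abs
variable {C : Cos} {E : Type} {X Np Nq N N1 N2 : Submodule (ZMod 2) (GCh C E)} {k : ℕ}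

/-- transfer of relative boundaries -/
lemma rb_transfer (h : Z N N1) (h1 : N1 ≤ N) (hNX : N ≤ X) {z : GCh C E} (hz : bd z ∈ N1) : z ∈ rb X N ↔ z ∈ rb X N1 := by
  rw [mem_rb, mem_rb]
  constructor
  · rintro ⟨e, he, h'⟩
    obtain ⟨e', he', h''⟩ := h _ h' (by rw [map_add, bd_bd, add_zero]; exact hz)
    exact ⟨e + e', X.add_mem he (hNX he'), by rw [map_add, ← add_assoc]; exact h''⟩
  · rintro ⟨e, he, h'⟩
    exact ⟨e, he, h1 h'⟩

lemma hc_base (hX : IsC X) (hNp : IsC Np) (hNq : IsC Nq) (hN1 : IsC N1) (hN2 : IsC N2)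
    (hXpq : Z X (Np ⊔ Nq)) (hN : N = Np ⊓ Nq) (hN12 : Z N (N1 ⊔ N2)) (h1N : N1 ≤ N) (h2N : N2 ≤ N) (hpX : Np ≤ X) (hqX : Nq ≤ X)
    (p1 : Z Np N1) (p2 : Z Np N2) (q1 : Z Nq N1) (q2 : Z Nq N2) (two : hc (k+1) X Np = 2) : hc k X (N1 ⊓ N2) ≠ 1 := by
  intro hone
  rw [hc_one] at hone
  obtain ⟨a, haX, hak, hab, harb, hall⟩ := hc_two.1 two
  have hNIsC : IsC N := by rw [hN]; exact hNp.inf hNq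
  have hNp' : N ≤ Np := by rw [hN]; exact inf_le_left
  have hNq' : N ≤ Nq := by rw [hN]; exact inf_le_right
  obtain ⟨e, he, hs⟩ := hXpq a haX (Submodule.mem_sup_left hab)
  obtain ⟨up, hup, uq, huq, hu⟩ := Submodule.mem_sup.1 hs
  have hprq : pr (k+1) uq ∈ Nq := hNq.2 _ _ huq
  have hprp : pr (k+1) up ∈ Np := hNp.2 _ _ hup
  have e1 : a + bd (pr (k+2) e) = pr (k+1) up + pr (k+1) uq := by
    rw [← map_add, hu, map_add, mem_Dg.1 hak, pr_bd]
  have e1' : bd a = bd (pr (k+1) up) + bd (pr (k+1) uq) := by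
    have := congrArg bd e1
    rwa [map_add, bd_bd, add_zero, map_add] at this
  have hy1 : bd (pr (k+1) uq) ∈ N := by
    rw [hN]
    refine ⟨?_, hNq.1 _ hprq⟩
    have : bd (pr (k+1) up) + bd (pr (k+1) uq) ∈ Np := by rw [← e1']; exact hab
    exact mem_of_add' this (hNp.1 _ hprp)
  obtain ⟨e', he', hs'⟩ := hN12 _ hy1 (by rw [bd_bd]; exact Submodule.zero_mem _)
  obtain ⟨n1, hn1, n2, hn2, hn⟩ := Submodule.mem_sup.1 hs'
  -- y
  set y := pr (k+1) uq + pr (k+1) e' with hy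
  have hye : pr (k+1) e' ∈ N := hNIsC.2 _ _ he'
  have hyq : y ∈ Nq := Nq.add_mem hprq (hNq' hye)
  have hyD : y ∈ Dg (C := C) (E := E) (k+1) := Submodule.add_mem _ (pr_mem_Dg _ _) (pr_mem_Dg _ _)
  have hyb : bd y = pr k n1 + pr k n2 := by
    rw [← map_add, hn, hy, map_add, map_add, pr_bd, pr_bd, pr_pr]
  have hyrb : y ∉ rb X Np := by
    intro h
    apply harb
    have h3 : a = y + (pr (k+1) e' + pr (k+1) up + bd (pr (k+2) e)) := by
      have h4 : a = pr (k+1) up + pr (k+1) uq + bd (pr (k+2) e) := by rw [← e1, add_cancel']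
      rw [h4, hy]
      rw [show pr (k+1) uq + pr (k+1) e' + (pr (k+1) e' + pr (k+1) up + bd (pr (k+2) e)) =
        (pr (k+1) up + pr (k+1) uq + bd (pr (k+2) e)) + (pr (k+1) e' + pr (k+1) e') by abel, zz, add_zero]
    rw [h3]
    refine Submodule.add_mem _ h (Submodule.add_mem _ (Submodule.mem_sup_left (Np.add_mem (hNp' hye) hprp)) ?_)
    exact Submodule.mem_sup_right ⟨_, hX.2 _ _ he, rfl⟩
  have hyrq : y ∈ rb X Nq := Submodule.mem_sup_left hyq
  have m1 : pr k n1 ∈ N1 := hN1.2 _ _ hn1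
  have m2 : pr k n2 ∈ N2 := hN2.2 _ _ hn2
  have hb12 : bd (pr k n1) = bd (pr k n2) := by
    have := congrArg bd hyb
    rw [bd_bd, map_add] at this
    exact eq_of_add this.symm
  obtain ⟨f, hf, hf'⟩ := hone (pr k n1) (hpX (hNp' (h1N m1))) (pr_mem_Dg _ _)
    ⟨hN1.1 _ m1, by rw [hb12]; exact hN2.1 _ m2⟩
  set z1 := pr (k+1) f with hz1
  have hz1X : z1 ∈ X := hX.2 _ _ hf
  have hf2 : pr k n1 + bd z1 ∈ N1 ⊓ N2 := by
    have := (hN1.inf hN2).2 k _ hf'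
    rwa [map_add, pr_pr, pr_bd] at this
  have hz1b : bd z1 ∈ N1 := mem_of_add' hf2.1 m1
  have hz2b : bd (y + z1) ∈ N2 := by
    rw [map_add, hyb, add_right_comm]
    exact N2.add_mem hf2.2 m2
  have hyX : y ∈ X := hqX hyq
  have hz1D : z1 ∈ Dg (C := C) (E := E) (k+1) := pr_mem_Dg _ _
  -- transfer
  have t1 : z1 ∈ rb X Np ↔ z1 ∈ rb X Nq :=
    (rb_transfer p1 (h1N.trans hNp') hpX hz1b).trans (rb_transfer q1 (h1N.trans hNq') hqX hz1b).symm
  have t2 : y + z1 ∈ rb X Np ↔ y + z1 ∈ rb X Nq :=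
    (rb_transfer p2 (h2N.trans hNp') hpX hz2b).trans (rb_transfer q2 (h2N.trans hNq') hqX hz2b).symm
  have c1 := hall z1 hz1X hz1D (hNp' (h1N hz1b))
  have c2 := hall (y + z1) (X.add_mem hyX hz1X) (Submodule.add_mem _ hyD hz1D) (hNp' (h2N hz2b))
  have n12 : z1 ∈ rb X Nq ↔ y + z1 ∈ rb X Nq := by
    constructor
    · intro h; exact Submodule.add_mem _ hyrq h
    · intro h; exact mem_of_add' h hyrq
  have n13 : z1 ∈ rb X Np ↔ y + z1 ∈ rb X Np := by rw [t1, t2, n12]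
  apply hyrb
  by_cases h : z1 ∈ rb X Np
  · exact mem_of_add (n13.1 h) h
  · have h2 := c1.resolve_left h
    have h3 := c2.resolve_left (fun hh => h (n13.2 hh))
    have := Submodule.add_mem _ h3 h2
    rwa [show y + z1 + a + (z1 + a) = y + ((z1 + z1) + (a + a)) by abel, zz, zz, add_zero, add_zero] at this

end abs

section sph
variable {n d : ℕ}

/-- real value of a bit -/
noncomputable def β (b : Bool) : ℝ := if b then 1 else 0

lemma β_inj {a b : Bool} (h : β a = β b) : a = b := by
  cases a <;> cases b <;> simp [β] at h ⊢

lemma β_01 (a : Bool) : β a = 0 ∨ β a = 1 := by cases a <;> simp [β]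

lemma β_01' (a : Bool) : 0 ≤ β a ∧ β a ≤ 1 := by cases a <;> simp [β]

/-- vertex patterns -/
def Vq (q : Fin n → Option ℝ) : Prop := ∀ i a, q i = some a → a = 0 ∨ a = 1

lemma Vq.G {q : Fin n → Option ℝ} (h : Vq q) : Gq q := by
  intro i a hi
  rcases h i a hi with h | h <;> rw [h] <;> norm_num

lemma Vq.upd {q : Fin n → Option ℝ} (h : Vq q) (c : Fin n) (b : Bool) : Vq (Function.update q c (some (β b))) := by
  intro i a hi
  by_cases hic : i = c
  · subst hic; rw [Function.update_self] at hi; cases hi; exact β_01 b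
  · rw [Function.update_of_ne hic] at hi; exact h i a hi

/-- facet of a pattern -/
noncomputable def fc (q : Fin n → Option ℝ) (t : Fin n × Bool) : Fin n → Option ℝ := Function.update q t.1 (some (β t.2))

/-- unions of facets -/
def Aq (q : Fin n → Option ℝ) (T : Finset (Fin n × Bool)) : Set (Fin n → ℝ) := {x | x ∈ Dq q ∧ ∃ t ∈ T, x t.1 = β t.2}

/-- admissible facet families -/
def Adm (X : Set (Fin n → ℝ)) (q : Fin n → Option ℝ) (T : Finset (Fin n × Bool)) : Prop :=
  ∀ t ∈ T, q t.1 = none ∧ ∀ x ∈ cube n, x ∈ Dq (fc q t) → x ∈ X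

lemma mem_Dq_fc {q : Fin n → Option ℝ} {t : Fin n × Bool} (h : q t.1 = none) {x : Fin n → ℝ} :
    x ∈ Dq (fc q t) ↔ x ∈ Dq q ∧ x t.1 = β t.2 := by
  constructor
  · intro hx
    refine ⟨fun i a hi => ?_, hx t.1 _ (by simp [fc])⟩
    have hic : i ≠ t.1 := by rintro rfl; rw [h] at hi; cases hi
    exact hx i a (by rw [fc, Function.update_of_ne hic]; exact hi)
  · rintro ⟨h1, h2⟩ i a hi
    by_cases hic : i = t.1
    · subst hic; rw [fc, Function.update_self] at hi; cases hi; exact h2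
    · rw [fc, Function.update_of_ne hic] at hi; exact h1 i a hi

lemma Aq_closed (q : Fin n → Option ℝ) (T : Finset (Fin n × Bool)) : IsClosed (Aq q T) := by
  have : Aq q T = Dq q ∩ ⋃ t ∈ T, {x | x t.1 = β t.2} := by
    ext x; simp [Aq]
  rw [this]
  refine (Dq_closed q).inter (T.finite_toSet.isClosed_biUnion fun t _ => isClosed_eq (continuous_apply _) continuous_const)

/-- vertices -/
def IsV (v : Fin n → ℝ) : Prop := ∀ i, v i = 0 ∨ v i = 1

lemma exists_v {q : Fin n → Option ℝ} (h : Vq q) : ∃ v, IsV v ∧ v ∈ Dq q := by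
  refine ⟨fun i => (q i).getD 0, ?_, ?_⟩
  · intro i
    cases hi : q i with
    | none => left; show (q i).getD 0 = 0; rw [hi]; rfl
    | some a => show (q i).getD 0 = 0 ∨ (q i).getD 0 = 1; rw [hi]; exact h i a hi
  · intro i a hi
    simp [hi]

lemma Aq_insert {q : Fin n → Option ℝ} {T : Finset (Fin n × Bool)} {t : Fin n × Bool} (h : q t.1 = none) :
    Aq q (insert t T) = Aq q T ∪ Dq (fc q t) := by
  ext x
  rw [Set.mem_union, mem_Dq_fc h]
  simp only [Aq, Set.mem_ofPred_eq, Finset.mem_insert, exists_eq_or_imp]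
  rw [and_or_left, or_comm]

lemma Aq_inter {q : Fin n → Option ℝ} {T : Finset (Fin n × Bool)} {t : Fin n × Bool} (h : q t.1 = none) (ht : t ∉ T) :
    Aq q T ∩ Dq (fc q t) = Aq (fc q t) (T.filter fun s => s.1 ≠ t.1) := by
  ext x
  simp only [Aq, Set.mem_inter_iff, Set.mem_ofPred_eq, mem_Dq_fc h, Finset.mem_filter]
  constructor
  · rintro ⟨⟨h1, s, hs, h2⟩, _, h3⟩
    refine ⟨⟨h1, h3⟩, s, ⟨hs, fun he => ?_⟩, h2⟩
    rw [he, h3] at h2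
    have := β_inj h2
    exact ht (by rwa [show t = s from Prod.ext he.symm this])
  · rintro ⟨⟨h1, h3⟩, s, ⟨hs, _⟩, h2⟩
    exact ⟨⟨h1, s, hs, h2⟩, h1, h3⟩

lemma Wlem {X : Set (Fin n → ℝ)} (hX : Cub X) (hm : Nonempty (ChartedSpace (EuclideanSpace ℝ (Fin d)) ↥X)) :
    ∀ (N : ℕ) (q : Fin n → Option ℝ) (T : Finset (Fin n × Bool)), T.card = N → Vq q → Adm X q T →
    (∃ t ∈ T, (t.1, !t.2) ∉ T) → ∀ v, IsV v → v ∈ Aq q T → Z (Sp (X \ {v})) (Sp (X \ Aq q T)) := by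
  intro N
  induction N using Nat.strong_induction_on with
  | _ N ih =>
  rintro q T hN hq hT ⟨t0, ht0, ht0'⟩ v hv hvA
  by_cases hall : ∀ t ∈ T, t = t0
  · have hTe : T = insert t0 ∅ := by
      ext t; constructor
      · intro h; rw [hall t h]; simp
      · intro h; simp at h; rwa [h]
    have hA : Aq q T = Dq (fc q t0) := by
      rw [hTe, Aq_insert (hT t0 ht0).1]; simp [Aq]
    rw [hA] at hvA ⊢
    exact disc' hX hm (hq.upd _ _).G (hT t0 ht0).2 hvA (fun i _ => hv i)
  · push Not at hall
    obtain ⟨t, ht, htne⟩ := hall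
    have h1 : t.1 ≠ t0.1 := by
      intro h
      have : t.2 ≠ t0.2 := fun h' => htne (Prod.ext h h')
      apply ht0'
      have h2 : t.2 = !t0.2 := by revert this; cases t.2 <;> cases t0.2 <;> simp
      rwa [← h, ← h2]
    have hTe : T = insert t (T.erase t) := (Finset.insert_erase ht).symm
    have hqt := (hT t ht).1
    have hA : Aq q T = Aq q (T.erase t) ∪ Dq (fc q t) := by
      rw [← Aq_insert hqt, ← hTe]
    have hI := Aq_inter (T := T.erase t) hqt (Finset.notMem_erase t T)
    have hc1 : (T.erase t).card < N := by rw [← hN]; exact Finset.card_erase_lt_of_mem ht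
    have hc2 : ((T.erase t).filter fun s => s.1 ≠ t.1).card < N := (Finset.card_filter_le _ _).trans_lt hc1
    have ht0e : t0 ∈ T.erase t := Finset.mem_erase.2 ⟨fun h => htne h.symm, ht0⟩
    have ih1 := ih _ hc1 q (T.erase t) rfl hq (fun s hs => hT s (Finset.mem_of_mem_erase hs))
      ⟨t0, ht0e, fun h => ht0' (Finset.mem_of_mem_erase h)⟩
    have ht0f : t0 ∈ (T.erase t).filter fun s => s.1 ≠ t.1 := Finset.mem_filter.2 ⟨ht0e, h1.symm⟩
    have hqf : Vq (fc q t) := hq.upd _ _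
    have hAdm : Adm X (fc q t) ((T.erase t).filter fun s => s.1 ≠ t.1) := by
      intro s hs
      rw [Finset.mem_filter] at hs
      have hsT := hT s (Finset.mem_of_mem_erase hs.1)
      have hn : fc q t s.1 = none := by rw [fc, Function.update_of_ne hs.2]; exact hsT.1
      refine ⟨hn, fun x hx h => hsT.2 x hx ?_⟩
      rw [mem_Dq_fc hn, mem_Dq_fc hqt] at h
      rw [mem_Dq_fc hsT.1]
      exact ⟨h.1.1, h.2⟩
    have ih2 := ih _ hc2 (fc q t) _ rfl hqf hAdm
      ⟨t0, ht0f, fun h => ht0' (Finset.mem_of_mem_erase (Finset.mem_filter.1 h).1)⟩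
    rw [← hI] at ih2
    obtain ⟨w, hw, hwD⟩ := exists_v (hqf.upd t0.1 t0.2)
    have hwI : w ∈ Aq q (T.erase t) ∩ Dq (fc q t) := by
      rw [hI]
      have := (mem_Dq_fc (hAdm t0 ht0f).1).1 hwD
      exact ⟨this.1, t0, ht0f, this.2⟩
    have zw := ih2 w hw hwI
    have zw1 := ih1 w hw hwI.1
    have zl : ∀ u, IsV u → u ∈ Dq (fc q t) → Z (Sp (X \ {u})) (Sp (X \ Dq (fc q t))) := fun u hu huD =>
      disc' hX hm hqf.G (hT t ht).2 huD (fun i _ => hu i)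
    have zw2 := zl w hw hwI.2
    have le0 : Sp (X \ (Aq q (T.erase t) ∩ Dq (fc q t))) ≤ Sp (X \ {w}) :=
      Sp_mono (Set.sdiff_subset_sdiff_right (Set.singleton_subset_iff.2 hwI))
    have le1 : Sp (X \ (Aq q (T.erase t))) ≤ Sp (X \ (Aq q (T.erase t) ∩ Dq (fc q t))) :=
      Sp_mono (Set.sdiff_subset_sdiff_right Set.inter_subset_left)
    have le2 : Sp (X \ Dq (fc q t)) ≤ Sp (X \ (Aq q (T.erase t) ∩ Dq (fc q t))) :=
      Sp_mono (Set.sdiff_subset_sdiff_right Set.inter_subset_right)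
    have za : Z (Sp (X \ (Aq q (T.erase t) ∩ Dq (fc q t)))) (Sp (X \ (Aq q (T.erase t)))) :=
      Z.right zw zw1 le0 le1 (Sp_isC _)
    have zb : Z (Sp (X \ (Aq q (T.erase t) ∩ Dq (fc q t)))) (Sp (X \ Dq (fc q t))) :=
      Z.right zw zw2 le0 le2 (Sp_isC _)
    have z1 := exc1 (Aq_closed _ _) (Dq_closed _) za
    have z2 := exc1 (Dq_closed _) (Aq_closed _ _) (by rw [Set.inter_comm]; exact zb)
    rw [Set.union_comm] at z2
    rw [hA] at hvA ⊢
    rcases hvA with h | h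
    · exact (ih1 v hv h).trans z2 (Sp_mono (Set.sdiff_subset_sdiff_right (Set.singleton_subset_iff.2 h)))
        (Sp_mono (Set.sdiff_subset_sdiff_right Set.subset_union_left))
    · exact (zl v hv h).trans z1 (Sp_mono (Set.sdiff_subset_sdiff_right (Set.singleton_subset_iff.2 h)))
        (Sp_mono (Set.sdiff_subset_sdiff_right Set.subset_union_right))

/-- all facets in given directions -/
def TC (C : Finset (Fin n)) : Finset (Fin n × Bool) := C ×ˢ Finset.univ

lemma mem_TC {C : Finset (Fin n)} {t : Fin n × Bool} : t ∈ TC C ↔ t.1 ∈ C := by simp [TC]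

lemma TC_ins {C : Finset (Fin n)} (c : Fin n) : TC (insert c C) = insert (c, true) (TC C) ∪ insert (c, false) (TC C) := by
  ext ⟨i, b⟩
  simp only [mem_TC, Finset.mem_insert, Finset.mem_union, Prod.mk.injEq]
  cases b
  · simp only [Bool.false_eq_true, and_false, false_or, and_true, reduceCtorEq]
    tauto
  · simp only [reduceCtorEq, and_false, false_or, and_true]
    tauto

lemma Aq_union {q : Fin n → Option ℝ} (T T' : Finset (Fin n × Bool)) : Aq q (T ∪ T') = Aq q T ∪ Aq q T' := by
  ext x
  simp only [Aq, Set.mem_ofPred_eq, Finset.mem_union, Set.mem_union]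
  constructor
  · rintro ⟨h, t, h1 | h1, h2⟩
    · exact Or.inl ⟨h, t, h1, h2⟩
    · exact Or.inr ⟨h, t, h1, h2⟩
  · rintro (⟨h, t, h1, h2⟩ | ⟨h, t, h1, h2⟩)
    · exact ⟨h, t, Or.inl h1, h2⟩
    · exact ⟨h, t, Or.inr h1, h2⟩

/-- half spheres -/
def TH (C : Finset (Fin n)) (c : Fin n) (b : Bool) : Finset (Fin n × Bool) := insert (c, b) (TC C)

lemma sph_data {X : Set (Fin n → ℝ)} (hX : Cub X) (hm : Nonempty (ChartedSpace (EuclideanSpace ℝ (Fin d)) ↥X))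
    {q : Fin n → Option ℝ} (hq : Vq q) {C : Finset (Fin n)} {c : Fin n} (hc : c ∉ C) (hA : Adm X q (TC (insert c C))) :
    (Aq q (TC (insert c C)) = Aq q (TH C c true) ∪ Aq q (TH C c false)) ∧
    (Aq q (TC C) = Aq q (TH C c true) ∩ Aq q (TH C c false)) ∧
    (∀ b v, IsV v → v ∈ Aq q (TH C c b) → Z (Sp (X \ {v})) (Sp (X \ Aq q (TH C c b)))) ∧
    (∀ b, ∃ v ∈ X, IsV v ∧ v ∈ Aq q (TH C c b)) := by
  have hmem : ∀ b, (c, b) ∈ TC (insert c C) := fun b => mem_TC.2 (Finset.mem_insert_self _ _)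
  have hsub : ∀ b, ∀ t ∈ TH C c b, t ∈ TC (insert c C) := by
    intro b t ht
    rw [TH, Finset.mem_insert] at ht
    rcases ht with rfl | ht
    · exact hmem b
    · exact mem_TC.2 (Finset.mem_insert_of_mem (mem_TC.1 ht))
  refine ⟨by rw [TC_ins, Aq_union]; rfl, ?_, ?_, ?_⟩
  · unfold TH
    rw [Aq_insert (hA _ (hmem true)).1, Aq_insert (hA _ (hmem false)).1]
    rw [← Set.union_inter_distrib_left]
    symm
    rw [Set.union_eq_left]
    rintro x ⟨h1, h2⟩
    have h1' := ((mem_Dq_fc (hA _ (hmem true)).1).1 h1).2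
    have h2' := ((mem_Dq_fc (hA _ (hmem false)).1).1 h2).2
    rw [h1'] at h2'
    exact absurd (β_inj h2') (by simp)
  · intro b v hv hvA
    refine Wlem hX hm _ q (TH C c b) rfl hq (fun t ht => hA t (hsub b t ht)) ⟨(c, b), by simp [TH], ?_⟩ v hv hvA
    simp only [TH, Finset.mem_insert, mem_TC, Prod.mk.injEq, true_and, not_or]
    exact ⟨by simp, hc⟩
  · intro b
    obtain ⟨v, hv, hvD⟩ := exists_v (hq.upd c b)
    have := hA _ (hmem b)
    refine ⟨v, this.2 v ?_ hvD, hv, ?_⟩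
    · intro i; rcases hv i with h | h <;> rw [h] <;> norm_num
    · have h2 := (mem_Dq_fc this.1).1 hvD
      exact ⟨h2.1, (c, b), by simp [TH], h2.2⟩

lemma half_hc {X : Set (Fin n → ℝ)} (hX : Cub X) (hm : Nonempty (ChartedSpace (EuclideanSpace ℝ (Fin d)) ↥X))
    {q : Fin n → Option ℝ} (hq : Vq q) {C : Finset (Fin n)} {c : Fin n} (hc' : c ∉ C) (hA : Adm X q (TC (insert c C))) (b : Bool)
    (k : ℕ) : hc k (Sp X) (Sp (X \ Aq q (TH C c b))) = if k = d + 1 then 2 else 1 := by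
  obtain ⟨_, _, h3, h4⟩ := sph_data hX hm hq hc' hA
  obtain ⟨v, hvX, hv, hvA⟩ := h4 b
  rw [hc_sub (h3 b v hv hvA) (Sp_mono (Set.sdiff_subset_sdiff_right (Set.singleton_subset_iff.2 hvA))) (Sp_mono Set.sdiff_subset)
    (Sp_isC _) (Sp_isC _), loc_hc hm hvX]

lemma Adm.mono {X : Set (Fin n → ℝ)} {q : Fin n → Option ℝ} {C : Finset (Fin n)} {c : Fin n} (hA : Adm X q (TC (insert c C))) :
    Adm X q (TC C) := fun t ht => hA t (mem_TC.2 (Finset.mem_insert_of_mem (mem_TC.1 ht)))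

lemma sph_a {X : Set (Fin n → ℝ)} (hX : Cub X) (hm : Nonempty (ChartedSpace (EuclideanSpace ℝ (Fin d)) ↥X))
    {q : Fin n → Option ℝ} (hq : Vq q) (C : Finset (Fin n)) :
    Adm X q (TC C) → ∀ k, k + C.card ≤ d + 1 → hc k (Sp X) (Sp (X \ Aq q (TC C))) = 1 := by
  induction C using Finset.induction_on with
  | empty =>
    intro _ k _
    have : Aq q (TC ∅) = ∅ := by simp [Aq, TC]
    rw [this, Set.sdiff_empty]
    exact hc_of_Z (Z.refl _)
  | insert c C hc ih =>
    intro hA k hk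
    rw [Finset.card_insert_of_notMem hc] at hk
    obtain ⟨h1, h2, h3, h4⟩ := sph_data hX hm hq hc hA
    rw [h1, Sp_diff_union]
    have hh : ∀ b, BF.hc k (Sp X) (Sp (X \ Aq q (TH C c b))) = 1 := by
      intro b; rw [half_hc hX hm hq hc hA, if_neg (by omega)]
    refine hc_mv (hh _) (hh _) ?_ (Sp_isC _) (Sp_mono Set.sdiff_subset) (Sp_isC _) (Sp_isC _)
    have hz := Z_exc X (Aq_closed q (TH C c true)) (Aq_closed q (TH C c false))
    rw [hc_sub hz (sup_le_diff _ _ _) (Sp_mono Set.sdiff_subset) (Sp_isC _) ((Sp_isC _).sup (Sp_isC _)), ← h2]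
    exact ih hA.mono (k+1) (by omega)

lemma sph_b {X : Set (Fin n → ℝ)} (hX : Cub X) (hm : Nonempty (ChartedSpace (EuclideanSpace ℝ (Fin d)) ↥X))
    {q : Fin n → Option ℝ} (hq : Vq q) (C : Finset (Fin n)) :
    Adm X q (TC C) → ∀ k, 2 ≤ C.card → k + C.card = d + 2 → hc k (Sp X) (Sp (X \ Aq q (TC C))) ≠ 1 := by
  induction C using Finset.induction_on with
  | empty =>
    intro _ k h2
    simp at h2
  | insert c C hc ih =>
    intro hA k hk2 hk
    rw [Finset.card_insert_of_notMem hc] at hk hk2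
    obtain ⟨h1, h2, h3, h4⟩ := sph_data hX hm hq hc hA
    rw [h1, Sp_diff_union]
    have hz := Z_exc X (Aq_closed q (TH C c true)) (Aq_closed q (TH C c false))
    by_cases hC : 2 ≤ C.card
    · have hh : ∀ b, BF.hc (k+1) (Sp X) (Sp (X \ Aq q (TH C c b))) = 1 := by
        intro b; rw [half_hc hX hm hq hc hA, if_neg (by omega)]
      refine hc_mv_inj (hh _) (hh _) ?_ (Sp_isC _) (Sp_mono Set.sdiff_subset) (Sp_mono Set.sdiff_subset) (Sp_isC _) (Sp_isC _)
      rw [hc_sub hz (sup_le_diff _ _ _) (Sp_mono Set.sdiff_subset) (Sp_isC _) ((Sp_isC _).sup (Sp_isC _)), ← h2]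
      exact ih hA.mono (k+1) hC (by omega)
    · have hC1 : C.card = 1 := by omega
      obtain ⟨c1, rfl⟩ := Finset.card_eq_one.1 hC1
      have hkd : k = d := by omega
      subst hkd
      have hmem : ∀ b, (c1, b) ∈ TC (insert c {c1}) := fun b => mem_TC.2 (by simp)
      have hmem' : ∀ b b', (c1, b) ∈ TH {c1} c b' := fun b b' => Finset.mem_insert_of_mem (mem_TC.2 (by simp))
      have hn : ∀ b, q (c1, b).1 = none := fun b => (hA _ (hmem b)).1
      have hAC : Aq q (TC {c1}) = Dq (fc q (c1, true)) ∪ Dq (fc q (c1, false)) := by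
        ext x
        rw [Set.mem_union, mem_Dq_fc (hn _), mem_Dq_fc (hn _)]
        constructor
        · rintro ⟨h, ⟨i, b⟩, ht, h'⟩
          have hi : i = c1 := by simpa [mem_TC] using ht
          subst hi
          cases b
          · exact Or.inr ⟨h, h'⟩
          · exact Or.inl ⟨h, h'⟩
        · rintro (⟨h, h'⟩ | ⟨h, h'⟩)
          · exact ⟨h, (c1, true), by simp [mem_TC], h'⟩
          · exact ⟨h, (c1, false), by simp [mem_TC], h'⟩
      have hdis : Dq (fc q (c1, true)) ∩ Dq (fc q (c1, false)) = ∅ := by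
        rw [Set.eq_empty_iff_forall_notMem]
        rintro x ⟨g1, g2⟩
        have g1' := ((mem_Dq_fc (hn _)).1 g1).2
        have g2' := ((mem_Dq_fc (hn _)).1 g2).2
        rw [g1'] at g2'
        exact absurd (β_inj g2') (by simp)
      have hsub : ∀ b b', Dq (fc q (c1, b)) ⊆ Aq q (TH {c1} c b') := by
        intro b b' x hx
        have := (mem_Dq_fc (hn _)).1 hx
        exact ⟨this.1, (c1, b), hmem' b b', this.2⟩
      have hvv : ∀ b, ∃ v ∈ X, IsV v ∧ v ∈ Dq (fc q (c1, b)) := by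
        intro b
        obtain ⟨v, hv, hvD⟩ := exists_v (hq.upd c1 b)
        exact ⟨v, (hA _ (hmem b)).2 v (fun i => by rcases hv i with h | h <;> rw [h] <;> norm_num) hvD, hv, hvD⟩
      have hd : ∀ b v, IsV v → v ∈ Dq (fc q (c1, b)) → Z (Sp (X \ {v})) (Sp (X \ Dq (fc q (c1, b)))) := fun b v hv hvD =>
        disc' hX hm (hq.upd _ _).G (hA _ (hmem b)).2 hvD (fun i _ => hv i)
      have hpz : ∀ b b', Z (Sp (X \ Dq (fc q (c1, b)))) (Sp (X \ Aq q (TH {c1} c b'))) := by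
        intro b b'
        obtain ⟨v, hvX, hv, hvD⟩ := hvv b
        exact Z.right (hd b v hv hvD) (h3 b' v hv (hsub b b' hvD)) (Sp_mono (Set.sdiff_subset_sdiff_right (Set.singleton_subset_iff.2 hvD)))
          (Sp_mono (Set.sdiff_subset_sdiff_right (hsub b b'))) (Sp_isC _)
      have hzx := Z_exc X (Dq_closed (fc q (c1, true))) (Dq_closed (fc q (c1, false)))
      rw [hdis, Set.sdiff_empty] at hzx
      rw [← h2] at hz
      have hle : ∀ b, Sp (X \ Aq q (TH {c1} c b)) ≤ Sp (X \ Aq q (TC {c1})) := by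
        intro b
        refine Sp_mono (Set.sdiff_subset_sdiff_right ?_)
        rw [hAC]
        exact Set.union_subset (hsub _ _) (hsub _ _)
      refine hc_base (Np := Sp (X \ Dq (fc q (c1, true)))) (Nq := Sp (X \ Dq (fc q (c1, false)))) (N := Sp (X \ Aq q (TC {c1})))
        (Sp_isC _) (Sp_isC _) (Sp_isC _) (Sp_isC _) (Sp_isC _) hzx (by rw [hAC, Sp_diff_union]) hz (hle _) (hle _)
        (Sp_mono Set.sdiff_subset) (Sp_mono Set.sdiff_subset) (hpz _ _) (hpz _ _) (hpz _ _) (hpz _ _) ?_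
      obtain ⟨v, hvX, hv, hvD⟩ := hvv true
      rw [hc_sub (hd true v hv hvD) (Sp_mono (Set.sdiff_subset_sdiff_right (Set.singleton_subset_iff.2 hvD))) (Sp_mono Set.sdiff_subset)
        (Sp_isC _) (Sp_isC _), loc_hc hm hvX, if_pos rfl]

end sph
end BF

set_option linter.unusedVariables false

namespace BF
open Finset

section fin
variable {n : ℕ}

/-- open star of a vertex -/
def St (w : Fin n → Bool) : Set (Fin n → ℝ) := {x | ∀ i, x i ≠ 1 - β (w i)}

lemma St_open (w : Fin n → Bool) : IsOpen (St w) := by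
  have : St w = ⋂ i, {x : Fin n → ℝ | x i ≠ 1 - β (w i)} := by ext x; simp [St]
  rw [this]
  exact isOpen_iInter_of_finite fun i => isOpen_ne_fun (continuous_apply i) continuous_const

lemma star_Z {X : Set (Fin n → ℝ)} (hX : Cub X) (v : Fin n → Bool) (T : Finset (Fin n → Bool)) (hv : v ∈ T)
    (hne : {x | x ∈ X ∧ ∀ w ∈ T, x ∈ St w}.Nonempty) : Z (Sp {x | x ∈ X ∧ ∀ w ∈ T, x ∈ St w}) ⊥ := by
  classical
  set b : Fin n → ℝ := fun i => if ∀ w ∈ T, w i = v i then β (v i) else 1/2 with hb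
  have hbc : ∀ i, 0 ≤ b i ∧ b i ≤ 1 := by
    intro i; simp only [hb]; split_ifs
    · exact β_01' _
    · norm_num
  have key : ∀ x ∈ X, (∀ w ∈ T, x ∈ St w) → ∀ t ∈ Set.Icc (0:ℝ) 1, (1 - t) • x + t • b ∈ {x | x ∈ X ∧ ∀ w ∈ T, x ∈ St w} := by
    intro x hx hxT t ht
    have hxc := hX.sub hx
    have e : ∀ i, ((1 - t) • x + t • b) i = (1 - t) * x i + t * b i := fun i => rfl
    have h0 : ∀ i, x i = 0 → b i = 0 := by
      intro i hi
      have : ∀ w ∈ T, w i = false := by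
        intro w hw
        by_contra h
        have h : w i = true := by simpa using h
        apply hxT w hw i
        rw [h, hi]; simp [β]
      simp only [hb]
      rw [if_pos (fun w hw => by rw [this w hw, this v hv]), this v hv]; simp [β]
    have h1 : ∀ i, x i = 1 → b i = 1 := by
      intro i hi
      have : ∀ w ∈ T, w i = true := by
        intro w hw
        by_contra h
        have h : w i = false := by simpa using h
        apply hxT w hw i
        rw [h, hi]; simp [β]
      simp only [hb]
      rw [if_pos (fun w hw => by rw [this w hw, this v hv]), this v hv]; simp [β]
    refine ⟨hX.st x hx _ ?_ ?_ ?_, ?_⟩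
    · intro i
      rw [e]
      have := hxc i; have := hbc i; have := ht.1; have := ht.2
      constructor <;> nlinarith
    · intro i hi; rw [e, hi, h0 i hi]; ring
    · intro i hi; rw [e, hi, h1 i hi]; ring
    · intro w hw i
      rw [e]
      have hxi := hxT w hw i
      have hxc := hxc i
      by_cases hall : ∀ w ∈ T, w i = v i
      · have : b i = β (w i) := by simp only [hb]; rw [if_pos hall, hall w hw]
        rw [this]
        cases hwi : w i
        · rw [hwi] at hxi
          simp only [β, Bool.false_eq_true, if_false] at hxi ⊢
          intro h
          apply hxi
          have := ht.1; have := ht.2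
          nlinarith
        · rw [hwi] at hxi
          simp only [β, if_true] at hxi ⊢
          intro h
          apply hxi
          have := ht.1; have := ht.2
          nlinarith
      · have hbi : b i = 1/2 := by simp only [hb]; rw [if_neg hall]
        have hx0 : x i ≠ 0 := fun h => by have := h0 i h; rw [hbi] at this; norm_num at this
        have hx1 : x i ≠ 1 := fun h => by have := h1 i h; rw [hbi] at this; norm_num at this
        have l0 : 0 < x i := lt_of_le_of_ne hxc.1 (Ne.symm hx0)
        have l1 : x i < 1 := lt_of_le_of_ne hxc.2 hx1
        rw [hbi]
        have := ht.1; have := ht.2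
        intro h
        rcases β_01 (w i) with h' | h' <;> rw [h'] at h
        · rcases eq_or_lt_of_le ht.1 with h2 | h2
          · rw [← h2] at h; linarith
          · nlinarith
        · rcases eq_or_lt_of_le ht.1 with h2 | h2
          · rw [← h2] at h; linarith
          · nlinarith
  obtain ⟨x, hx, hxT⟩ := hne
  refine Z_star (b := b) ?_ (fun x hx t ht => key x hx.1 hx.2 t ht)
  have := key x hx hxT 1 (by norm_num)
  simpa using this

lemma hc_finite_aux {X : Set (Fin n → ℝ)} (hX : Cub X) (T : Finset (Fin n → Bool)) : ∀ (T0 : Finset (Fin n → Bool)) (k : ℕ),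
    hc k (Sp {x | x ∈ X ∧ (∀ w ∈ T0, x ∈ St w) ∧ ∃ w ∈ T, x ∈ St w}) ⊥ ≠ 0 := by
  classical
  induction T using Finset.induction_on with
  | empty =>
    intro T0 k
    have : {x | x ∈ X ∧ (∀ w ∈ T0, x ∈ St w) ∧ ∃ w ∈ (∅ : Finset (Fin n → Bool)), x ∈ St w} = ∅ := by
      ext x; simp
    rw [this, hc_empty]
    split_ifs <;> norm_num
  | insert v T hv ih =>
    intro T0 k
    set A : Set (Fin n → ℝ) := {x | x ∈ X ∧ ∀ w ∈ insert v T0, x ∈ St w} with hA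
    set B : Set (Fin n → ℝ) := {x | x ∈ X ∧ (∀ w ∈ T0, x ∈ St w) ∧ ∃ w ∈ T, x ∈ St w} with hB
    have hU : {x | x ∈ X ∧ (∀ w ∈ T0, x ∈ St w) ∧ ∃ w ∈ insert v T, x ∈ St w} = A ∪ B := by
      ext x
      simp only [hA, hB, Set.mem_ofPred_eq, Set.mem_union, Finset.forall_mem_insert, Finset.exists_mem_insert]
      tauto
    rw [hU]
    rcases A.eq_empty_or_nonempty with hE | hE
    · rw [hE, Set.empty_union]; exact ih T0 k
    have hAZ := star_Z hX v (insert v T0) (Finset.mem_insert_self _ _) hE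
    have hsm : Z (Sp (A ∪ B)) (Sp A ⊔ Sp B) := by
      refine Z_small (O1 := St v) (O2 := ⋃ w ∈ T, St w) (St_open v) (isOpen_biUnion fun w _ => St_open w) ?_ ?_ ?_
      · rintro x ⟨h, h'⟩
        rcases h with h | h
        · exact h
        · exact ⟨h.1, Finset.forall_mem_insert _ _ _ |>.2 ⟨h', h.2.1⟩⟩
      · rintro x ⟨h, h'⟩
        simp only [Set.mem_iUnion, exists_prop] at h'
        rcases h with h | h
        · exact ⟨h.1, fun w hw => h.2 w (Finset.mem_insert_of_mem hw), h'⟩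
        · exact h
      · rintro x (h | h)
        · exact Or.inl (h.2 v (Finset.mem_insert_self _ _))
        · right
          simp only [Set.mem_iUnion, exists_prop]
          exact h.2.2
    rw [← hc_big hsm bot_le (sup_le (Sp_mono Set.subset_union_left) (Sp_mono Set.subset_union_right))
      ((Sp_isC _).sup (Sp_isC _)) (Sp_isC _)]
    refine hc_les (ih T0 k) ?_ le_sup_right bot_le ((Sp_isC _).sup (Sp_isC _)) (Sp_isC _)
    rw [← hc_exc (Sp_isC _) (Sp_isC _), ← Sp_inter]
    cases k with
    | zero => rw [hc_zero]; norm_num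
    | succ k =>
      rw [hc_bd hAZ bot_le (Sp_mono Set.inter_subset_left) (Sp_isC _) (Sp_isC _) IsC.bot]
      have : A ∩ B = {x | x ∈ X ∧ (∀ w ∈ insert v T0, x ∈ St w) ∧ ∃ w ∈ T, x ∈ St w} := by
        ext x
        simp only [hA, hB, Set.mem_ofPred_eq, Set.mem_inter_iff, Finset.forall_mem_insert]
        tauto
      rw [this]
      exact ih _ k

lemma hc_finite {X : Set (Fin n → ℝ)} (hX : Cub X) (k : ℕ) : hc k (Sp X) ⊥ ≠ 0 := by
  classical
  have := hc_finite_aux hX Finset.univ ∅ k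
  convert this using 3
  ext x
  simp only [Set.mem_ofPred_eq, Finset.notMem_empty, false_imp_iff, implies_true, true_and, Finset.mem_univ, iff_self_and]
  intro hx
  refine ⟨fun i => decide (x i = 1), fun i => ?_⟩
  by_cases h : x i = 1
  · simp [β, h]
  · simp [β, h]

end fin
end BF

set_option linter.unusedVariables false

namespace BF
open Finset CubeFace

section comb
variable {n m : ℕ}

/-- flip one coordinate -/
def fl (v : Fin n → Bool) (i : Fin n) : Fin n → Bool := Function.update v i (!v i)

lemma fl_self (v : Fin n → Bool) (i : Fin n) : fl v i i = !v i := by simp [fl]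
lemma fl_ne (v : Fin n → Bool) {i j : Fin n} (h : j ≠ i) : fl v i j = v j := by simp [fl, h]
lemma fl_fl (v : Fin n → Bool) (i : Fin n) : fl (fl v i) i = v := by
  funext j
  by_cases h : j = i
  · subst h; rw [fl_self, fl_self, Bool.not_not]
  · rw [fl_ne _ h, fl_ne _ h]
lemma fl_neq (v : Fin n → Bool) (i : Fin n) : fl v i ≠ v := by
  intro h
  have := congrFun h i
  rw [fl_self] at this
  cases hv : v i <;> rw [hv] at this <;> simp at this
lemma fl_inj {v : Fin n → Bool} {i j : Fin n} (h : fl v i = fl v j) : i = j := by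
  by_contra hij
  have := congrFun h i
  rw [fl_self, fl_ne _ hij] at this
  cases hv : v i <;> rw [hv] at this <;> simp at this

lemma fl_induct {P : (Fin n → Bool) → Prop} (h0 : P fun _ => false) (h1 : ∀ v i, P v → P (fl v i)) (v : Fin n → Bool) : P v := by
  classical
  have : ∀ s : Finset (Fin n), P (fun i => decide (i ∈ s)) := by
    intro s
    induction s using Finset.induction_on with
    | empty => simpa using h0
    | insert a s ha ih =>
      have := h1 _ a ih
      convert this using 1
      funext j
      by_cases hj : j = a
      · subst hj; rw [fl_self]; simp [ha]
      · rw [fl_ne _ hj]; simp [hj]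
  have h := this (Finset.univ.filter fun i => v i = true)
  simpa using h

lemma mem_verts {F : CubeFace n} {v : Fin n → Bool} : v ∈ verts F ↔ ∀ i b, F i = some b → v i = b := by
  constructor
  · intro h i b hb
    rcases h i with h' | h'
    · rw [h'] at hb; cases hb
    · have : some (v i) = some b := by rw [← hb, ← h']; rfl
      exact Option.some.inj this
  · intro h i
    cases hF : F i with
    | none => exact Or.inl rfl
    | some b => right; show some (v i) = some b; rw [h i b hF]

lemma verts_nonempty (F : CubeFace n) : (verts F).Nonempty :=
  ⟨fun i => (F i).getD false, mem_verts.2 fun i b h => by simp [h]⟩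

lemma verts_fl {F : CubeFace n} {v : Fin n → Bool} (hv : v ∈ verts F) {i : Fin n} (h : F i = none) : fl v i ∈ verts F := by
  rw [mem_verts] at *
  intro j b hj
  have : j ≠ i := by rintro rfl; rw [h] at hj; cases hj
  rw [fl_ne _ this]; exact hv j b hj

lemma le_of_verts {F G : CubeFace n} (h : verts F ⊆ verts G) : F ≤ G := by
  intro i
  cases hG : G i with
  | none => exact Or.inl rfl
  | some b =>
    right
    obtain ⟨v, hv⟩ := verts_nonempty F
    have h1 := mem_verts.1 (h hv) i b hG
    cases hF : F i with
    | none =>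
      have h2 := mem_verts.1 (h (verts_fl hv hF)) i b hG
      rw [fl_self, h1] at h2
      cases b <;> simp at h2
    | some c => rw [← mem_verts.1 hv i c hF, h1]

lemma verts_mono {F G : CubeFace n} (h : F ≤ G) : verts F ⊆ verts G := fun v hv => le_trans hv h

lemma verts_inj {F G : CubeFace n} (h : verts F = verts G) : F = G :=
  le_antisymm (le_of_verts h.le) (le_of_verts h.ge)

lemma mem_bdry_top {G : CubeFace m} : G ∈ boundaryCube m ↔ ∃ i b, G i = some b := by
  unfold boundaryCube
  constructor
  · intro h
    by_contra h'
    push Not at h'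
    apply h
    funext i
    cases hi : G i with
    | none => rfl
    | some b => exact absurd hi (h' i b)
  · rintro ⟨i, b, h⟩ h'
    rw [h'] at h; cases h

lemma iso_face {S : Set (CubeFace n)} (hm : 2 ≤ m) (hS : IsSubcomplex S) (hiso : Iso S (boundaryCube m)) :
    ∃ F : CubeFace n, dim F = m ∧ S = bdryHat F ∧ cvert S = verts F := by
  classical
  obtain ⟨f, hf, hW⟩ := hiso
  have hall : ∀ v, v ∈ cvert (boundaryCube m) := fun v => mem_bdry_top.2 ⟨⟨0, by omega⟩, _, rfl⟩
  have hex : ∀ v, ∃ u ∈ cvert S, f u = v := fun v => hf.surjOn (hall v)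
  choose g hgS hfg using hex
  have gf : ∀ u ∈ cvert S, g (f u) = u := fun u hu => hf.injOn (hgS _) hu (hfg _)
  have ginj : Function.Injective g := fun a b h => by rw [← hfg a, ← hfg b, h]
  have hface : ∀ G ∈ boundaryCube m, ∃ F ∈ S, verts F = g '' verts G := by
    intro G hG
    refine (hW (g '' verts G) ?_).2 ⟨G, hG, ?_⟩
    · rintro _ ⟨v, _, rfl⟩; exact hgS v
    · rw [Set.image_image]; simp [hfg]
  have hface' : ∀ F ∈ S, ∃ G ∈ boundaryCube m, verts F = g '' verts G := by
    intro F hF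
    have hsub : verts F ⊆ cvert S := fun v hv => hS.2 F hF _ hv
    obtain ⟨G, hG, h⟩ := (hW (verts F) hsub).1 ⟨F, hF, rfl⟩
    refine ⟨G, hG, ?_⟩
    rw [h, Set.image_image]
    ext u
    constructor
    · intro hu; exact ⟨u, hu, gf u (hsub hu)⟩
    · rintro ⟨u', hu', rfl⟩; show g (f u') ∈ _; rw [gf u' (hsub hu')]; exact hu'
  -- edges
  have hedge : ∀ v i, ∃ j, g (fl v i) = fl (g v) j := by
    intro v i
    set G : CubeFace m := fun j => if j = i then none else some (v j) with hG
    have hGi : G i = none := if_pos rfl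
    have hGj : ∀ j, j ≠ i → G j = some (v j) := fun j hj => if_neg hj
    have hGv : verts G = {v, fl v i} := by
      ext u
      rw [mem_verts]
      constructor
      · intro h
        have h' : ∀ j, j ≠ i → u j = v j := fun j hj => h j _ (hGj j hj)
        by_cases hu : u i = v i
        · left; funext j
          by_cases hj : j = i
          · rw [hj, hu]
          · exact h' j hj
        · right; funext j
          by_cases hj : j = i
          · rw [hj, fl_self]; cases h1 : u i <;> cases h2 : v i <;> simp_all
          · rw [fl_ne _ hj]; exact h' j hj
      · rintro (rfl | rfl) j b hb
        · by_cases hj : j = i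
          · rw [hj, hGi] at hb; cases hb
          · rw [hGj j hj] at hb; exact Option.some.inj hb
        · by_cases hj : j = i
          · rw [hj, hGi] at hb; cases hb
          · rw [hGj j hj] at hb; rw [fl_ne _ hj]; exact Option.some.inj hb
    have hGb : G ∈ boundaryCube m := by
      rw [mem_bdry_top]
      have : Nontrivial (Fin m) := Fin.nontrivial_iff_two_le.2 hm
      obtain ⟨j, hj⟩ := exists_ne i
      exact ⟨j, v j, hGj j hj⟩
    obtain ⟨F, hF, hFv⟩ := hface G hGb
    rw [hGv, Set.image_pair] at hFv
    have h1 : g v ∈ verts F := by rw [hFv]; exact Or.inl rfl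
    have h2 : g (fl v i) ∈ verts F := by rw [hFv]; exact Or.inr rfl
    have hne : g (fl v i) ≠ g v := fun h => fl_neq v i (ginj h)
    obtain ⟨j, hj⟩ := Function.ne_iff.1 hne
    have hFj : F j = none := by
      cases h : F j with
      | none => rfl
      | some b => exact absurd ((mem_verts.1 h2 j b h).trans (mem_verts.1 h1 j b h).symm) hj
    refine ⟨j, ?_⟩
    have h3 := verts_fl h1 hFj
    rw [hFv] at h3
    rcases h3 with h3 | h3
    · exact absurd h3 (fl_neq _ _)
    · exact h3.symm
  choose ψ hψ using hedge
  have hcomm : ∀ (v : Fin m → Bool) i j, fl (fl v i) j = fl (fl v j) i := by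
    intro v i j
    by_cases hij : i = j
    · rw [hij]
    · funext k
      by_cases h1 : k = i
      · subst h1; rw [fl_ne _ hij, fl_self, fl_self, fl_ne _ hij]
      · by_cases h2 : k = j
        · subst h2; rw [fl_self, fl_ne _ h1, fl_ne _ h1, fl_self]
        · rw [fl_ne _ h2, fl_ne _ h1, fl_ne _ h1, fl_ne _ h2]
  have hψinj : ∀ v i j, ψ v i = ψ v j → i = j := by
    intro v i j h
    have : g (fl v i) = g (fl v j) := by rw [hψ, hψ, h]
    exact fl_inj (ginj this)
  have hψc : ∀ v i j, ψ (fl v i) j = ψ v j := by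
    intro v i j
    by_cases hij : i = j
    · subst hij
      have h1 := hψ (fl v i) i
      rw [fl_fl, hψ v i] at h1
      have h2 : fl (fl (g v) (ψ v i)) (ψ v i) = fl (fl (g v) (ψ v i)) (ψ (fl v i) i) := by rw [fl_fl]; exact h1
      exact (fl_inj h2).symm
    · have e1 : g (fl (fl v i) j) = fl (fl (g v) (ψ v i)) (ψ (fl v i) j) := by rw [hψ, hψ]
      have e2 : g (fl (fl v i) j) = fl (fl (g v) (ψ v j)) (ψ (fl v j) i) := by rw [hcomm, hψ, hψ]
      have hab : ψ v i ≠ ψ v j := fun h => hij (hψinj v i j h)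
      have hac : ψ (fl v i) j ≠ ψ v i := by
        intro h
        rw [h, fl_fl] at e1
        have h3 := congrFun (ginj e1) j
        rw [fl_self, fl_ne _ (Ne.symm hij)] at h3
        cases hv : v j <;> rw [hv] at h3 <;> simp at h3
      by_contra hcb
      have h4 := congrFun (e1.symm.trans e2) (ψ (fl v i) j)
      have h5 := congrFun (e1.symm.trans e2) (ψ v i)
      rw [fl_ne _ (Ne.symm hac), fl_self] at h5
      by_cases hd : ψ v i = ψ (fl v j) i
      · rw [← hd] at h4
        rw [fl_self, fl_ne _ hac, fl_ne _ hac, fl_ne _ hcb] at h4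
        cases hv : g v (ψ (fl v i) j) <;> rw [hv] at h4 <;> simp at h4
      · rw [fl_ne _ hd, fl_ne _ hab] at h5
        cases hv : g v (ψ v i) <;> rw [hv] at h5 <;> simp at h5
  set o : Fin m → Bool := fun _ => false with ho
  set φ : Fin m → Fin n := ψ o with hφ
  have hφv : ∀ v, ∀ j, ψ v j = φ j := by
    intro v
    refine fl_induct (P := fun v => ∀ j, ψ v j = φ j) (fun j => rfl) ?_ v
    intro v i h j
    rw [hψc]; exact h j
  have hφinj : Function.Injective φ := fun i j h => hψinj o i j h
  have hg1 : ∀ v i, g v (φ i) = xor (g o (φ i)) (v i) := by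
    intro v
    refine fl_induct (P := fun v => ∀ i, g v (φ i) = xor (g o (φ i)) (v i)) ?_ ?_ v
    · intro i; show g o (φ i) = xor _ false; simp
    · intro v j h i
      rw [hψ, hφv]
      by_cases hij : i = j
      · subst hij; rw [fl_self, fl_self, h]; simp
      · rw [fl_ne _ (fun h => hij (hφinj h)), fl_ne _ hij, h]
  have hg2 : ∀ v k, (∀ i, φ i ≠ k) → g v k = g o k := by
    intro v
    refine fl_induct (P := fun v => ∀ k, (∀ i, φ i ≠ k) → g v k = g o k) ?_ ?_ v
    · intro k hk; rfl
    · intro v j h k hk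
      rw [hψ, hφv, fl_ne _ (Ne.symm (hk j)), h k hk]
  set F : CubeFace n := fun k => if ∃ i, φ i = k then none else some (g o k) with hF
  have hFφ : ∀ i, F (φ i) = none := fun i => if_pos ⟨i, rfl⟩
  have hFk : ∀ k, (∀ i, φ i ≠ k) → F k = some (g o k) := fun k hk => if_neg (by rintro ⟨i, hi⟩; exact hk i hi)
  have hgF : ∀ v, g v ∈ verts F := by
    intro v
    rw [mem_verts]
    intro k b hb
    by_cases hk : ∃ i, φ i = k
    · obtain ⟨i, rfl⟩ := hk; rw [hFφ] at hb; cases hb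
    · push Not at hk
      rw [hFk k hk] at hb
      rw [hg2 v k hk]; exact Option.some.inj hb
  have hFg : ∀ u ∈ verts F, ∃ v, g v = u := by
    intro u hu
    refine ⟨fun i => xor (g o (φ i)) (u (φ i)), ?_⟩
    funext k
    by_cases hk : ∃ i, φ i = k
    · obtain ⟨i, rfl⟩ := hk; rw [hg1]; simp
    · push Not at hk
      rw [hg2 _ k hk]; exact (mem_verts.1 hu k _ (hFk k hk)).symm
  refine ⟨F, ?_, ?_, ?_⟩
  · unfold dim
    have : (@Finset.filter _ (fun i => F i = none) (fun i => Option.instDecidableEq (F i) none) Finset.univ) = Finset.univ.image φ := by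
      ext k
      rw [Finset.mem_filter, Finset.mem_image]
      constructor
      · rintro ⟨_, h⟩
        by_contra hk
        push Not at hk
        rw [hFk k (fun i => hk i (Finset.mem_univ i))] at h; cases h
      · rintro ⟨i, _, rfl⟩; exact ⟨Finset.mem_univ _, hFφ i⟩
    rw [this, Finset.card_image_of_injective _ hφinj, Finset.card_univ, Fintype.card_fin]
  · ext G
    constructor
    · intro hG
      obtain ⟨G', hG', h⟩ := hface' G hG
      refine ⟨le_of_verts ?_, ?_⟩
      · rw [h]; rintro _ ⟨v, _, rfl⟩; exact hgF v
      · rintro rfl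
        obtain ⟨i, b, hi⟩ := mem_bdry_top.1 hG'
        have h1 := hgF (fun _ => !b)
        rw [h] at h1
        obtain ⟨v, hv, hv'⟩ := h1
        have := ginj hv'
        rw [this] at hv
        have := mem_verts.1 hv i b hi
        cases b <;> simp at this
    · rintro ⟨hle, hne⟩
      set G' : CubeFace m := fun i => (G (φ i)).map (fun b => xor (g o (φ i)) b) with hG'
      have hGb : G' ∈ boundaryCube m := by
        by_contra hcon
        rw [mem_bdry_top] at hcon
        push Not at hcon
        apply hne
        funext k
        by_cases hk : ∃ i, φ i = k
        · obtain ⟨i, rfl⟩ := hk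
          rw [hFφ]
          cases h : G (φ i) with
          | none => rfl
          | some b => exact absurd (by simp only [hG', h]; rfl) (hcon i (xor (g o (φ i)) b))
        · push Not at hk
          rcases hle k with h | h
          · rw [hFk k hk] at h; cases h
          · exact h
      have hmem : ∀ v, v ∈ verts G' ↔ g v ∈ verts G := by
        intro v
        rw [mem_verts, mem_verts]
        constructor
        · intro h k b hb
          by_cases hk : ∃ i, φ i = k
          · obtain ⟨i, rfl⟩ := hk
            rw [hg1, h i (xor (g o (φ i)) b) (by simp only [hG', hb]; rfl)]
            simp
          · push Not at hk
            rcases hle k with h' | h'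
            · rw [hFk k hk] at h'; cases h'
            · rw [h', hFk k hk] at hb; rw [hg2 v k hk]; exact Option.some.inj hb
        · intro h i b hb
          cases hGi : G (φ i) with
          | none => simp only [hG', hGi] at hb; cases hb
          | some c =>
            simp only [hG', hGi] at hb
            have hb' := Option.some.inj hb
            have := h _ _ hGi
            rw [hg1] at this
            rw [← hb', ← this]; simp
      obtain ⟨F', hF', h⟩ := hface G' hGb
      have : F' = G := by
        apply verts_inj
        rw [h]
        ext u
        constructor
        · rintro ⟨v, hv, rfl⟩; exact (hmem v).1 hv
        · intro hu
          obtain ⟨v, rfl⟩ := hFg u (verts_mono hle hu)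
          exact ⟨v, (hmem v).2 hu, rfl⟩
      rw [← this]; exact hF'
  · ext u
    constructor
    · intro hu; rw [← gf u hu]; exact hgF _
    · intro hu
      obtain ⟨v, rfl⟩ := hFg u hu
      exact hgS v

end comb

section bridge
variable {n : ℕ}

/-- carrier face -/
noncomputable def car (x : Fin n → ℝ) : CubeFace n := fun i =>
  if x i = 0 then some false else if x i = 1 then some true else none

lemma car_some {x : Fin n → ℝ} {i : Fin n} {b : Bool} : car x i = some b ↔ x i = β b := by
  unfold car β
  by_cases h0 : x i = 0
  · cases b <;> simp [h0]
  · by_cases h1 : x i = 1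
    · cases b <;> simp [h1]
    · cases b <;> simp [h0, h1]

lemma mem_real' {K : Set (CubeFace n)} {x : Fin n → ℝ} :
    x ∈ real K ↔ ∃ F ∈ K, x ∈ cube n ∧ ∀ i b, F i = some b → x i = β b := by
  unfold real
  simp only [Set.mem_iUnion, exists_prop, Set.mem_ofPred_eq]
  refine exists_congr fun F => and_congr_right fun _ => and_congr_right fun _ => forall_congr' fun i => ?_
  constructor
  · rintro ⟨h0, h1⟩ b hb
    cases b
    · simp [β, h0 hb]
    · simp [β, h1 hb]
  · intro h
    exact ⟨fun hb => by simp [h _ hb, β], fun hb => by simp [h _ hb, β]⟩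

lemma mem_real {K : Set (CubeFace n)} (hK : ∀ F ∈ K, ∀ G : CubeFace n, G ≤ F → G ∈ K) {x : Fin n → ℝ} :
    x ∈ real K ↔ x ∈ cube n ∧ car x ∈ K := by
  rw [mem_real']
  constructor
  · rintro ⟨F, hF, hx, h⟩
    refine ⟨hx, hK F hF _ fun i => ?_⟩
    cases hi : F i with
    | none => exact Or.inl rfl
    | some b => exact Or.inr (car_some.2 (h i b hi))
  · rintro ⟨hx, h⟩
    exact ⟨_, h, hx, fun i b hb => car_some.1 hb⟩

lemma real_Cub {K : Set (CubeFace n)} (hK : ∀ F ∈ K, ∀ G : CubeFace n, G ≤ F → G ∈ K) : Cub (real K) := by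
  constructor
  · intro x hx; exact ((mem_real hK).1 hx).1
  · intro x hx y hy h0 h1
    obtain ⟨_, hx⟩ := (mem_real hK).1 hx
    refine (mem_real hK).2 ⟨hy, hK _ hx _ fun i => ?_⟩
    cases hi : car x i with
    | none => exact Or.inl rfl
    | some b =>
      right
      rw [car_some] at hi ⊢
      cases b
      · simp only [β, Bool.false_eq_true, if_false] at hi ⊢; exact h0 i hi
      · simp only [β, if_true] at hi ⊢; exact h1 i hi

lemma verts_disj {A B : CubeFace n} : verts A ∩ verts B = ∅ ↔ ∃ i b b', A i = some b ∧ B i = some b' ∧ b ≠ b' := by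
  constructor
  · intro h
    by_contra hcon
    push Not at hcon
    have : (fun i => (A i).getD ((B i).getD false)) ∈ verts A ∩ verts B := by
      constructor
      · rw [mem_verts]; intro i b hb; simp [hb]
      · rw [mem_verts]; intro i b hb
        cases hA : A i with
        | none => simp [hA, hb]
        | some c => simpa [hA] using hcon i c b hA hb
    rw [h] at this; exact this
  · rintro ⟨i, b, b', hA, hB, hne⟩
    ext v
    simp only [Set.mem_inter_iff, Set.mem_empty_iff_false, iff_false, not_and]
    intro h1 h2
    exact hne ((mem_verts.1 h1 i b hA).symm.trans (mem_verts.1 h2 i b' hB))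

/-- pattern of a face -/
noncomputable def qF (F : CubeFace n) : Fin n → Option ℝ := fun i => (F i).map β

lemma qF_none {F : CubeFace n} {i : Fin n} : qF F i = none ↔ F i = none := by simp [qF]

lemma qF_some {F : CubeFace n} {i : Fin n} {a : ℝ} : qF F i = some a ↔ ∃ b, F i = some b ∧ β b = a := by simp [qF]

lemma qF_V (F : CubeFace n) : Vq (qF F) := by
  intro i a h
  obtain ⟨b, _, rfl⟩ := qF_some.1 h
  exact β_01 b

lemma mem_Dq_qF {F : CubeFace n} {x : Fin n → ℝ} : x ∈ Dq (qF F) ↔ ∀ i b, F i = some b → x i = β b := by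
  constructor
  · intro h i b hb; exact h i _ (qF_some.2 ⟨b, hb, rfl⟩)
  · intro h i a ha
    obtain ⟨b, hb, rfl⟩ := qF_some.1 ha
    exact h i b hb

lemma Pq_real {M S : Set (CubeFace n)} (hM : ∀ F ∈ M, ∀ G : CubeFace n, G ≤ F → G ∈ M) {F : CubeFace n}
    (hS : cvert S = verts F) : Pq (real M) (qF F) = real (delete M S) := by
  have hd : ∀ A ∈ delete M S, ∀ G : CubeFace n, G ≤ A → G ∈ delete M S := by
    rintro A ⟨hA, hA'⟩ G hG
    refine ⟨hM A hA G hG, ?_⟩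
    rw [Set.eq_empty_iff_forall_notMem] at hA' ⊢
    exact fun v hv => hA' v ⟨verts_mono hG hv.1, hv.2⟩
  ext x
  rw [mem_real hd]
  unfold Pq delete
  rw [Set.mem_ofPred_eq, Set.mem_ofPred_eq, mem_real hM, hS, verts_disj, and_assoc]
  refine and_congr_right fun _ => and_congr_right fun _ => ?_
  refine exists_congr fun i => ?_
  constructor
  · rintro ⟨a, ha, h01, hne⟩
    obtain ⟨b', hb', rfl⟩ := qF_some.1 ha
    rcases h01 with h | h
    · exact ⟨false, b', car_some.2 (by simp [β, h]), hb', by rintro rfl; exact hne (by simp [β, h])⟩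
    · exact ⟨true, b', car_some.2 (by simp [β, h]), hb', by rintro rfl; exact hne (by simp [β, h])⟩
  · rintro ⟨b, b', hb, hb', hne⟩
    rw [car_some] at hb
    refine ⟨β b', qF_some.2 ⟨b', hb', rfl⟩, ?_, ?_⟩
    · rw [hb]; exact β_01 b
    · rw [hb]; exact fun h => hne (β_inj h)

lemma main_hc {r : ℕ} (hr : 2 ≤ r) {M S : Set (CubeFace n)} (hM : ∀ F ∈ M, ∀ G : CubeFace n, G ≤ F → G ∈ M)
    (hm : Nonempty (ChartedSpace (EuclideanSpace ℝ (Fin (2 * r))) ↥(real M))) {F : CubeFace n} (hSM : S ⊆ M)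
    (hF : dim F = r + 1) (hSF : S = bdryHat F) (hS : cvert S = verts F) :
    hc r (Sp (real M)) (Sp (real (delete M S))) = 1 ∧
    (hc (r+1) (Sp (real M)) (Sp (real (delete M S))) = 1 ↔ F ∈ M) := by
  classical
  have hX := real_Cub hM
  have hz := Z_push_D hX (qF_V F).G
  rw [Pq_real hM hS] at hz
  have hsub : real (delete M S) ⊆ real M \ Dq (qF F) := by
    rw [← Pq_real hM hS]
    exact fun x hx => ⟨Pq_sub _ hx, Pq_Dq x hx⟩
  have hred : ∀ k, hc k (Sp (real M)) (Sp (real (delete M S))) = hc k (Sp (real M)) (Sp (real M \ Dq (qF F))) :=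
    fun k => hc_sub hz (Sp_mono hsub) (Sp_mono Set.sdiff_subset) (Sp_isC _) (Sp_isC _)
  rw [hred, hred]
  by_cases hFM : F ∈ M
  · have hD : ∀ x ∈ cube n, x ∈ Dq (qF F) → x ∈ real M := by
      intro x hx hxD
      exact mem_real'.2 ⟨F, hFM, hx, mem_Dq_qF.1 hxD⟩
    obtain ⟨v, hv, hvD⟩ := exists_v (qF_V F)
    have hvc : v ∈ cube n := by
      intro i; rcases hv i with h | h <;> rw [h] <;> norm_num
    have hz2 := disc' hX hm (qF_V F).G hD hvD (fun i _ => hv i)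
    have hk : ∀ k, k ≠ 2 * r + 1 → hc k (Sp (real M)) (Sp (real M \ Dq (qF F))) = 1 := by
      intro k hk
      rw [hc_sub hz2 (Sp_mono (Set.sdiff_subset_sdiff_right (Set.singleton_subset_iff.2 hvD))) (Sp_mono Set.sdiff_subset)
        (Sp_isC _) (Sp_isC _), loc_hc hm (hD v hvc hvD), if_neg hk]
    exact ⟨hk _ (by omega), iff_of_true (hk _ (by omega)) hFM⟩
  · set C : Finset (Fin n) := (@Finset.filter _ (fun i => F i = none) (fun i => Option.instDecidableEq (F i) none) Finset.univ) with hC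
    have hCm : ∀ i, i ∈ C ↔ F i = none := by intro i; exact (@Finset.mem_filter _ (fun i => F i = none) (fun i => Option.instDecidableEq (F i) none) _ _).trans (and_iff_right (Finset.mem_univ _))
    have hCc : C.card = r + 1 := hF
    have hdiff : real M \ Dq (qF F) = real M \ Aq (qF F) (TC C) := by
      ext x
      refine and_congr_right fun hx => not_congr ?_
      constructor
      · intro hD
        refine ⟨hD, ?_⟩
        by_contra hcon
        apply hFM
        have : car x = F := by
          funext i
          cases hi : F i with
          | some b => exact car_some.2 (mem_Dq_qF.1 hD i b hi)
          | none =>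
            cases hc : car x i with
            | none => rfl
            | some b => exact absurd ⟨(i, b), mem_TC.2 ((hCm i).2 hi), car_some.1 hc⟩ hcon
        rw [← this]
        exact ((mem_real hM).1 hx).2
      · intro h; exact h.1
    have hA : Adm (real M) (qF F) (TC C) := by
      rintro ⟨i, b⟩ ht
      rw [mem_TC, hCm] at ht
      have hq : qF F i = none := qF_none.2 ht
      refine ⟨hq, fun x hx hxD => ?_⟩
      rw [mem_Dq_fc hq] at hxD
      refine mem_real'.2 ⟨Function.update F i (some b), hSM ?_, hx, ?_⟩
      · rw [hSF]
        constructor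
        · intro j
          by_cases hj : j = i
          · left; rw [hj]; exact ht
          · right; exact Function.update_of_ne hj _ _
        · intro h
          have := congrFun h i
          rw [ht] at this
          have h2 : (some b : Option Bool) = none := by rw [← this]; exact (Function.update_self i (some b) F).symm
          cases h2
      · intro j c hc
        by_cases hj : j = i
        · subst hj
          have : some b = some c := by rw [← hc]; exact (Function.update_self j (some b) F).symm
          rw [← Option.some.inj this]; exact hxD.2
        · have : F j = some c := by rw [← hc]; exact (Function.update_of_ne hj _ F).symm
          exact mem_Dq_qF.1 hxD.1 j c this
    rw [hdiff]
    refine ⟨sph_a hX hm (qF_V F) C hA r (by omega), iff_of_false ?_ hFM⟩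
    exact sph_b hX hm (qF_V F) C hA (r+1) (by omega) (by omega)

end bridge
end BF

set_option linter.unusedVariables false

namespace BF
open Finset

section gen
variable {Ω : Type} [AddCommGroup Ω] [Module (ZMod 2) Ω]

/-- subquotient -/
def QQ (A A0 : Submodule (ZMod 2) Ω) : Type := ↥A ⧸ A0.comap A.subtype

noncomputable instance (A A0 : Submodule (ZMod 2) Ω) : AddCommGroup (QQ A A0) :=
  inferInstanceAs (AddCommGroup (↥A ⧸ A0.comap A.subtype))

noncomputable instance (A A0 : Submodule (ZMod 2) Ω) : Module (ZMod 2) (QQ A A0) :=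
  inferInstanceAs (Module (ZMod 2) (↥A ⧸ A0.comap A.subtype))

/-- projection to the subquotient -/
noncomputable def qmk (A A0 : Submodule (ZMod 2) Ω) : ↥A →ₗ[ZMod 2] QQ A A0 := (A0.comap A.subtype).mkQ

lemma qmk_surj {A A0 : Submodule (ZMod 2) Ω} (y : QQ A A0) : ∃ c, ∃ hc : c ∈ A, qmk A A0 ⟨c, hc⟩ = y := by
  obtain ⟨⟨c, hc⟩, h⟩ := Submodule.mkQ_surjective (A0.comap A.subtype) y
  exact ⟨c, hc, h⟩

lemma qmk_zero {A A0 : Submodule (ZMod 2) Ω} {c : Ω} {hc : c ∈ A} : qmk A A0 ⟨c, hc⟩ = 0 ↔ c ∈ A0 :=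
  Submodule.Quotient.mk_eq_zero (A0.comap A.subtype)

lemma qmk_eqq {A A0 : Submodule (ZMod 2) Ω} {c c' : Ω} {hc : c ∈ A} {hc' : c' ∈ A} :
    qmk A A0 ⟨c, hc⟩ = qmk A A0 ⟨c', hc'⟩ ↔ c - c' ∈ A0 :=
  Submodule.Quotient.eq (A0.comap A.subtype)

/-- induced map -/
noncomputable def qmap {A A0 B B0 : Submodule (ZMod 2) Ω} (h : A ≤ B) (h0 : A0 ≤ B0) : QQ A A0 →ₗ[ZMod 2] QQ B B0 :=
  Submodule.mapQ (A0.comap A.subtype) (B0.comap B.subtype) (Submodule.inclusion h) (fun c hc => h0 hc)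

lemma qmap_mk {A A0 B B0 : Submodule (ZMod 2) Ω} (h : A ≤ B) (h0 : A0 ≤ B0) (c : Ω) (hc : c ∈ A) :
    qmap h h0 (qmk A A0 ⟨c, hc⟩) = qmk B B0 ⟨c, h hc⟩ := rfl

lemma qc_card (A A0 : Submodule (ZMod 2) Ω) : qc A A0 = Nat.card (QQ A A0) := rfl

/-- comparison with an abstract subquotient -/
lemma QQ_equiv {P : Type} [AddCommGroup P] [Module (ZMod 2) P] {A A0 : Submodule (ZMod 2) Ω} (B B0 : Submodule (ZMod 2) P)
    (φ : P →ₗ[ZMod 2] Ω) (hi : Function.Injective φ) (h1 : ∀ x, φ x ∈ A ↔ x ∈ B) (h2 : ∀ y ∈ A, ∃ x, φ x = y)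
    (h3 : ∀ x ∈ B, (φ x ∈ A0 ↔ x ∈ B0)) : Nonempty (QQ A A0 ≃ₗ[ZMod 2] (↥B ⧸ B0.comap B.subtype)) := by
  let ψ : ↥B →ₗ[ZMod 2] ↥A := φ.restrict (fun x hx => (h1 x).2 hx)
  have hψ : Function.Bijective ψ := by
    constructor
    · intro a b hab
      exact Subtype.ext (hi (congrArg Subtype.val hab))
    · rintro ⟨y, hy⟩
      obtain ⟨x, rfl⟩ := h2 y hy
      exact ⟨⟨x, (h1 x).1 hy⟩, rfl⟩
  refine ⟨(Submodule.Quotient.equiv (B0.comap B.subtype) (A0.comap A.subtype) (LinearEquiv.ofBijective ψ hψ) ?_).symm⟩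
  ext ⟨y, hy⟩
  obtain ⟨⟨x, hx⟩, hxy⟩ := hψ.2 ⟨y, hy⟩
  rw [← hxy]
  constructor
  · rintro ⟨z, hz, hzx⟩
    have : z = ⟨x, hx⟩ := hψ.1 hzx
    subst this
    exact (h3 x hx).2 hz
  · intro h
    exact ⟨⟨x, hx⟩, (h3 x hx).1 h, rfl⟩

end gen

section alg
variable {C : Cos} {E : Type} {X A : Submodule (ZMod 2) (GCh C E)} {k : ℕ}

/-- homology group -/
abbrev HQ (k : ℕ) (V : Submodule (ZMod 2) (GCh C E)) : Type := QQ (rc k V ⊥) (rb V ⊥)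

lemma rc_mono (h : A ≤ X) : rc k A ⊥ ≤ rc k X ⊥ := fun c hc => by
    rw [mem_rc] at hc ⊢; exact ⟨⟨h hc.1.1, hc.1.2⟩, hc.2⟩

lemma rb_mono (h : A ≤ X) : rb A ⊥ ≤ rb X ⊥ := by
  intro c hc
  rw [mem_rb] at hc ⊢
  obtain ⟨e, he, h'⟩ := hc
  exact ⟨e, h he, h'⟩

/-- induced map on homology -/
noncomputable def HQMap (k : ℕ) (h : A ≤ X) : HQ k A →ₗ[ZMod 2] HQ k X :=
  qmap (rc_mono h) (rb_mono h)

lemma HQ_surj (h : A ≤ X) (hX : IsC X) (hA : IsC A) (h1 : hc k X A = 1) : Function.Surjective (HQMap k h) := by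
  intro y
  obtain ⟨c, hc, rfl⟩ := qmk_surj y
  obtain ⟨⟨hcX, hck⟩, hcb⟩ := mem_rc.1 hc
  obtain ⟨e, he, h'⟩ := hc_one.1 h1 c hcX hck (by rw [(Submodule.mem_bot _).1 hcb]; exact A.zero_mem)
  have h2 := hA.2 k _ h'
  rw [map_add, mem_Dg.1 hck, pr_bd] at h2
  have hmem : c + bd (pr (k+1) e) ∈ rc k A ⊥ := by
    refine mem_rc.2 ⟨⟨h2, Submodule.add_mem _ hck ?_⟩, ?_⟩
    · rw [← pr_bd]; exact pr_mem_Dg _ _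
    · rw [map_add, bd_bd, add_zero]; exact hcb
  refine ⟨qmk _ _ ⟨_, hmem⟩, ?_⟩
  refine qmk_eqq.2 ?_
  show c + bd (pr (k+1) e) - c ∈ rb X ⊥
  rw [add_sub_cancel_left]
  exact mem_rb.2 ⟨pr (k+1) e, hX.2 _ _ he, by rw [zz]; exact Submodule.zero_mem _⟩

lemma HQ_inj (h : A ≤ X) (hX : IsC X) (hA : IsC A) (h1 : hc (k+1) X A = 1) : Function.Injective (HQMap k h) := by
  rw [injective_iff_map_eq_zero]
  intro y
  obtain ⟨c, hc, rfl⟩ := qmk_surj y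
  intro h0
  obtain ⟨⟨hcA, hck⟩, hcb⟩ := mem_rc.1 hc
  have h0' : c ∈ rb X ⊥ := qmk_zero.1 h0
  obtain ⟨e, he, h2⟩ := mem_rb.1 h0'
  have h3 : c = bd e := eq_of_add ((Submodule.mem_bot _).1 h2)
  have h4 : c = bd (pr (k+1) e) := by rw [← pr_bd, ← h3, mem_Dg.1 hck]
  obtain ⟨e2, he2, h5⟩ := hc_one.1 h1 (pr (k+1) e) (hX.2 _ _ he) (pr_mem_Dg _ _) (by rw [← h4]; exact hcA)
  refine qmk_zero.2 ?_
  show c ∈ rb A ⊥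
  refine mem_rb.2 ⟨_, h5, ?_⟩
  rw [map_add, bd_bd, add_zero, ← h4, zz]
  exact Submodule.zero_mem _

lemma HQ_inj' (h : A ≤ X) (hX : IsC X) (hA : IsC A) (hz : hc (k+1) X ⊥ = 1) (hi : Function.Injective (HQMap k h)) : hc (k+1) X A = 1 := by
  rw [hc_one]
  intro e he hek heb
  have hbk : bd e ∈ Dg (C := C) (E := E) k := by
    rw [← mem_Dg.1 hek, ← pr_bd]; exact pr_mem_Dg _ _
  have hmem : bd e ∈ rc k A ⊥ := mem_rc.2 ⟨⟨heb, hbk⟩, by rw [bd_bd]; exact Submodule.zero_mem _⟩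
  have h0 : HQMap k h (qmk _ _ ⟨bd e, hmem⟩) = 0 := by
    refine qmk_zero.2 ?_
    show bd e ∈ rb X ⊥
    exact mem_rb.2 ⟨e, he, by rw [zz]; exact Submodule.zero_mem _⟩
  have h1 := (injective_iff_map_eq_zero _).1 hi _ h0
  have h2 : bd e ∈ rb A ⊥ := qmk_zero.1 h1
  obtain ⟨a, ha, h3⟩ := mem_rb.1 h2
  have h4 : bd e = bd a := eq_of_add ((Submodule.mem_bot _).1 h3)
  have h5 : bd e = bd (pr (k+1) a) := by rw [← pr_bd, ← h4, mem_Dg.1 hbk]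
  obtain ⟨x, hx, h6⟩ := hc_one.1 hz (e + pr (k+1) a) (X.add_mem he (h (hA.2 _ _ ha))) (Submodule.add_mem _ hek (pr_mem_Dg _ _))
    (by rw [map_add, ← h5, zz]; exact Submodule.zero_mem _)
  refine ⟨x, hx, ?_⟩
  rw [add_right_comm] at h6
  rw [eq_of_add ((Submodule.mem_bot _).1 h6)]
  exact hA.2 _ _ ha

lemma HQ_final (h : A ≤ X) (hX : IsC X) (hA : IsC A) (hs : hc k X A = 1) (hz : hc (k+1) X ⊥ = 1) (hf : hc k X ⊥ ≠ 0) :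
    Nonempty (HQ k A ≃ₗ[ZMod 2] HQ k X) ↔ hc (k+1) X A = 1 := by
  constructor
  · rintro ⟨e⟩
    apply HQ_inj' h hX hA hz
    have hfin : Finite (HQ k X) := Nat.finite_of_card_ne_zero hf
    have hfin' : Finite (HQ k A) := Finite.of_equiv _ e.symm.toEquiv
    have hsur : Function.Surjective (fun x => e.symm (HQMap k h x)) := e.symm.surjective.comp (HQ_surj h hX hA hs)
    have hinj := Finite.injective_iff_surjective.2 hsur
    intro a b hab
    exact hinj (by simp only [hab])
  · intro h1
    exact ⟨LinearEquiv.ofBijective (HQMap k h) ⟨HQ_inj h hX hA h1, HQ_surj h hX hA hs⟩⟩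

end alg
end BF

set_option linter.unusedVariables false

namespace BF
open Finset CategoryTheory

lemma homology_QQ (K : ChainComplex (ModuleCat.{0} (ZMod 2)) ℕ) (i : ℕ) :
    Nonempty ((K.homology (i+1) : ModuleCat (ZMod 2)) ≃ₗ[ZMod 2]
      (↥(LinearMap.ker (K.d (i+1) i).hom) ⧸ (LinearMap.range (K.d (i+2) (i+1)).hom).comap (LinearMap.ker (K.d (i+1) i).hom).subtype)) := by
  let S := K.sc' (i+2) (i+1) i
  have e1 : K.homology (i+1) ≅ S.homology := K.homologyIsoSc' (i+2) (i+1) i (by simp) (by simp)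
  have e2 : S.homology ≅ S.moduleCatLeftHomologyData.H := S.moduleCatHomologyIso
  have e3 : (K.homology (i+1) : ModuleCat (ZMod 2)) ≃ₗ[ZMod 2] (LinearMap.ker S.g.hom ⧸ LinearMap.range S.moduleCatToCycles) :=
    (e1 ≪≫ e2).toLinearEquiv
  have h : LinearMap.range S.moduleCatToCycles = (LinearMap.range S.f.hom).comap (LinearMap.ker S.g.hom).subtype := by
    ext ⟨x, hx⟩
    constructor
    · rintro ⟨y, hy⟩
      exact ⟨y, congrArg Subtype.val hy⟩
    · rintro ⟨y, hy⟩
      exact ⟨y, Subtype.ext hy⟩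
  exact ⟨e3.trans (Submodule.quotEquivOfEq _ _ h)⟩

section link
variable {n : ℕ} (A : Set (Fin n → ℝ))

/-- the simplicial set -/
noncomputable abbrev sA : SSet.{0} := TopCat.toSSet.obj (TopCat.of ↥A)

/-- the simplicial module -/
noncomputable abbrev mA : SimplicialObject (ModuleCat.{0} (ZMod 2)) :=
  ((SimplicialObject.whiskering _ _).obj (ModuleCat.free (ZMod 2))).obj (sA A)

/-- the chain complex -/
noncomputable abbrev kA : ChainComplex (ModuleCat.{0} (ZMod 2)) ℕ :=
  (AlgebraicTopology.alternatingFaceMapComplex (ModuleCat (ZMod 2))).obj (mA A)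

/-- simplices as generators -/
noncomputable def sg (j : ℕ) (s : (sA A).obj (Opposite.op (SimplexCategory.mk j))) : Σ k, stdSimplex ℝ (Fin k) → (Fin n → ℝ) :=
  ⟨j+1, fun t => ((TopCat.toSSetObjEquiv (TopCat.of ↥A) _ s) t : ↥A).1⟩

lemma sg_inj (j : ℕ) : Function.Injective (sg A j) := by
  intro s s' h
  have h2 := eq_of_heq (Sigma.mk.inj h).2
  apply (TopCat.toSSetObjEquiv (TopCat.of ↥A) _).injective
  ext1 t
  exact Subtype.ext (congrFun h2 t)

lemma sg_surj (j : ℕ) (σ : stdSimplex ℝ (Fin (j+1)) → (Fin n → ℝ)) (hσ : Continuous σ) (h : ∀ t, σ t ∈ A) :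
    ∃ s, sg A j s = ⟨j+1, σ⟩ := by
  refine ⟨(TopCat.toSSetObjEquiv (TopCat.of ↥A) (Opposite.op (SimplexCategory.mk j))).symm
    ⟨fun t => ⟨σ t, h t⟩, hσ.subtype_mk _⟩, ?_⟩
  unfold sg
  rw [Equiv.apply_symm_apply]
  rfl

lemma sg_cont (j : ℕ) (s) : Continuous (sg A j s).2 := 
  continuous_subtype_val.comp (TopCat.toSSetObjEquiv (TopCat.of ↥A) _ s).continuous

lemma sg_mem (j : ℕ) (s) (t) : (sg A j s).2 t ∈ A := 
  ((TopCat.toSSetObjEquiv (TopCat.of ↥A) _ s) t : ↥A).2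

lemma sg_δ (j : ℕ) (i : Fin (j+2)) (s : (sA A).obj (Opposite.op (SimplexCategory.mk (j+1)))) :
   sg A j ((sA A).δ i s) = ⟨j+1, (sg A (j+1) s).2 ∘ cD.δ (j+1) i⟩ := rfl

/-- comparison map -/
noncomputable def Ph (j : ℕ) : ((kA A).X j : ModuleCat (ZMod 2)) →ₗ[ZMod 2] Ch (Fin n → ℝ) :=
  Finsupp.lmapDomain (ZMod 2) (ZMod 2) (sg A j)

/-- basis elements -/
noncomputable def fm (j : ℕ) (s : (sA A).obj (Opposite.op (SimplexCategory.mk j))) : ((kA A).X j : ModuleCat (ZMod 2)) :=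
  (Finsupp.single s 1 : (sA A).obj (Opposite.op (SimplexCategory.mk j)) →₀ ZMod 2)

lemma fm_ind {j : ℕ} {P : ((kA A).X j : ModuleCat (ZMod 2)) → Prop} (x) (h0 : P 0) (ha : ∀ a b, P a → P b → P (a + b))
    (hg : ∀ s, P (fm A j s)) : P x := by
  have : ∀ y : (sA A).obj (Opposite.op (SimplexCategory.mk j)) →₀ ZMod 2, P y := by
    intro y
    induction y using Finsupp.induction_linear with
    | zero => exact h0
    | add a b h1 h2 => exact ha _ _ h1 h2
    | single s r =>
      have : r = 0 ∨ r = 1 := by revert r; decide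
      rcases this with rfl | rfl
      · rw [Finsupp.single_zero]; exact h0
      · exact hg s
  exact this x

lemma Ph_single (j : ℕ) (s) : Ph A j (fm A j s) = gen (C := cD) (sg A j s).1 (sg A j s).2 := by
  have := Finsupp.mapDomain_single (f := sg A j) (a := s) (b := (1 : ZMod 2))
  exact this

lemma kA_d (j : ℕ) : (kA A).d (j+1) j = ∑ i : Fin (j+2), (mA A).δ i := by
  rw [AlgebraicTopology.alternatingFaceMapComplex_obj_d]
  unfold AlgebraicTopology.AlternatingFaceMapComplex.objD
  refine Finset.sum_congr rfl (fun i _ => ?_)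
  have h2 : ∀ (X Y : ModuleCat.{0} (ZMod 2)) (f : X ⟶ Y), (-1 : ℤ) • f = f := by
    intro X Y f
    ext x
    rw [neg_smul, one_smul]
    show - f.hom x = f.hom x
    exact neg_eq_of_add_eq_zero_left (zz _)
  rcases neg_one_pow_eq_or ℤ (i : ℕ) with h | h
  · rw [h, one_smul]
  · rw [h, h2]

lemma δ_fm (j : ℕ) (i : Fin (j+2)) (s : (sA A).obj (Opposite.op (SimplexCategory.mk (j+1)))) :
    ((mA A).δ i).hom (fm A (j+1) s) = fm A j ((sA A).δ i s) := by
  have := Finsupp.mapDomain_single (f := (sA A).δ i) (a := s) (b := (1 : ZMod 2))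
  exact this

lemma d_fm (j : ℕ) (s : (sA A).obj (Opposite.op (SimplexCategory.mk (j+1)))) :
    ((kA A).d (j+1) j).hom (fm A (j+1) s) = ∑ i : Fin (j+2), fm A j ((sA A).δ i s) := by
  rw [kA_d]
  have h := ModuleCat.hom_sum (fun i : Fin (j+2) => (mA A).δ i) Finset.univ
  refine (congrArg (fun f => f (fm A (j+1) s)) h).trans ?_
  refine (LinearMap.sum_apply _ _ _).trans ?_
  exact Finset.sum_congr rfl (fun i _ => δ_fm A j i s)

lemma Ph_d (j : ℕ) (x : ((kA A).X (j+1) : ModuleCat (ZMod 2))) : Ph A j (((kA A).d (j+1) j).hom x) = bd (Ph A (j+1) x) := by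
  refine fm_ind A (P := fun x => Ph A j (((kA A).d (j+1) j).hom x) = bd (Ph A (j+1) x)) x ?_ ?_ ?_
  · simp only [map_zero]
  · intro a b h1 h2
    simp only [map_add, h1, h2]
  · intro s
    rw [d_fm, Ph_single, map_sum]
    refine Eq.trans ?_ (bd_gen_succ (C := cD) (j+1) (sg A (j+1) s).2).symm
    refine Finset.sum_congr rfl (fun i _ => ?_)
    rw [Ph_single]
    rfl

lemma Ph_inj (j : ℕ) : Function.Injective (Ph A j) := Finsupp.mapDomain_injective (sg_inj A j)

lemma Ph_mem (j : ℕ) (x) : Ph A j x ∈ Sp A ∧ Ph A j x ∈ Dg (C := cD) (E := Fin n → ℝ) (j+1) := by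
  refine fm_ind A (P := fun x => Ph A j x ∈ Sp A ∧ Ph A j x ∈ Dg (C := cD) (E := Fin n → ℝ) (j+1)) x ?_ ?_ ?_
  · rw [map_zero]; exact ⟨Submodule.zero_mem _, Submodule.zero_mem _⟩
  · intro a b h1 h2
    rw [map_add]
    exact ⟨Submodule.add_mem _ h1.1 h2.1, Submodule.add_mem _ h1.2 h2.2⟩
  · intro s
    rw [Ph_single]
    exact ⟨gen_mem_Sp (sg_cont A j s) (sg_mem A j s), gen_mem_Dg _ _⟩

lemma Ph_surj (j : ℕ) (c : Ch (Fin n → ℝ)) (h : c ∈ Sp A) (hd : c ∈ Dg (C := cD) (E := Fin n → ℝ) (j+1)) : ∃ x, Ph A j x = c := by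
  suffices ∃ x, Ph A j x = pr (j+1) c by
    rwa [mem_Dg.1 hd] at this
  clear hd
  refine Sp_ind (P := fun c => ∃ x, Ph A j x = pr (j+1) c) h ⟨0, by rw [map_zero, map_zero]⟩ ?_ ?_
  · rintro a b ⟨x, hx⟩ ⟨y, hy⟩
    exact ⟨x + y, by rw [map_add, map_add, hx, hy]⟩
  · intro k σ hσ hA
    by_cases hk : k = j + 1
    · subst hk
      obtain ⟨s, hs⟩ := sg_surj A j σ hσ hA
      refine ⟨fm A j s, ?_⟩
      rw [Ph_single, pr_gen_same, hs]
    · exact ⟨0, by rw [pr_gen_ne hk, map_zero]⟩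

lemma link (i : ℕ) : Nonempty (HQ (i+2) (Sp A) ≃ₗ[ZMod 2] (sHomology (ZMod 2) ↥A (i+1) : ModuleCat (ZMod 2))) := by
  obtain ⟨e⟩ := homology_QQ (kA A) i
  have := QQ_equiv (A := rc (i+2) (Sp A) ⊥) (A0 := rb (Sp A) ⊥) (LinearMap.ker ((kA A).d (i+1) i).hom) (LinearMap.range ((kA A).d (i+2) (i+1)).hom) (Ph A (i+1)) (Ph_inj A _) ?_ ?_ ?_
  · obtain ⟨f⟩ := this
    exact ⟨f.trans e.symm⟩
  · intro x
    rw [mem_rc, LinearMap.mem_ker, Submodule.mem_bot]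
    constructor
    · rintro ⟨_, h⟩
      rw [← Ph_d] at h
      exact Ph_inj A i (by rw [h, map_zero])
    · intro h
      exact ⟨Ph_mem A _ x, by rw [← Ph_d, h, map_zero]⟩
  · intro y hy
    rw [mem_rc] at hy
    exact Ph_surj A _ y hy.1.1 hy.1.2
  · intro x hx
    rw [mem_rb]
    constructor
    · rintro ⟨e, he, h⟩
      have h3 := eq_of_add ((Submodule.mem_bot _).1 h)
      have h4 : Ph A (i+1) x = bd (pr (i+3) e) := by
        rw [← pr_bd, ← h3, mem_Dg.1 (Ph_mem A _ x).2]
      obtain ⟨y, hy⟩ := Ph_surj A (i+2) (pr (i+3) e) ((Sp_isC A).2 _ _ he) (pr_mem_Dg _ _)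
      refine ⟨y, Ph_inj A _ ?_⟩
      rw [Ph_d, hy, h4]
    · rintro ⟨y, rfl⟩
      refine ⟨Ph A (i+2) y, (Ph_mem A _ y).1, ?_⟩
      rw [Ph_d, zz]
      exact Submodule.zero_mem _

end link
end BF

set_option linter.unusedVariables false

namespace BF
open CategoryTheory CubeFace

lemma cvert_bdryHat {n : ℕ} {F : CubeFace n} (h : dim F ≠ 0) : cvert (bdryHat F) = verts F := by
  ext v
  constructor
  · intro hv; exact hv.1
  · intro hv
    refine ⟨hv, fun h' => h ?_⟩
    rw [← h']
    unfold dim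
    rw [Finset.card_eq_zero, Finset.eq_empty_iff_forall_notMem]
    intro i hi
    have h3 := (@Finset.mem_filter _ _ (fun i => Option.instDecidableEq (toFace v i) none) _ _).1 hi
    cases h3.2

lemma iso_iff {A B : Type} [AddCommGroup A] [Module (ZMod 2) A] [AddCommGroup B] [Module (ZMod 2) B]
    {P Q : ModuleCat.{0} (ZMod 2)} (e : A ≃ₗ[ZMod 2] P) (f : B ≃ₗ[ZMod 2] Q) :
    Nonempty (P ≅ Q) ↔ Nonempty (A ≃ₗ[ZMod 2] B) := by
  constructor
  · rintro ⟨i⟩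
    exact ⟨(e.trans i.toLinearEquiv).trans f.symm⟩
  · rintro ⟨i⟩
    exact ⟨((e.symm.trans i).trans f).toModuleIso⟩

lemma real_delete_sub {n : ℕ} (M S : Set (CubeFace n)) : real (delete M S) ⊆ real M := by
  intro x hx
  simp only [real, Set.mem_iUnion] at hx ⊢
  obtain ⟨F, hF, h⟩ := hx
  exact ⟨F, hF.1, h⟩

end BF

open CubeFace in
/-- let `M ⊆ I^n` be a cubical manifold of dimension `d = 2r` (`r ≥ 2`)
with `H_r(|M|; ℤ/2) = 0`. A subcomplex `S ≅ ∂I^{r+1}` is the boundary of an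
`(r+1)`-face of `M` iff `H_{r−1}(|M ∖ S|; ℤ/2) ≅ H_{r−1}(|M|; ℤ/2)`. -/
theorem boundary_of_face_iff_homology_middle
    {n r : ℕ} (hr : 2 ≤ r)
    (M : Set (CubeFace n)) (hM : IsSubcomplex M) (hdim : HasDim M (2 * r))
    (hman : IsCompactManifold (↥(real M)) (2 * r))
    (hmid : Subsingleton (sHomology (ZMod 2) (↥(real M)) r))
    (S : Set (CubeFace n)) (hS : IsSubcomplex S) (hSM : S ⊆ M)
    (hiso : Iso S (boundaryCube (r + 1))) :
    (∃ F ∈ M, dim F = r + 1 ∧ S = bdryHat F) ↔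
    Nonempty (sHomology (ZMod 2) (↥(real (delete M S))) (r - 1) ≅
      sHomology (ZMod 2) (↥(real M)) (r - 1)) := by
  obtain ⟨F, hF, hSF, hSv⟩ := BF.iso_face (m := r + 1) (by omega) hS hiso
  obtain ⟨h1, h2⟩ := BF.main_hc hr hM.2 hman.2 hSM hF hSF hSv
  obtain ⟨q, rfl⟩ : ∃ q, r = q + 2 := ⟨r - 2, by omega⟩
  have hL : (∃ F ∈ M, dim F = q + 2 + 1 ∧ S = bdryHat F) ↔ F ∈ M := by
    constructor
    · rintro ⟨F', hF', hd, hS'⟩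
      have : F = F' := by
        apply BF.verts_inj
        rw [← hSv, hS', BF.cvert_bdryHat (by omega)]
      rw [this]; exact hF'
    · intro h
      exact ⟨F, h, hF, hSF⟩
  rw [hL, ← h2]
  obtain ⟨e0⟩ := BF.link (real M) (q + 1)
  have hz : BF.hc (q + 2 + 1) (BF.Sp (real M)) ⊥ = 1 := by
    have hs : Subsingleton (BF.HQ (q + 1 + 2) (BF.Sp (real M))) := by
      have : Subsingleton (sHomology (ZMod 2) (↥(real M)) (q + 1 + 1)) := hmid
      exact e0.toEquiv.subsingleton
    unfold BF.hc
    rw [BF.qc_card]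
    have := hs
    exact Nat.card_eq_one_iff_unique.2 ⟨hs, ⟨0⟩⟩
  obtain ⟨e1⟩ := BF.link (real M) q
  obtain ⟨e2⟩ := BF.link (real (delete M S)) q
  refine (BF.HQ_final (BF.Sp_mono (BF.real_delete_sub M S)) (BF.Sp_isC _) (BF.Sp_isC _) h1 hz
    (BF.hc_finite (BF.real_Cub hM.2) _)).symm.trans ?_
  exact (BF.iso_iff e2 e1).symm
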